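/- Let G₁ and G₂ be finitely presented groups. Assume that G₁ contains no subgroup isomorphic to the free group of rank 2, and that G₂ has a solvable subgroup of finite index and has finite Prüfer rank. Then there exists a finitely presented normal fibre product in G₁ × G₂ of co-rank min{rk G₁/G₁', rk G₂/G₂'}. -/

import Mathlib

/-- A group is finitely presented if it is the quotient of a finitely generated free group
by the normal closure of finitely many relators. -/
def FinitelyPresentedGroup (G : Type*) [Group G] : Prop :=
  ∃ (n : ℕ) (f : FreeGroup (Fin n) →* G) (S : Finset (FreeGroup (Fin n))),
    Function.Surjective f ∧ f.ker = Subgroup.normalClosure (S : Set (FreeGroup (Fin n)))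

/-- The torsion-free rank of the abelianization of `G`, i.e. `rk G/G'`. -/
noncomputable def rkAb (G : Type*) [Group G] : ℕ :=
  Module.finrank ℤ (Additive (Abelianization G))

/-- The torsion-free rank of the quotient `G ⧸ K` (for `K` a normal subgroup). -/
noncomputable def rkQuot {G : Type*} [Group G] (K : Subgroup G) (hK : K.Normal) : ℕ :=
  letI := hK
  rkAb (G ⧸ K)

/-- A group has finite Prüfer rank if there is an integer `r` such that every finitely
generated subgroup can be generated by at most `r` elements. -/
def FinitePruferRank (G : Type*) [Group G] : Prop :=
  ∃ r : ℕ, ∀ H : Subgroup G, H.FG →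
    ∃ S : Finset G, S.card ≤ r ∧ Subgroup.closure (S : Set G) = H


namespace FibProd

open Group Subgroup
open scoped commutatorElement

theorem fp_iff {G : Type*} [Group G] :
    FinitelyPresentedGroup G ↔ Group.IsFinitelyPresented G := by
  constructor
  · rintro ⟨n, f, S, hf, hS⟩
    exact ⟨n, f, hf, S, S.finite_toSet, hS.symm⟩
  · rintro ⟨n, f, hf, S, hS, h⟩
    exact ⟨n, f, hS.toFinset, hf, by rw [← h]; simp⟩

theorem fg_of_fp (G : Type*) [Group G] [h : IsFinitelyPresented G] : Group.FG G := by
  obtain ⟨n, f, hf, -⟩ := h.out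
  exact Group.fg_of_surjective hf

theorem ker_nfg {E G : Type*} [Group E] [Group G] [hE : Group.FG E] [hG : IsFinitelyPresented G]
    (p : E →* G) (hp : Function.Surjective p) : p.ker.IsFinitelyNormallyGenerated := by
  obtain ⟨n, f, hf, S, hSf, hS⟩ := hG.out
  obtain ⟨T, hT⟩ := hE.out
  let φ : FreeGroup (Fin n) →* E := FreeGroup.lift fun i => Function.surjInv hp (f (FreeGroup.of i))
  have hφ : p.comp φ = f := by
    ext i
    simp [φ, Function.surjInv_eq]
  have hφ' : ∀ w, p (φ w) = f w := fun w => by rw [← hφ]; rfl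
  let w : E → FreeGroup (Fin n) := fun e => Function.surjInv hf (p e)
  have hw : ∀ e, f (w e) = p e := fun e => Function.surjInv_eq hf _
  let R : Set E := φ '' S ∪ (fun e => e * (φ (w e))⁻¹) '' (T : Set E)
  have hRfin : R.Finite := (hSf.image _).union (T.finite_toSet.image _)
  refine ⟨R, hRfin, ?_⟩
  have hle : normalClosure R ≤ p.ker := by
    apply normalClosure_le_normal
    rintro x (⟨s, hs, rfl⟩ | ⟨e, he, rfl⟩)
    · have : s ∈ f.ker := by rw [← hS]; exact subset_normalClosure hs
      simpa [MonoidHom.mem_ker, hφ'] using this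
    · simp [MonoidHom.mem_ker, hφ', hw]
  apply le_antisymm hle
  intro e he
  have htop : normalClosure R ⊔ φ.range = ⊤ := by
    rw [eq_top_iff, ← hT, closure_le]
    intro e he
    have h1 : e * (φ (w e))⁻¹ ∈ normalClosure R := subset_normalClosure (Or.inr ⟨e, he, rfl⟩)
    have := mul_mem_sup h1 (show φ (w e) ∈ φ.range from ⟨_, rfl⟩)
    simpa using this
  have hmem : e ∈ normalClosure R ⊔ φ.range := htop ▸ mem_top e
  rw [Subgroup.mem_sup_of_normal_left] at hmem
  obtain ⟨k, hk, _, ⟨v, rfl⟩, rfl⟩ := hmem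
  apply mul_mem hk
  have hv : v ∈ f.ker := by
    have := mul_mem (inv_mem (hle hk)) he
    rw [inv_mul_cancel_left] at this
    rw [MonoidHom.mem_ker] at this ⊢
    rw [← hφ', this]
  rw [← hS] at hv
  have : normalClosure S ≤ (normalClosure R).comap φ := by
    apply normalClosure_le_normal
    intro s hs
    exact subset_normalClosure (Or.inl ⟨s, hs, rfl⟩)
  exact this hv

/-- Every subgroup of a finitely generated commutative group is finitely generated. -/
theorem fg_subgroup_comm {Q : Type*} [CommGroup Q] [hQ : Group.FG Q] (H : Subgroup Q) : H.FG := by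
  haveI : AddGroup.FG (Additive Q) := inferInstance
  haveI : Module.Finite ℤ (Additive Q) := Module.Finite.iff_addGroup_fg.2 inferInstance
  haveI : IsNoetherian ℤ (Additive Q) := inferInstance
  have h := IsNoetherian.noetherian (AddSubgroup.toIntSubmodule (Subgroup.toAddSubgroup H))
  rw [Subgroup.fg_iff_add_fg]
  rw [Submodule.fg_iff_addSubgroup_fg] at h
  simpa using h

theorem fp_of_comm_fg (Q : Type*) [CommGroup Q] [hQ : Group.FG Q] : IsFinitelyPresented Q := by
  obtain ⟨T, hT⟩ := hQ.out
  let R : Set (FreeGroup T) := Set.range fun ij : T × T => ⁅FreeGroup.of ij.1, FreeGroup.of ij.2⁆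
  haveI : Finite R := (Set.finite_range _)
  haveI hfp : IsFinitelyPresented (PresentedGroup R) := inferInstance
  have hc : ∀ x y : PresentedGroup R, x * y = y * x := by
    have h0 : ∀ i j : T, (PresentedGroup.of i : PresentedGroup R) * PresentedGroup.of j
        = PresentedGroup.of j * PresentedGroup.of i := by
      intro i j
      rw [← commutatorElement_eq_one_iff_mul_comm]
      have : PresentedGroup.mk R ⁅FreeGroup.of i, FreeGroup.of j⁆ = 1 :=
        PresentedGroup.one_of_mem ⟨(i, j), rfl⟩
      rw [map_commutatorElement] at this; exact this
    have hcl : closure (Set.range (PresentedGroup.of : T → PresentedGroup R)) = ⊤ :=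
      PresentedGroup.closure_range_of R
    have h1 : ∀ x : PresentedGroup R, ∀ i : T, x * PresentedGroup.of i = PresentedGroup.of i * x := by
      intro x i
      have : (⊤ : Subgroup (PresentedGroup R)) ≤ centralizer {PresentedGroup.of i} := by
        rw [← hcl, closure_le]
        rintro _ ⟨j, rfl⟩
        simp only [SetLike.mem_coe, mem_centralizer_singleton_iff]
        exact h0 _ _
      exact mem_centralizer_singleton_iff.1 (this (mem_top x))
    intro x y
    have : (⊤ : Subgroup (PresentedGroup R)) ≤ centralizer {x} := by
      rw [← hcl, closure_le]
      rintro _ ⟨j, rfl⟩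
      simp only [SetLike.mem_coe, mem_centralizer_singleton_iff]
      exact (h1 _ _).symm
    exact (mem_centralizer_singleton_iff.1 (this (mem_top y))).symm
  letI : CommGroup (PresentedGroup R) := { (inferInstance : Group (PresentedGroup R)) with mul_comm := hc }
  haveI : Group.FG (PresentedGroup R) := fg_of_fp _
  let f : PresentedGroup R →* Q := PresentedGroup.toGroup (f := fun i : T => (i : Q)) (by
    rintro _ ⟨ij, rfl⟩
    simp [map_commutatorElement, commutatorElement_eq_one_iff_mul_comm, mul_comm])
  have hf : Function.Surjective f := by
    rw [← MonoidHom.range_eq_top, eq_top_iff, ← hT, closure_le]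
    intro x hx
    exact ⟨PresentedGroup.of ⟨x, hx⟩, by simp [f]⟩
  refine IsFinitelyPresented.of_surjective f hf ?_
  haveI := (Group.fg_iff_subgroup_fg f.ker).2 (fg_subgroup_comm f.ker)
  exact IsFinitelyNormallyGenerated.of_FG f.ker

end FibProd

namespace FibProd

open Group Subgroup
open scoped commutatorElement

theorem noeth_lemma {V : Type*} [AddCommGroup V] (T : Set (Module.End ℤ V)) (hT : T.Finite)
    (hcomm : ∀ a ∈ T, ∀ b ∈ T, a * b = b * a) (S : Set V) (hS : S.Finite)
    (hgen : ∀ W : AddSubgroup V, S ⊆ W → (∀ a ∈ T, ∀ v ∈ W, a v ∈ W) → W = ⊤) (Y : Set V) :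
    ∃ Y' : Set V, Y'.Finite ∧ Y' ⊆ Y ∧ ∀ W : AddSubgroup V, Y' ⊆ W →
      (∀ a ∈ T, ∀ v ∈ W, a v ∈ W) → Y ⊆ W := by
  let R := Algebra.adjoin ℤ T
  letI : CommRing R := Algebra.adjoinCommRingOfComm ℤ hcomm
  haveI hft : Algebra.FiniteType ℤ R := by
    have h1 : R.FG := ⟨hT.toFinset, by simp [R]⟩
    exact R.fg_iff_finiteType.1 h1
  haveI : IsNoetherianRing R := Algebra.FiniteType.isNoetherianRing ℤ R
  have hspan : Submodule.span R S = ⊤ := by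
    have h := hgen (Submodule.span R S).toAddSubgroup (fun s hs => Submodule.subset_span hs) (by
      intro a ha v hv
      exact Submodule.smul_mem (Submodule.span R S) (⟨a, Algebra.subset_adjoin ha⟩ : R) hv)
    rw [eq_top_iff]
    intro x _
    have : x ∈ (Submodule.span R S).toAddSubgroup := by rw [h]; trivial
    exact this
  haveI : Module.Finite R V := ⟨⟨hS.toFinset, by simpa using hspan⟩⟩
  haveI : IsNoetherian R V := inferInstance
  have hfg : (Submodule.span R Y).FG := IsNoetherian.noetherian _
  obtain ⟨Y', hY', heq⟩ := (Submodule.fg_span_iff_fg_span_finset_subset Y).1 hfg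
  refine ⟨Y', Y'.finite_toSet, hY', fun W hW hst => ?_⟩
  have key : ∀ r ∈ R, ∀ v ∈ W, r v ∈ W := by
    intro r hr
    refine Algebra.adjoin_induction (p := fun r _ => ∀ v ∈ W, r v ∈ W) ?_ ?_ ?_ ?_ hr
    · exact fun a ha => hst a ha
    · intro z v hv
      have : (algebraMap ℤ (Module.End ℤ V) z) v = z • v := rfl
      rw [this]; exact W.zsmul_mem hv z
    · intro a b _ _ ha hb v hv
      exact W.add_mem (ha v hv) (hb v hv)
    · intro a b _ _ ha hb v hv
      exact ha _ (hb v hv)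
  let W' : Submodule R V := { W with smul_mem' := fun r v hv => key r r.2 v hv }
  have hle : Submodule.span R Y ≤ W' := by
    rw [heq, Submodule.span_le]; exact hW
  exact fun y hy => hle (Submodule.subset_span hy)

theorem nfg_of_abelian_action {D : Type*} [Group D] [hD : Group.FG D] (C Z : Subgroup D)
    [hC : C.Normal] [hZ : Z.Normal] (hZC : Z ≤ C) (hCfg : C.IsFinitelyNormallyGenerated)
    (hact : ∀ d d' : D, ∀ c ∈ C, ⁅⁅d, d'⁆, c⁆ ∈ ⁅C, C⁆)
    (hinter : Z ⊓ ⁅C, C⁆ = ⊥) : Z.IsFinitelyNormallyGenerated := by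
  obtain ⟨S, hSfin, hS⟩ := hCfg
  obtain ⟨T, hT⟩ := hD.out
  let V := Additive (Abelianization C)
  let E : D → Module.End ℤ V := fun d =>
    (MonoidHom.toAdditive (Abelianization.map (MulAut.conjNormal d : MulAut C).toMonoidHom)).toIntLinearMap
  let ι : C → V := fun c => Additive.ofMul (Abelianization.of c)
  have hE : ∀ d c, E d (ι c) = ι (MulAut.conjNormal d c) := fun d c => rfl
  have hι : ∀ c c', ι (c * c') = ι c + ι c' := fun c c' => rfl
  have hι1 : ι 1 = 0 := rfl
  have hιinv : ∀ c, ι c⁻¹ = - ι c := fun c => rfl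
  have hιsurj : Function.Surjective ι := fun v => QuotientGroup.mk_surjective v
  have hker : ∀ c : C, ι c = 0 ↔ (c : D) ∈ ⁅C, C⁆ := by
    intro c
    have h1 : ι c = 0 ↔ c ∈ commutator C := by
      rw [← Abelianization.ker_of, MonoidHom.mem_ker]; rfl
    rw [h1, ← Subgroup.map_subtype_commutator]
    simp
  have hEmul : ∀ d d', E (d * d') = E d * E d' := by
    intro d d'
    refine LinearMap.ext fun v => ?_
    obtain ⟨c, rfl⟩ := hιsurj v
    simp [hE]
  have hEcomm : ∀ d d', E d * E d' = E d' * E d := by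
    intro d d'
    rw [← hEmul, ← hEmul]
    refine LinearMap.ext fun v => ?_
    obtain ⟨c, rfl⟩ := hιsurj v
    rw [hE, hE, ← sub_eq_zero (G := V), sub_eq_add_neg, ← hιinv, ← hι, hker]
    have h := hact d d' _ (hC.conj_mem c c.2 (d' * d))
    convert h using 1
    simp [commutatorElement_def]
    group
  let T' : Set (Module.End ℤ V) := E '' ((T : Set D) ∪ (T : Set D)⁻¹)
  have hT' : T'.Finite := ((T.finite_toSet).union (T.finite_toSet.inv)).image _
  have hstab : ∀ W : AddSubgroup V, (∀ a ∈ T', ∀ v ∈ W, a v ∈ W) → ∀ d, ∀ v ∈ W, E d v ∈ W := by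
    intro W hW d
    have hd : d ∈ closure (T : Set D) := hT ▸ mem_top d
    induction hd using closure_induction'' with
    | mem x hx => exact hW _ ⟨x, Or.inl hx, rfl⟩
    | inv_mem x hx => exact hW _ ⟨x⁻¹, Or.inr (by simpa using hx), rfl⟩
    | one =>
      intro v hv
      have : E 1 v = v := by
        obtain ⟨c, rfl⟩ := hιsurj v
        simp [hE]
      rwa [this]
    | mul x y _ _ hx hy =>
      intro v hv
      rw [hEmul]
      exact hx _ (hy _ hv)
  have hSC : S ⊆ C := by rw [← hS]; exact subset_normalClosure
  -- pulling back stable subgroups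
  have pull : ∀ W : AddSubgroup V, (∀ d, ∀ v ∈ W, E d v ∈ W) → ∀ R : Set D, R ⊆ C →
      (∀ c : C, (c : D) ∈ R → ι c ∈ W) → ∀ c : C, (c : D) ∈ normalClosure R → ι c ∈ W := by
    intro W hW R hRC hR c hc
    let K : Subgroup D :=
      { carrier := {d | ∃ h : d ∈ C, ι ⟨d, h⟩ ∈ W}
        one_mem' := ⟨C.one_mem, W.zero_mem⟩
        mul_mem' := by
          rintro a b ⟨ha, ha'⟩ ⟨hb, hb'⟩
          exact ⟨C.mul_mem ha hb, W.add_mem ha' hb'⟩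
        inv_mem' := by
          rintro a ⟨ha, ha'⟩
          exact ⟨C.inv_mem ha, W.neg_mem ha'⟩ }
    haveI : K.Normal := ⟨by
      rintro a ⟨ha, ha'⟩ g
      exact ⟨hC.conj_mem a ha g, hW g _ ha'⟩⟩
    have hle : normalClosure R ≤ K := normalClosure_le_normal (fun d hd => ⟨hRC hd, hR _ hd⟩)
    exact (hle hc).2
  let Sι : Set V := ι '' {c : C | (c : D) ∈ S}
  have hSι : Sι.Finite := (hSfin.preimage (Subtype.val_injective.injOn)).image _
  obtain ⟨Y', hY'fin, hY'sub, hY'⟩ := noeth_lemma T' hT'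
    (by rintro _ ⟨a, _, rfl⟩ _ ⟨b, _, rfl⟩; exact hEcomm a b) Sι hSι (by
      intro W hW hst
      rw [eq_top_iff]
      intro v _
      obtain ⟨c, rfl⟩ := hιsurj v
      exact pull W (hstab W hst) S hSC (fun c hc => hW ⟨c, hc, rfl⟩) c (by rw [hS]; exact c.2))
    (ι '' {c : C | (c : D) ∈ Z})
  obtain ⟨P, hPsub, rfl⟩ := Set.subset_image_iff.1 hY'sub
  obtain ⟨P', hP'sub, hP'fin, hP'eq⟩ : ∃ P' : Set C, P' ⊆ P ∧ P'.Finite ∧ ι '' P' = ι '' P := by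
    obtain ⟨P', hP', h⟩ := Set.exists_subset_bijOn P ι
    refine ⟨P', hP', ?_, h.image_eq⟩
    exact Set.Finite.of_finite_image (by rw [h.image_eq]; exact hY'fin) h.injOn
  refine ⟨Subtype.val '' P', hP'fin.image _, ?_⟩
  have hle : normalClosure (Subtype.val '' P') ≤ Z := by
    apply normalClosure_le_normal
    rintro _ ⟨c, hc, rfl⟩
    exact hPsub (hP'sub hc)
  apply le_antisymm hle
  let N := normalClosure (Subtype.val '' P')
  let W : AddSubgroup V :=
    { carrier := ι '' {c : C | (c : D) ∈ N}
      zero_mem' := ⟨1, N.one_mem, hι1⟩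
      add_mem' := by
        rintro _ _ ⟨a, ha, rfl⟩ ⟨b, hb, rfl⟩
        exact ⟨a * b, N.mul_mem ha hb, hι _ _⟩
      neg_mem' := by
        rintro _ ⟨a, ha, rfl⟩
        exact ⟨a⁻¹, N.inv_mem ha, hιinv _⟩ }
  have hYW := hY' W (by
    rw [← hP'eq]
    rintro _ ⟨c, hc, rfl⟩
    exact ⟨c, subset_normalClosure ⟨c, hc, rfl⟩, rfl⟩) (by
    rintro _ ⟨d, _, rfl⟩ _ ⟨c, hc, rfl⟩
    exact ⟨MulAut.conjNormal d c, (normalClosure_normal (s := Subtype.val '' P')).conj_mem c hc d, (hE _ _).symm⟩)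
  intro z hz
  obtain ⟨c, hc, hcz⟩ := hYW ⟨⟨z, hZC hz⟩, hz, rfl⟩
  have h0 : ι (c⁻¹ * ⟨z, hZC hz⟩) = 0 := by rw [hι, hιinv, hcz]; exact neg_add_cancel _
  rw [hker] at h0
  have h1 : ((c⁻¹ * ⟨z, hZC hz⟩ : C) : D) ∈ Z ⊓ ⁅C, C⁆ :=
    ⟨Z.mul_mem (Z.inv_mem (hle hc)) hz, h0⟩
  rw [hinter, mem_bot] at h1
  have : z = c := by
    have := inv_mul_eq_one.1 h1
    exact this.symm
  rw [this]; exact hc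

end FibProd

namespace FibProd

open Group Subgroup
open scoped commutatorElement

theorem exists_section_of_free {C F : Type*} [Group C] [Group F] [IsFreeGroup F]
    (π : C →* F) (hπ : Function.Surjective π) : ∃ s : F →* C, ∀ f, π (s f) = f := by
  let s : F →* C := IsFreeGroup.lift (fun i => Function.surjInv hπ (IsFreeGroup.of i))
  refine ⟨s, fun f => ?_⟩
  have : π.comp s = MonoidHom.id F := by
    apply IsFreeGroup.ext_hom
    intro i
    simp [s, Function.surjInv_eq]
  exact DFunLike.congr_fun this f

theorem lemmaZ {Γ G₁ Q τ : Type*} [Group Γ] [Group G₁] [CommGroup Q] [Finite τ]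
    [IsFinitelyPresented G₁] (A B : Subgroup Γ) [hAn : A.Normal] [hBn : B.Normal]
    (hAB : ∀ a ∈ A, ∀ b ∈ B, a * b = b * a) (q₁ : Γ →* G₁) (hq₁ : Function.Surjective q₁)
    (hker : q₁.ker = B) (h : FreeGroup τ →* Γ) (X : Set Γ) (hX : X.Finite)
    (hA : A = closure {y | ∃ f, ∃ x ∈ X, y = h f * x * (h f)⁻¹})
    (hΓ : ∀ γ, ∃ a ∈ A, ∃ b ∈ B, ∃ f, γ = a * b * h f)
    (θ : Γ →* Q) (hθ : ∀ γ, θ γ = 1 → γ ∈ A ⊔ B) :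
    (A ⊓ B).IsFinitelyNormallyGenerated := by
  let D : Subgroup (Γ × FreeGroup τ) :=
    { carrier := {p | p.1 * (h p.2)⁻¹ ∈ A}
      one_mem' := by simp
      mul_mem' := by
        rintro ⟨a, f⟩ ⟨b, g⟩ ha hb
        simp only [Set.mem_setOf_eq, Prod.mk_mul_mk, map_mul, mul_inv_rev] at *
        have := A.mul_mem ha (hAn.conj_mem _ hb (h f))
        convert this using 1
        group
      inv_mem' := by
        rintro ⟨a, f⟩ ha
        simp only [Set.mem_setOf_eq, Prod.inv_mk, map_inv, inv_inv] at *
        have := hAn.conj_mem _ (A.inv_mem ha) ((h f)⁻¹)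
        convert this using 1
        group }
  have hDmem : ∀ p : Γ × FreeGroup τ, p ∈ D ↔ p.1 * (h p.2)⁻¹ ∈ A := fun p => Iff.rfl
  haveI hDfg : Group.FG D := by
    rw [Group.fg_iff_subgroup_fg, Subgroup.fg_iff]
    refine ⟨(fun x => ((x, 1) : Γ × FreeGroup τ)) '' X ∪
      Set.range (fun i : τ => ((h (FreeGroup.of i), FreeGroup.of i) : Γ × FreeGroup τ)), ?_,
      (hX.image _).union (Set.finite_range _)⟩
    set K := closure ((fun x => ((x, 1) : Γ × FreeGroup τ)) '' X ∪
      Set.range (fun i : τ => ((h (FreeGroup.of i), FreeGroup.of i) : Γ × FreeGroup τ))) with hK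
    apply le_antisymm
    · rw [hK, closure_le]
      rintro _ (⟨x, hx, rfl⟩ | ⟨i, rfl⟩)
      · change x * (h 1)⁻¹ ∈ A
        rw [hA]
        exact subset_closure ⟨1, x, hx, by simp⟩
      · change h _ * (h _)⁻¹ ∈ A
        simp
    · have hF : ∀ f, ((h f, f) : Γ × FreeGroup τ) ∈ K := by
        intro f
        have : (⊤ : Subgroup (FreeGroup τ)) ≤ K.comap (h.prod (MonoidHom.id _)) := by
          rw [← FreeGroup.closure_range_of, closure_le]
          rintro _ ⟨i, rfl⟩
          exact subset_closure (Or.inr ⟨i, rfl⟩)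
        exact this (mem_top f)
      have hAK : ∀ a ∈ A, ((a, 1) : Γ × FreeGroup τ) ∈ K := by
        have : A ≤ K.comap (MonoidHom.inl Γ (FreeGroup τ)) := by
          rw [hA, closure_le]
          rintro _ ⟨f, x, hx, rfl⟩
          have h1 : ((x, 1) : Γ × FreeGroup τ) ∈ K := subset_closure (Or.inl ⟨x, hx, rfl⟩)
          have := K.mul_mem (K.mul_mem (hF f) h1) (K.inv_mem (hF f))
          simpa using this
        exact fun a ha => this ha
      rintro ⟨γ, f⟩ hp
      have := K.mul_mem (hAK _ hp) (hF f)
      simpa using this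
  let φ : D →* G₁ := (q₁.comp (MonoidHom.fst Γ (FreeGroup τ))).comp D.subtype
  have hφ : Function.Surjective φ := by
    intro g
    obtain ⟨γ, rfl⟩ := hq₁ g
    obtain ⟨a, ha, b, hb, f, rfl⟩ := hΓ γ
    refine ⟨⟨(a * h f, f), by simp [hDmem, ha]⟩, ?_⟩
    change q₁ (a * h f) = _
    rw [map_mul, map_mul, map_mul, (by rw [← hker] at hb; exact hb : q₁ b = 1), mul_one]
  let C : Subgroup D := φ.ker
  have hCmem : ∀ d : D, d ∈ C ↔ d.1.1 ∈ B := by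
    intro d
    rw [← hker]; rfl
  let Z : Subgroup D :=
    { carrier := {d | d.1.1 ∈ A ⊓ B ∧ d.1.2 = 1}
      one_mem' := ⟨one_mem _, rfl⟩
      mul_mem' := by
        rintro a b ⟨ha, ha'⟩ ⟨hb, hb'⟩
        exact ⟨mul_mem ha hb, by simp [ha', hb']⟩
      inv_mem' := by
        rintro a ⟨ha, ha'⟩
        exact ⟨inv_mem ha, by simp [ha']⟩ }
  have hZmem : ∀ d : D, d ∈ Z ↔ d.1.1 ∈ A ⊓ B ∧ d.1.2 = 1 := fun d => Iff.rfl
  haveI : Z.Normal := ⟨by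
    rintro a ⟨ha, ha'⟩ g
    exact ⟨Normal.conj_mem inferInstance _ ha _, by simp [ha']⟩⟩
  have hZC : Z ≤ C := fun d hd => (hCmem d).2 hd.1.2
  have hCnfg : C.IsFinitelyNormallyGenerated := ker_nfg φ hφ
  have hact : ∀ d d' : D, ∀ c ∈ C, ⁅⁅d, d'⁆, c⁆ ∈ ⁅C, C⁆ := by
    intro d d' c hc
    set e := ⁅d, d'⁆ with he
    have h1 : θ e.1.1 = 1 := by
      have : (e : Γ × FreeGroup τ).1 = ⁅d.1.1, d'.1.1⁆ := rfl
      rw [this, map_commutatorElement, commutatorElement_eq_one_iff_mul_comm, mul_comm]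
    have h2 := hθ _ h1
    rw [Subgroup.mem_sup_of_normal_left] at h2
    obtain ⟨a, ha, b, hb, hab⟩ := h2
    have heA : e.1.1 * (h e.1.2)⁻¹ ∈ A := e.2
    have hbD : ((b, e.1.2) : Γ × FreeGroup τ) ∈ D := by
      rw [hDmem]
      have := A.mul_mem (A.inv_mem ha) heA
      rw [← hab] at this
      simpa [mul_assoc] using this
    have haD : ((a, 1) : Γ × FreeGroup τ) ∈ D := by
      rw [hDmem]; simpa using ha
    have hed : e = ⟨_, haD⟩ * ⟨_, hbD⟩ := by
      apply Subtype.ext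
      apply Prod.ext
      · exact hab.symm
      · simp
    have hbC : (⟨_, hbD⟩ : D) ∈ C := (hCmem _).2 hb
    have hcomm : ∀ c' ∈ C, (⟨_, haD⟩ : D) * c' = c' * ⟨_, haD⟩ := by
      intro c' hc'
      apply Subtype.ext
      apply Prod.ext
      · exact hAB a ha _ ((hCmem _).1 hc')
      · simp
    have h3 : ⁅e, c⁆ = ⁅(⟨_, hbD⟩ : D), c⁆ := by
      have h4 := hcomm _ (C.mul_mem (C.mul_mem hbC hc) (C.inv_mem hbC))
      refine (congrArg (fun x => ⁅x, c⁆) hed).trans ?_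
      rw [commutatorElement_def, commutatorElement_def, mul_inv_rev]
      have h5 : ∀ x y z : D, x * (y * z * y⁻¹) = (y * z * y⁻¹) * x →
          x * y * z * (y⁻¹ * x⁻¹) * z⁻¹ = y * z * y⁻¹ * z⁻¹ := by
        intro x y z hxy
        calc x * y * z * (y⁻¹ * x⁻¹) * z⁻¹ = (x * (y * z * y⁻¹)) * x⁻¹ * z⁻¹ := by group
          _ = _ := by rw [hxy]; group
      exact h5 _ _ _ h4
    rw [h3]
    exact commutator_mem_commutator hbC hc
  have hinter : Z ⊓ ⁅C, C⁆ = ⊥ := by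
    let pr : C →* FreeGroup τ := ((MonoidHom.snd Γ (FreeGroup τ)).comp D.subtype).comp C.subtype
    haveI : IsFreeGroup pr.range := subgroupIsFreeOfIsFree _
    obtain ⟨s, hs⟩ := exists_section_of_free pr.rangeRestrict pr.rangeRestrict_surjective
    have hs' : ∀ f : pr.range, (s f).1.1.2 = f.1 := fun f => congrArg Subtype.val (hs f)
    let r : C → Γ := fun c => c.1.1.1 * ((s (pr.rangeRestrict c)).1.1.1)⁻¹
    have hrZ : ∀ c, r c ∈ A ⊓ B := by
      intro c
      refine ⟨?_, ?_⟩
      · have h1 : c.1.1.1 * (h c.1.1.2)⁻¹ ∈ A := c.1.2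
        have h2 : (s (pr.rangeRestrict c)).1.1.1 * (h (s (pr.rangeRestrict c)).1.1.2)⁻¹ ∈ A :=
          (s (pr.rangeRestrict c)).1.2
        rw [hs'] at h2
        have := A.mul_mem h1 (A.inv_mem h2)
        have h3 : ((pr.rangeRestrict c : pr.range) : FreeGroup τ) = c.1.1.2 := rfl
        rw [h3] at this
        convert this using 1
        simp [r]
      · exact B.mul_mem ((hCmem _).1 c.2) (B.inv_mem ((hCmem _).1 (s _).2))
    let ρ : C →* Γ := MonoidHom.mk' r (by
      intro c c'
      have h1 : r c' * (s (pr.rangeRestrict c)).1.1.1 = (s (pr.rangeRestrict c)).1.1.1 * r c' :=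
        hAB _ (hrZ c').1 _ ((hCmem _).1 (s _).2)
      have h2 : r (c * c') = c.1.1.1 * r c' * ((s (pr.rangeRestrict c)).1.1.1)⁻¹ := by
        simp only [r, map_mul, Subgroup.coe_mul, Prod.fst_mul, mul_inv_rev]
        group
      rw [h2]
      have h3 : r c' * ((s (pr.rangeRestrict c)).1.1.1)⁻¹
          = ((s (pr.rangeRestrict c)).1.1.1)⁻¹ * r c' := by
        rw [mul_inv_eq_iff_eq_mul, mul_assoc, h1]; group
      rw [mul_assoc, h3, ← mul_assoc])
    have hρ : commutator C ≤ ρ.ker := by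
      rw [_root_.commutator_def, commutator_le]
      intro g _ g' _
      rw [MonoidHom.mem_ker, map_commutatorElement, commutatorElement_eq_one_iff_mul_comm]
      exact hAB _ (hrZ g).1 _ (hrZ g').2
    rw [eq_bot_iff]
    rintro d ⟨hd1, hd2⟩
    have hdC := hZC hd1
    rw [← Subgroup.map_subtype_commutator] at hd2
    obtain ⟨c, hc, rfl⟩ := hd2
    have h1 : r c = 1 := hρ hc
    have h2 : pr.rangeRestrict c = 1 := Subtype.ext ((hZmem _).1 hd1).2
    simp only [r, h2, map_one] at h1
    have h3 : c.1.1.1 = 1 := by simpa using h1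
    rw [mem_bot]
    apply Subtype.ext
    exact Prod.ext h3 ((hZmem _).1 hd1).2
  obtain ⟨P, hPfin, hP⟩ := nfg_of_abelian_action C Z hZC hCnfg hact hinter
  let π : D →* Γ := (MonoidHom.fst Γ (FreeGroup τ)).comp D.subtype
  refine ⟨π '' P, hPfin.image _, le_antisymm ?_ ?_⟩
  · apply normalClosure_le_normal
    rintro _ ⟨d, hd, rfl⟩
    have : d ∈ Z := by rw [← hP]; exact subset_normalClosure hd
    exact this.1
  · intro z hz
    have hzD : ((z, 1) : Γ × FreeGroup τ) ∈ D := by rw [hDmem]; simpa using hz.1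
    have h1 : (⟨_, hzD⟩ : D) ∈ Z := ⟨hz, rfl⟩
    rw [← hP] at h1
    have h2 : normalClosure P ≤ (normalClosure (π '' P)).comap π :=
      normalClosure_le_normal (fun d hd => subset_normalClosure ⟨d, hd, rfl⟩)
    exact h2 h1

end FibProd

namespace FibProd

open Group Subgroup
open scoped commutatorElement

theorem exists_relators {E H : Type*} [Group E] [Group H] (p : E →* H)
    (U : Set (E × Subgroup E)) (hU : U.Finite) (hmem : ∀ u ∈ U, p u.1 ∈ u.2.map p) :
    ∃ R : Set E, R.Finite ∧ R ⊆ p.ker ∧ ∀ N : Subgroup E, ∀ [N.Normal], R ⊆ N →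
      ∀ u ∈ U, (QuotientGroup.mk' N) u.1 ∈ u.2.map (QuotientGroup.mk' N) := by
  choose! w hw hw' using hmem
  refine ⟨(fun u => u.1 * (w u)⁻¹) '' U, hU.image _, ?_, ?_⟩
  · rintro _ ⟨u, hu, rfl⟩
    simp [MonoidHom.mem_ker, hw' u hu]
  · intro N _ hN u hu
    refine ⟨w u, hw u hu, ?_⟩
    have h1 : u.1 * (w u)⁻¹ ∈ N := hN ⟨u, hu, rfl⟩
    have h2 : (QuotientGroup.mk' N) (u.1 * (w u)⁻¹) = 1 := by
      rw [← MonoidHom.mem_ker, QuotientGroup.ker_mk']; exact h1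
    rw [map_mul, map_inv, mul_inv_eq_one] at h2
    exact h2.symm

theorem fp_of_comm {H G₁ G₂ Q : Type*} [Group H] [Group G₁] [Group G₂] [CommGroup Q]
    [IsFinitelyPresented G₁] [IsFinitelyPresented G₂]
    (q₁ : H →* G₁) (q₂ : H →* G₂) (hq₁ : Function.Surjective q₁) (hq₂ : Function.Surjective q₂)
    (hinj : ∀ h, q₁ h = 1 → q₂ h = 1 → h = 1)
    (θ : H →* Q) (hθ : ∀ h, θ h = 1 → ∃ a b, q₂ a = 1 ∧ q₁ b = 1 ∧ h = a * b)
    (X Y T : Set H) (hXf : X.Finite) (hYf : Y.Finite) (hTf : T.Finite)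
    (hgen : closure (X ∪ Y ∪ T) = ⊤) (hX : normalClosure X = q₂.ker)
    (hY : normalClosure Y = q₁.ker)
    (hcomm : ∀ (n : ℕ) (p : FreeGroup (Fin n) →* H) (σ : H → FreeGroup (Fin n)),
      (∀ h, p (σ h) = h) → ∃ M : Set (FreeGroup (Fin n) × Set (FreeGroup (Fin n))), M.Finite ∧
        (∀ m ∈ M, p m.1 ∈ closure (p '' m.2)) ∧
        ∀ (Γ : Type) [Group Γ] (π : FreeGroup (Fin n) →* Γ), Function.Surjective π →
          (∀ m ∈ M, π m.1 ∈ closure (π '' m.2)) →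
          closure ((fun h => π (σ h)) '' (X ∪ Y ∪ T)) = ⊤ →
          ∀ x ∈ X, ∀ y ∈ Y, ∀ g, Commute (π (σ x)) (g * π (σ y) * g⁻¹)) :
    IsFinitelyPresented H := by
  haveI hfgH : Group.FG H := (Group.fg_iff).2 ⟨_, hgen, (hXf.union hYf).union hTf⟩
  obtain ⟨n, p, hp⟩ : ∃ (n : ℕ) (p : FreeGroup (Fin n) →* H), Function.Surjective p := by
    obtain ⟨S, hS⟩ := hfgH.out
    let e := S.equivFin
    refine ⟨S.card, FreeGroup.lift (fun i => (e.symm i : H)), ?_⟩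
    rw [← MonoidHom.range_eq_top, eq_top_iff, ← hS, closure_le]
    intro x hx
    exact ⟨FreeGroup.of (e ⟨x, hx⟩), by simp⟩
  let E := FreeGroup (Fin n)
  let σ : H → E := Function.surjInv hp
  have hσ : ∀ h, p (σ h) = h := Function.surjInv_eq hp
  have himg : ∀ S : Set H, p '' (σ '' S) = S := by
    intro S; rw [← Set.image_comp]; convert Set.image_id S; exact hσ _
  obtain ⟨M, hMf, hM, hMc⟩ := hcomm n p σ hσ
  obtain ⟨P₂, hP₂f, hP₂⟩ := ker_nfg (q₂.comp p) (hq₂.comp hp)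
  obtain ⟨P₁, hP₁f, hP₁⟩ := ker_nfg (q₁.comp p) (hq₁.comp hp)
  obtain ⟨RM, hRMf, hRMk, hRM⟩ := exists_relators p ((fun m => (m.1, closure m.2)) '' M)
    (hMf.image _) (by
      rintro _ ⟨m, hm, rfl⟩
      rw [MonoidHom.map_closure]; exact hM m hm)
  obtain ⟨RG, hRGf, hRGk, hRG⟩ := exists_relators p
    (Set.range fun i : Fin n => (FreeGroup.of i, closure (σ '' (X ∪ Y ∪ T)))) (Set.finite_range _) (by
      rintro _ ⟨i, rfl⟩
      rw [MonoidHom.map_closure, himg, hgen]; trivial)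
  obtain ⟨R2, hR2f, hR2k, hR2⟩ := exists_relators p
    ((fun u => (u, normalClosure (σ '' X))) '' P₂) (hP₂f.image _) (by
      rintro _ ⟨u, hu, rfl⟩
      rw [map_normalClosure _ _ hp, himg, hX]
      have : u ∈ (q₂.comp p).ker := by rw [← hP₂]; exact subset_normalClosure hu
      exact this)
  obtain ⟨R1, hR1f, hR1k, hR1⟩ := exists_relators p
    ((fun u => (u, normalClosure (σ '' Y))) '' P₁) (hP₁f.image _) (by
      rintro _ ⟨u, hu, rfl⟩
      rw [map_normalClosure _ _ hp, himg, hY]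
      have : u ∈ (q₁.comp p).ker := by rw [← hP₁]; exact subset_normalClosure hu
      exact this)
  let R := RM ∪ RG ∪ R2 ∪ R1
  have hRf : R.Finite := ((hRMf.union hRGf).union hR2f).union hR1f
  have hRk : R ⊆ p.ker := by
    rintro x (((h | h) | h) | h)
    exacts [hRMk h, hRGk h, hR2k h, hR1k h]
  let N := normalClosure R
  have hNk : N ≤ p.ker := normalClosure_le_normal hRk
  let π : E →* E ⧸ N := QuotientGroup.mk' N
  have hπ : Function.Surjective π := QuotientGroup.mk'_surjective N
  let pb : E ⧸ N →* H := QuotientGroup.lift N p hNk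
  have hpb : ∀ e, pb (π e) = p e := fun e => rfl
  have hpbs : Function.Surjective pb := fun h => ⟨π (σ h), hσ h⟩
  have hsub : R ⊆ N := subset_normalClosure
  let A := normalClosure (π '' (σ '' X))
  let B := normalClosure (π '' (σ '' Y))
  have hA : A = (q₂.comp pb).ker := by
    apply le_antisymm
    · apply normalClosure_le_normal
      rintro _ ⟨_, ⟨x, hx, rfl⟩, rfl⟩
      have : x ∈ q₂.ker := by rw [← hX]; exact subset_normalClosure hx
      simpa [MonoidHom.mem_ker, hpb, hσ] using this
    · intro γ hγ
      obtain ⟨e, rfl⟩ := hπ γ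
      have he : e ∈ normalClosure P₂ := by rw [hP₂]; exact hγ
      have : normalClosure P₂ ≤ A.comap π := by
        apply normalClosure_le_normal
        intro u hu
        have := hR2 N (fun r hr => hsub (Or.inl (Or.inr hr))) _ ⟨u, hu, rfl⟩
        rw [map_normalClosure _ _ hπ] at this
        exact this
      exact this he
  have hB : B = (q₁.comp pb).ker := by
    apply le_antisymm
    · apply normalClosure_le_normal
      rintro _ ⟨_, ⟨x, hx, rfl⟩, rfl⟩
      have : x ∈ q₁.ker := by rw [← hY]; exact subset_normalClosure hx
      simpa [MonoidHom.mem_ker, hpb, hσ] using this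
    · intro γ hγ
      obtain ⟨e, rfl⟩ := hπ γ
      have he : e ∈ normalClosure P₁ := by rw [hP₁]; exact hγ
      have : normalClosure P₁ ≤ B.comap π := by
        apply normalClosure_le_normal
        intro u hu
        have := hR1 N (fun r hr => hsub (Or.inr hr)) _ ⟨u, hu, rfl⟩
        rw [map_normalClosure _ _ hπ] at this
        exact this
      exact this he
  have hgenΓ : closure ((fun h => π (σ h)) '' (X ∪ Y ∪ T)) = ⊤ := by
    have h0 : (fun h => π (σ h)) '' (X ∪ Y ∪ T) = π '' (σ '' (X ∪ Y ∪ T)) := by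
      rw [← Set.image_comp]; rfl
    rw [h0, eq_top_iff]
    have h1 : (⊤ : Subgroup (E ⧸ N)) = (⊤ : Subgroup E).map π := by
      rw [← MonoidHom.range_eq_map, MonoidHom.range_eq_top.2 hπ]
    rw [h1, ← FreeGroup.closure_range_of, MonoidHom.map_closure, closure_le]
    rintro _ ⟨_, ⟨i, rfl⟩, rfl⟩
    have := hRG N (fun r hr => hsub (Or.inl (Or.inl (Or.inr hr)))) _ ⟨i, rfl⟩
    rw [MonoidHom.map_closure] at this
    exact this
  have hc0 := hMc (E ⧸ N) π hπ (by
    intro m hm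
    have := hRM N (fun r hr => hsub (Or.inl (Or.inl (Or.inl hr)))) _ ⟨m, hm, rfl⟩
    rw [MonoidHom.map_closure] at this
    exact this) hgenΓ
  have hcAB : ∀ a ∈ A, ∀ b ∈ B, a * b = b * a := by
    have h1 : B ≤ centralizer (π '' (σ '' X)) := by
      rw [show B = closure (conjugatesOfSet (π '' (σ '' Y))) from rfl, closure_le]
      intro z hz
      rw [mem_conjugatesOfSet_iff] at hz
      obtain ⟨_, ⟨_, ⟨y, hy, rfl⟩, rfl⟩, hzy⟩ := hz
      rw [isConj_iff] at hzy
      obtain ⟨g, rfl⟩ := hzy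
      rw [SetLike.mem_coe, mem_centralizer_iff]
      rintro _ ⟨_, ⟨x, hx, rfl⟩, rfl⟩
      exact hc0 x hx y hy g
    have h2 : A ≤ centralizer (B : Set (E ⧸ N)) := by
      apply normalClosure_le_normal
      intro x hx
      rw [SetLike.mem_coe, mem_centralizer_iff]
      intro b hb
      exact (mem_centralizer_iff.1 (h1 hb) x hx).symm
    intro a ha b hb
    exact (mem_centralizer_iff.1 (h2 ha) b hb).symm
  haveI : Finite T := hTf
  let hF : FreeGroup T →* E ⧸ N := FreeGroup.lift (fun t => π (σ t))
  have hXA : ∀ x ∈ X, π (σ x) ∈ A := fun x hx => subset_normalClosure ⟨_, ⟨x, hx, rfl⟩, rfl⟩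
  have hYB : ∀ x ∈ Y, π (σ x) ∈ B := fun x hx => subset_normalClosure ⟨_, ⟨x, hx, rfl⟩, rfl⟩
  have hTF : ∀ t ∈ T, π (σ t) ∈ hF.range := fun t ht => ⟨FreeGroup.of ⟨t, ht⟩, by simp [hF]⟩
  have hAcl : A = closure {y | ∃ f, ∃ x ∈ π '' (σ '' X), y = hF f * x * (hF f)⁻¹} := by
    set A₀ := closure {y | ∃ f, ∃ x ∈ π '' (σ '' X), y = hF f * x * (hF f)⁻¹} with hA₀
    have hle : A₀ ≤ A := by
      rw [hA₀, closure_le]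
      rintro _ ⟨f, x, hx, rfl⟩
      exact (normalClosure_normal (s := π '' (σ '' X))).conj_mem _ (subset_normalClosure hx) _
    have hXA₀ : π '' (σ '' X) ⊆ A₀ := fun x hx => subset_closure ⟨1, x, hx, by simp⟩
    apply le_antisymm _ hle
    have hnorm : normalizer (A₀ : Set (E ⧸ N)) = ⊤ := by
      rw [eq_top_iff, ← hgenΓ, closure_le]
      rintro _ ⟨z, ((hz | hz) | hz), rfl⟩
      · exact le_normalizer (hXA₀ ⟨_, ⟨z, hz, rfl⟩, rfl⟩)
      · rw [SetLike.mem_coe, mem_normalizer_iff]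
        intro a
        have hb := hYB z hz
        constructor
        · intro ha
          have := hcAB a (hle ha) _ hb
          simp only
          rw [← this]; simpa using ha
        · intro ha
          have h1 := hcAB _ (hle ha) _ hb
          simp only at ha h1
          have : a = π (σ z) * a * (π (σ z))⁻¹ := by
            rw [inv_mul_cancel_right] at h1
            exact mul_left_cancel h1
          rw [this]; exact ha
      · obtain ⟨f, hf⟩ := hTF z hz
        have hconj : ∀ f, ∀ a ∈ A₀, hF f * a * (hF f)⁻¹ ∈ A₀ := by
          intro f
          have : A₀ ≤ A₀.comap (MulAut.conj (hF f)).toMonoidHom := by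
            conv_lhs => rw [hA₀]
            rw [closure_le]
            rintro _ ⟨f', x, hx, rfl⟩
            refine subset_closure ⟨f * f', x, hx, ?_⟩
            change hF f * (hF f' * x * (hF f')⁻¹) * (hF f)⁻¹ = _
            rw [map_mul]; group
          exact fun a ha => this ha
        rw [SetLike.mem_coe, mem_normalizer_iff]
        intro a
        simp only
        rw [← hf]
        refine ⟨hconj f a, fun ha => ?_⟩
        have := hconj f⁻¹ _ ha
        simpa [mul_assoc] using this
    haveI : A₀.Normal := normalizer_eq_top_iff.1 hnorm
    exact normalClosure_le_normal hXA₀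
  have hΓ : ∀ γ, ∃ a ∈ A, ∃ b ∈ B, ∃ f, γ = a * b * hF f := by
    intro γ
    have h1 : (A ⊔ B) ⊔ hF.range = ⊤ := by
      rw [eq_top_iff, ← hgenΓ, closure_le]
      rintro _ ⟨z, ((hz | hz) | hz), rfl⟩
      · exact mem_sup_left (mem_sup_left (hXA z hz))
      · exact mem_sup_left (mem_sup_right (hYB z hz))
      · exact mem_sup_right (hTF z hz)
    have h2 : γ ∈ (A ⊔ B) ⊔ hF.range := h1 ▸ mem_top γ
    rw [Subgroup.mem_sup_of_normal_left] at h2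
    obtain ⟨c, hc, _, ⟨f, rfl⟩, rfl⟩ := h2
    rw [Subgroup.mem_sup_of_normal_left] at hc
    obtain ⟨a, ha, b, hb, rfl⟩ := hc
    exact ⟨a, ha, b, hb, f, rfl⟩
  have hZ := lemmaZ A B hcAB (q₁.comp pb) (hq₁.comp hpbs) hB.symm hF (π '' (σ '' X))
    ((hXf.image _).image _) hAcl hΓ (θ.comp pb) (by
      intro γ hγ
      obtain ⟨a, b, ha, hb, hab⟩ := hθ _ hγ
      obtain ⟨a', rfl⟩ := hpbs a
      have h1 : a' ∈ A := by rw [hA]; exact ha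
      have h2 : a'⁻¹ * γ ∈ B := by
        rw [hB, MonoidHom.mem_ker]
        simp [hab, hb]
      have := mul_mem_sup h1 h2
      simpa using this)
  haveI : Finite R := hRf
  haveI : IsFinitelyPresented (E ⧸ N) := IsFinitelyPresented.quotient N ⟨R, hRf, rfl⟩
  refine IsFinitelyPresented.of_surjective pb hpbs ?_
  have : pb.ker = A ⊓ B := by
    ext γ
    rw [mem_inf, hA, hB, MonoidHom.mem_ker, MonoidHom.mem_ker, MonoidHom.mem_ker]
    constructor
    · intro h; simp [h]
    · rintro ⟨h1, h2⟩; exact hinj _ h2 h1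
  rw [this]; exact hZ

/-- A convenient way to verify the commutation hypothesis. -/
theorem commute_of_normalizing {Γ : Type*} [Group Γ] (X Y T : Set Γ)
    (hgen : closure (X ∪ Y ∪ T) = ⊤) (B₀ : Subgroup Γ) (hY : Y ⊆ B₀)
    (hX : ∀ x ∈ X, ∀ b ∈ B₀, Commute x b)
    (hT : ∀ t ∈ T, ∀ b ∈ B₀, t * b * t⁻¹ ∈ B₀ ∧ t⁻¹ * b * t ∈ B₀) :
    ∀ x ∈ X, ∀ y ∈ Y, ∀ g, Commute x (g * y * g⁻¹) := by
  have hnorm : normalizer (B₀ : Set Γ) = ⊤ := by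
    rw [eq_top_iff, ← hgen, closure_le]
    rintro z ((hz | hz) | hz)
    · rw [SetLike.mem_coe, mem_normalizer_iff]
      intro b
      constructor
      · intro hb
        rw [(hX z hz b hb).eq]; simpa using hb
      · intro hb
        have h1 := (hX z hz _ hb).eq
        have h2 : z * b * z⁻¹ = b := by
          rw [inv_mul_cancel_right] at h1
          exact mul_left_cancel h1
        rwa [h2] at hb
    · exact le_normalizer (hY hz)
    · rw [SetLike.mem_coe, mem_normalizer_iff]
      intro b
      refine ⟨fun hb => (hT z hz b hb).1, fun hb => ?_⟩
      have := (hT z hz _ hb).2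
      simpa [mul_assoc] using this
  haveI : B₀.Normal := normalizer_eq_top_iff.1 hnorm
  intro x hx y hy g
  exact hX x hx _ (Normal.conj_mem inferInstance _ (hY hy) g)

end FibProd

namespace FibProd

open Group Subgroup

section CommLemma
variable {Γ : Type*} [Group Γ]

/-- The subgroup generated by the conjugates `t ^ b * y * t ^ (-b)` for `lo ≤ b ≤ hi`. -/
def Bint (t : Γ) (Y : Set Γ) (lo hi : ℤ) : Subgroup Γ :=
  closure {z | ∃ b : ℤ, lo ≤ b ∧ b ≤ hi ∧ ∃ y ∈ Y, z = t ^ b * y * t ^ (-b)}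

theorem Bint_mono {t : Γ} {Y : Set Γ} {lo hi lo' hi' : ℤ} (h1 : lo' ≤ lo) (h2 : hi ≤ hi') :
    Bint t Y lo hi ≤ Bint t Y lo' hi' := by
  apply Subgroup.closure_mono
  rintro z ⟨b, hb1, hb2, y, hy, rfl⟩
  exact ⟨b, by omega, by omega, y, hy, rfl⟩

theorem mem_Bint {t : Γ} {Y : Set Γ} {lo hi : ℤ} {b : ℤ} (h1 : lo ≤ b) (h2 : b ≤ hi) {y : Γ}
    (hy : y ∈ Y) : t ^ b * y * t ^ (-b) ∈ Bint t Y lo hi :=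
  subset_closure ⟨b, h1, h2, y, hy, rfl⟩

theorem conj_closure_le {g : Γ} {S : Set Γ} {K : Subgroup Γ} (h : ∀ z ∈ S, g * z * g⁻¹ ∈ K) :
    ∀ z ∈ closure S, g * z * g⁻¹ ∈ K := by
  have : closure S ≤ K.comap (MulAut.conj g).toMonoidHom := by
    rw [closure_le]; exact h
  exact fun z hz => this hz

theorem Bint_shift {t : Γ} {Y : Set Γ} {lo hi : ℤ} (m : ℤ) :
    ∀ z ∈ Bint t Y lo hi, t ^ m * z * (t ^ m)⁻¹ ∈ Bint t Y (lo + m) (hi + m) := by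
  apply conj_closure_le
  rintro _ ⟨b, hb1, hb2, y, hy, rfl⟩
  have := mem_Bint (t := t) (Y := Y) (lo := lo + m) (hi := hi + m) (b := m + b) (by omega) (by omega) hy
  convert this using 1
  rw [neg_add_rev, zpow_add, zpow_add]
  simp [mul_assoc]

theorem commute_closure {x : Γ} {S : Set Γ} (h : ∀ z ∈ S, Commute x z) :
    ∀ z ∈ closure S, Commute x z := by
  have : closure S ≤ centralizer {x} := by
    rw [closure_le]
    intro z hz
    rw [SetLike.mem_coe, mem_centralizer_singleton_iff]
    exact (h z hz).symm
  intro z hz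
  exact (mem_centralizer_singleton_iff.1 (this hz)).symm

/-- Commutation up to level `k`. -/
def CommUpTo (t : Γ) (X Y : Set Γ) (k : ℤ) : Prop :=
  ∀ x ∈ X, ∀ y ∈ Y, ∀ i : ℤ, |i| ≤ k → Commute x (t ^ i * y * t ^ (-i))

theorem CommUpTo.bint {t : Γ} {X Y : Set Γ} {k : ℤ} (h : CommUpTo t X Y k) {D lo hi : ℤ}
    (hb : ∀ b, lo ≤ b → b ≤ hi → |b - D| ≤ k) {u : Γ} (hu : u ∈ X) :
    ∀ z ∈ Bint t Y lo hi, Commute (t ^ D * u * t ^ (-D)) z := by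
  apply commute_closure
  rintro _ ⟨b, hb1, hb2, y, hy, rfl⟩
  have h1 := h u hu y hy (b - D) (hb b hb1 hb2)
  have h2 := (Commute.conj_iff (t ^ D)).2 h1
  have e1 : t ^ D * u * t ^ (-D) = t ^ D * u * (t ^ D)⁻¹ := by rw [zpow_neg]
  have e2 : t ^ b * y * t ^ (-b) = t ^ D * (t ^ (b - D) * y * t ^ (-(b - D))) * (t ^ D)⁻¹ := by
    rw [neg_sub, zpow_sub, zpow_sub, zpow_neg]; group
  rw [e1, e2]; exact h2

variable {t : Γ} {X Y : Set Γ}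

theorem conj_up {k : ℤ} (h : CommUpTo t X Y k) {w u : Γ} (hw : w ∈ Y) (hu : u ∈ X) {D c : ℤ}
    (hc : 0 ≤ c) (z : Γ) (hz : z ∈ Bint t Y (-c) c) (m : ℕ)
    (hb : ∀ b, -c ≤ b → b ≤ c + m → |b - D| ≤ k) :
    (w * (t ^ D * u * t ^ (-D)) * t) ^ (m : ℤ) * z * ((w * (t ^ D * u * t ^ (-D)) * t) ^ (m : ℤ))⁻¹
      ∈ Bint t Y (-c) (c + m) := by
  induction m with
  | zero => simpa using hz
  | succ m ih =>
    have ih := ih (fun b h1 h2 => hb b h1 (by push_cast; omega))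
    set P := w * (t ^ D * u * t ^ (-D)) * t with hP
    set z' := P ^ (m : ℤ) * z * (P ^ (m : ℤ))⁻¹ with hz'
    have e : P ^ ((m + 1 : ℕ) : ℤ) * z * (P ^ ((m + 1 : ℕ) : ℤ))⁻¹ = P * z' * P⁻¹ := by
      rw [hz', show ((m + 1 : ℕ) : ℤ) = 1 + m by push_cast; ring, zpow_add, zpow_one]; group
    rw [e]
    have h1 := Bint_shift 1 z' ih
    rw [zpow_one] at h1
    have h1' : t * z' * t⁻¹ ∈ Bint t Y (-c) (c + (m + 1 : ℕ)) :=
      Bint_mono (by omega) (by push_cast; omega) h1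
    have h2 := h.bint (D := D) hb hu _ h1'
    have h3 : w ∈ Bint t Y (-c) (c + (m + 1 : ℕ)) := by
      have := mem_Bint (t := t) (lo := -c) (hi := c + (m + 1 : ℕ)) (b := 0) (by omega)
        (by push_cast; omega) hw
      simpa using this
    have e2 : P * z' * P⁻¹ = w * (t * z' * t⁻¹) * w⁻¹ := by
      set v := t ^ D * u * t ^ (-D)
      have : v * (t * z' * t⁻¹) * v⁻¹ = t * z' * t⁻¹ := by
        rw [h2.eq, mul_inv_cancel_right]
      calc P * z' * P⁻¹ = w * (v * (t * z' * t⁻¹) * v⁻¹) * w⁻¹ := by rw [hP]; group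
        _ = _ := by rw [this]
    rw [e2]
    exact mul_mem (mul_mem h3 h1') (inv_mem h3)

theorem conj_down {k : ℤ} (h : CommUpTo t X Y k) {w u : Γ} (hw : w ∈ Y) (hu : u ∈ X) {D c : ℤ}
    (hc : 0 ≤ c) (z : Γ) (hz : z ∈ Bint t Y (-c) c) (m : ℕ)
    (hb : ∀ b, -c - m ≤ b → b ≤ c → |b - D| ≤ k) :
    (w * (t ^ D * u * t ^ (-D)) * t) ^ (-m : ℤ) * z *
      ((w * (t ^ D * u * t ^ (-D)) * t) ^ (-m : ℤ))⁻¹ ∈ Bint t Y (-c - m) c := by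
  induction m with
  | zero => simpa using hz
  | succ m ih =>
    have ih := ih (fun b h1 h2 => hb b (by push_cast; omega) h2)
    set P := w * (t ^ D * u * t ^ (-D)) * t with hP
    set z' := P ^ (-m : ℤ) * z * (P ^ (-m : ℤ))⁻¹ with hz'
    have e : P ^ (-((m + 1 : ℕ) : ℤ)) * z * (P ^ (-((m + 1 : ℕ) : ℤ)))⁻¹ = P⁻¹ * z' * P := by
      rw [hz', show (-((m + 1 : ℕ) : ℤ)) = -1 + -m by push_cast; ring, zpow_add, zpow_neg_one]; group
    rw [e]
    have h3 : w ∈ Bint t Y (-c - m) c := by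
      have := mem_Bint (t := t) (lo := -c - m) (hi := c) (b := 0) (by omega) (by omega) hw
      simpa using this
    have h1 : w⁻¹ * z' * w ∈ Bint t Y (-c - m) c := mul_mem (mul_mem (inv_mem h3) ih) h3
    have h2 := h.bint (D := D) (fun b h1 h2 => hb b (by push_cast; omega) h2) hu _ h1
    have e2 : P⁻¹ * z' * P = t ^ (-1 : ℤ) * (w⁻¹ * z' * w) * (t ^ (-1 : ℤ))⁻¹ := by
      set v := t ^ D * u * t ^ (-D)
      have : v⁻¹ * (w⁻¹ * z' * w) * v = w⁻¹ * z' * w := by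
        rw [mul_assoc, ← h2.eq, inv_mul_cancel_left]
      calc P⁻¹ * z' * P = t⁻¹ * (v⁻¹ * (w⁻¹ * z' * w) * v) * t := by rw [hP]; group
        _ = _ := by rw [this]; group
    rw [e2]
    exact Bint_mono (by push_cast; omega) (by omega) (Bint_shift (-1) _ h1)

theorem conj_int {k : ℤ} (h : CommUpTo t X Y k) {g w u : Γ} (hw : w ∈ Y) (hu : u ∈ X) {D c : ℤ}
    (hc : 0 ≤ c) (hg : g * t * g⁻¹ = w * (t ^ D * u * t ^ (-D)) * t)
    (hgY : ∀ y ∈ Y, g * y * g⁻¹ ∈ Bint t Y (-c) c) (j lo hi : ℤ) (h1 : lo ≤ -c) (h2 : lo ≤ -c + j)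
    (h3 : c ≤ hi) (h4 : c + j ≤ hi) (hb : ∀ b, lo ≤ b → b ≤ hi → |b - D| ≤ k) :
    ∀ y ∈ Y, g * (t ^ j * y * t ^ (-j)) * g⁻¹ ∈ Bint t Y lo hi := by
  intro y hy
  have e : g * (t ^ j * y * t ^ (-j)) * g⁻¹ = (g * t * g⁻¹) ^ j * (g * y * g⁻¹) * ((g * t * g⁻¹) ^ j)⁻¹ := by
    rw [conj_zpow, zpow_neg]; group
  rw [e, hg]
  obtain ⟨m, rfl | rfl⟩ := j.eq_nat_or_neg
  · exact Bint_mono (by omega) (by omega) (conj_up h hw hu hc _ (hgY y hy) m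
      (fun b h1 h2 => hb b (by omega) (by omega)))
  · exact Bint_mono (by omega) (by omega) (conj_down h hw hu hc _ (hgY y hy) m
      (fun b h1 h2 => hb b (by omega) (by omega)))

theorem conj_Bint {k : ℤ} (h : CommUpTo t X Y k) {g w u : Γ} (hw : w ∈ Y) (hu : u ∈ X) {c : ℤ}
    (hc : 0 ≤ c) (hg : g * t * g⁻¹ = w * u * t)
    (hgY : ∀ y ∈ Y, g * y * g⁻¹ ∈ Bint t Y (-c) c) (i : ℤ) (hi : 0 ≤ i) (hik : i + c ≤ k) :
    ∀ z ∈ Bint t Y (-i) i, g * z * g⁻¹ ∈ Bint t Y (-(i + c)) (i + c) := by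
  apply conj_closure_le
  rintro _ ⟨b, hb1, hb2, y, hy, rfl⟩
  refine conj_int h hw hu (D := 0) hc (by simpa using hg) hgY b _ _ (by omega) (by omega)
    (by omega) (by omega) ?_ y hy
  intro b h1 h2
  rw [sub_zero, abs_le]; constructor <;> omega

/-- Words of length at most `n` in a set. -/
def WL (S : Set Γ) : ℕ → Set Γ
  | 0 => {1}
  | n + 1 => {g | ∃ g' ∈ WL S n, ∃ s ∈ S, g = g' * s} ∪ WL S n

theorem conj_WL {k : ℤ} (h : CommUpTo t X Y k) (S : Set Γ) (hSinv : ∀ s ∈ S, s⁻¹ ∈ S) {c : ℤ}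
    (hc : 1 ≤ c)
    (hSt : ∀ s ∈ S, ∃ w ∈ Y, ∃ u ∈ X, s * t * s⁻¹ = w * u * t)
    (hSY : ∀ s ∈ S, ∀ y ∈ Y, s * y * s⁻¹ ∈ Bint t Y (-c) c) (n : ℕ) :
    ∀ g ∈ WL (S ∪ {t, t⁻¹}) n, ∀ i : ℤ, 0 ≤ i → i + n * c ≤ k → ∀ z ∈ Bint t Y (-i) i,
      g⁻¹ * z * g ∈ Bint t Y (-(i + n * c)) (i + n * c) := by
  induction n with
  | zero =>
    rintro g hg i hi hk z hz
    have : g = 1 := hg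
    subst this
    simpa using hz
  | succ n ih =>
    have hnc : ((n + 1 : ℕ) : ℤ) * c = n * c + c := by push_cast; ring
    have hnc0 : 0 ≤ (n : ℤ) * c := by positivity
    rintro g (⟨g', hg', s, hs, rfl⟩ | hg) i hi hk z hz
    · have h1 := ih g' hg' i hi (by omega) z hz
      have e : (g' * s)⁻¹ * z * (g' * s) = s⁻¹ * (g'⁻¹ * z * g') * s⁻¹⁻¹ := by group
      rw [e, hnc, ← add_assoc]
      rcases hs with hs | hs
      · obtain ⟨w, hw, u, hu, hsw⟩ := hSt _ (hSinv s hs)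
        exact conj_Bint h hw hu (by omega) hsw (hSY _ (hSinv s hs)) (i + n * c) (by omega)
          (by omega) _ h1
      · rcases hs with rfl | hs
        · have := Bint_shift (-1) _ h1
          rw [zpow_neg_one] at this
          exact Bint_mono (by omega) (by omega) this
        · have hs : s = t⁻¹ := hs
          subst hs
          have := Bint_shift 1 _ h1
          rw [zpow_one] at this
          rw [inv_inv]
          exact Bint_mono (by omega) (by omega) this
    · exact Bint_mono (by omega) (by omega) (ih g hg i hi (by omega) z hz)

theorem comm_lemma (S : Set Γ) (r τ : Γ) (N c ℓ : ℕ) (hc : 1 ≤ c) (hN : c + ℓ * c + 1 ≤ N)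
    (hgen : closure (X ∪ Y ∪ (S ∪ {t, r})) = ⊤)
    (hτ : τ = r * t ^ (-N : ℤ))
    (hSinv : ∀ s ∈ S, s⁻¹ ∈ S)
    (hSt : ∀ s ∈ S, ∃ w ∈ Y, ∃ u ∈ X, s * t * s⁻¹ = w * u * t)
    (hSY : ∀ s ∈ S, ∀ y ∈ Y, s * y * s⁻¹ ∈ Bint t Y (-c) c)
    (hτY : ∀ y ∈ Y, τ * y * τ⁻¹ ∈ Bint t Y (-c) c)
    (hτY' : ∀ y ∈ Y, τ⁻¹ * y * τ ∈ Bint t Y (-c) c)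
    (hτt : ∃ w ∈ Y, ∃ u ∈ X, τ * t * τ⁻¹ = w * u * t)
    (hτt' : ∃ w ∈ Y, ∃ u ∈ X, τ⁻¹ * t * τ = w * (t ^ (N : ℤ) * u * t ^ (-N : ℤ)) * t)
    (hrX : ∀ x ∈ X, r * x * r⁻¹ ∈ closure {z | ∃ g ∈ WL (S ∪ {t, t⁻¹}) ℓ, ∃ x ∈ X, z = g * x * g⁻¹})
    (hrX' : ∀ x ∈ X, r⁻¹ * x * r ∈ closure {z | ∃ g ∈ WL (S ∪ {t, t⁻¹}) ℓ, ∃ x ∈ X, z = g * x * g⁻¹})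
    (hbase : CommUpTo t X Y (N + c + ℓ * c)) :
    ∀ x ∈ X, ∀ y ∈ Y, ∀ g, Commute x (g * y * g⁻¹) := by
  obtain ⟨w₁, hw₁, u₁, hu₁, he₁⟩ := hτt
  obtain ⟨w₂, hw₂, u₂, hu₂, he₂⟩ := hτt'
  have hr : r = τ * t ^ (N : ℤ) := by rw [hτ]; simp
  have he₁' : τ * t * τ⁻¹ = w₁ * (t ^ (0 : ℤ) * u₁ * t ^ (-0 : ℤ)) * t := by simpa using he₁
  have he₂' : τ⁻¹ * t * τ⁻¹⁻¹ = w₂ * (t ^ (N : ℤ) * u₂ * t ^ (-N : ℤ)) * t := by simpa using he₂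
  have hτY'' : ∀ y ∈ Y, τ⁻¹ * y * τ⁻¹⁻¹ ∈ Bint t Y (-c) c := by simpa using hτY'
  zify at hN hc
  have hc'0 : (0 : ℤ) ≤ ℓ * c := by positivity
  -- conjugates of X commute with B[-i,i]
  have hXB : ∀ k : ℤ, CommUpTo t X Y k → ∀ i : ℤ, 0 ≤ i → i + ℓ * c ≤ k →
      ∀ v ∈ closure {z | ∃ g ∈ WL (S ∪ {t, t⁻¹}) ℓ, ∃ x ∈ X, z = g * x * g⁻¹},
      ∀ z ∈ Bint t Y (-i) i, Commute v z := by
    intro k hk i hi hik v hv z hz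
    refine (commute_closure (x := z) ?_ v hv).symm
    rintro _ ⟨g, hg, x, hx, rfl⟩
    have h1 := conj_WL hk S hSinv hc hSt hSY ℓ g hg i hi hik z hz
    have h2 := hk.bint (D := 0) (lo := -(i + ℓ * c)) (hi := i + ℓ * c) (fun b h1 h2 => by
      rw [sub_zero, abs_le]; constructor <;> omega) hx _ h1
    have h3 := (Commute.conj_iff g).2 h2
    simp only [zpow_zero, one_mul, neg_zero, mul_one] at h3
    have e : g * (g⁻¹ * z * g) * g⁻¹ = z := by group
    rw [e] at h3
    exact h3.symm
  have step : ∀ k : ℕ, (N : ℤ) + c + ℓ * c ≤ k → CommUpTo t X Y k → CommUpTo t X Y (k + 1 : ℕ) := by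
    intro k hk h x hx y hy j hj
    by_cases hjk : |j| ≤ k
    · exact h x hx y hy j hjk
    have hj' : j = k + 1 ∨ j = -(k + 1) := by
      push_cast at hj
      rcases abs_cases j with ⟨h1, h2⟩ | ⟨h1, h2⟩ <;> omega
    rcases hj' with rfl | rfl
    · have h1 := conj_int h hw₂ hu₂ (D := N) (c := c) (by omega) he₂' hτY'' (k + 1) (-c) (c + (k + 1))
        (by omega) (by omega) (by omega) (by omega) (by
          intro b h1 h2; rw [abs_le]; constructor <;> omega) y hy
      have h2 := Bint_shift (-N) _ h1
      have h3 : r⁻¹ * (t ^ (k + 1 : ℤ) * y * t ^ (-(k + 1) : ℤ)) * r ∈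
          Bint t Y (-(k - ℓ * c)) (k - ℓ * c) := by
        have h2' := Bint_mono (lo' := -(k - ℓ * c : ℤ)) (hi' := (k - ℓ * c : ℤ))
          (by omega) (by omega) h2
        convert h2' using 1
        rw [hr]; group
      have h4 := hXB k h (k - ℓ * c) (by omega) (by omega) _ (hrX' x hx) _ h3
      have h5 := (Commute.conj_iff r).2 h4
      have e1 : r * (r⁻¹ * x * r) * r⁻¹ = x := by group
      have e2 : ∀ v : Γ, r * (r⁻¹ * v * r) * r⁻¹ = v := by intro v; group
      rw [e2, e2] at h5
      exact h5
    · have h1 := conj_int h hw₁ hu₁ (D := 0) (c := c) (by omega) he₁' hτY (N - (k + 1))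
        (-c + (N - (k + 1))) c
        (by omega) (by omega) (by omega) (by omega) (by
          intro b h1 h2; rw [abs_le]; constructor <;> omega) y hy
      have h3 : r * (t ^ (-(k + 1) : ℤ) * y * t ^ (-(-(k + 1)) : ℤ)) * r⁻¹ ∈
          Bint t Y (-(k - ℓ * c)) (k - ℓ * c) := by
        have h2' := Bint_mono (lo' := -(k - ℓ * c : ℤ)) (hi' := (k - ℓ * c : ℤ))
          (by omega) (by omega) h1
        convert h2' using 1
        rw [hr]
        have hgg : ∀ a e : ℤ, τ * t ^ a * (t ^ e * y * t ^ (-e)) * (τ * t ^ a)⁻¹ =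
            τ * (t ^ (a + e) * y * t ^ (-(a + e))) * τ⁻¹ := by
          intro a e
          rw [neg_add_rev, zpow_add, zpow_add]; simp [mul_assoc]
        exact hgg _ _
      have h4 := hXB k h (k - ℓ * c) (by omega) (by omega) _ (hrX x hx) _ h3
      exact (Commute.conj_iff r).1 h4
  have hall : ∀ k : ℤ, CommUpTo t X Y k := by
    have h1 : ∀ m : ℕ, CommUpTo t X Y ((N + c + ℓ * c + m : ℕ) : ℤ) := by
      intro m
      induction m with
      | zero => push_cast; simpa using hbase
      | succ m ih =>
        exact step (N + c + ℓ * c + m) (by push_cast; omega) ih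
    intro k x hx y hy i hi
    exact h1 k.natAbs x hx y hy i (by have := le_abs_self k; push_cast; omega)
  let B₀ : Subgroup Γ := closure {z | ∃ b : ℤ, ∃ y ∈ Y, z = t ^ b * y * t ^ (-b)}
  have hB₀ : ∀ lo hi, Bint t Y lo hi ≤ B₀ := by
    intro lo hi
    apply Subgroup.closure_mono
    rintro _ ⟨b, _, _, y, hy, rfl⟩
    exact ⟨b, y, hy, rfl⟩
  refine commute_of_normalizing X Y (S ∪ {t, r}) hgen B₀ ?_ ?_ ?_
  · intro y hy
    exact subset_closure ⟨0, y, hy, by simp⟩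
  · intro x hx
    apply commute_closure
    rintro _ ⟨b, y, hy, rfl⟩
    exact hall |b| x hx y hy b le_rfl
  · have ht : ∀ m : ℤ, ∀ b ∈ B₀, t ^ m * b * (t ^ m)⁻¹ ∈ B₀ := by
      intro m
      apply conj_closure_le
      rintro _ ⟨b, y, hy, rfl⟩
      refine subset_closure ⟨m + b, y, hy, ?_⟩
      rw [neg_add_rev, zpow_add, zpow_add]; simp [mul_assoc]
    have hs : ∀ s ∈ S, ∀ b ∈ B₀, s * b * s⁻¹ ∈ B₀ := by
      intro s hs
      apply conj_closure_le
      rintro _ ⟨b, y, hy, rfl⟩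
      obtain ⟨w, hw, u, hu, hsw⟩ := hSt s hs
      refine hB₀ _ _ (conj_Bint (hall (|b| + c)) hw hu (c := c) (by omega) hsw (hSY s hs) |b|
        (abs_nonneg b) le_rfl _ (mem_Bint (b := b) (neg_abs_le b) (le_abs_self b) hy))
    have hgen' : ∀ (g w u : Γ) (D : ℤ), w ∈ Y → u ∈ X →
        g * t * g⁻¹ = w * (t ^ D * u * t ^ (-D)) * t →
        (∀ y ∈ Y, g * y * g⁻¹ ∈ Bint t Y (-c) c) → ∀ b ∈ B₀, g * b * g⁻¹ ∈ B₀ := by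
      intro g w u D hw hu hg hgY
      apply conj_closure_le
      rintro _ ⟨b, y, hy, rfl⟩
      refine hB₀ _ _ (conj_int (hall (c + |b| + |D|)) hw hu (c := c) (by omega) hg hgY b
        (-(c + |b|)) (c + |b|) ?_ ?_ ?_ ?_ ?_ y hy)
      · have := abs_nonneg b; omega
      · have := neg_abs_le b; omega
      · have := abs_nonneg b; omega
      · have := le_abs_self b; omega
      · intro b' h1 h2
        have := neg_abs_le D
        have := le_abs_self D
        rw [abs_le]; constructor <;> omega
    have hτ1 := hgen' τ w₁ u₁ 0 hw₁ hu₁ he₁' hτY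
    have hτ2 := hgen' τ⁻¹ w₂ u₂ N hw₂ hu₂ he₂' hτY''
    rintro g (hg | hg | hg) b hb
    · refine ⟨hs g hg b hb, ?_⟩
      have := hs g⁻¹ (hSinv g hg) b hb
      simpa using this
    · subst hg
      refine ⟨by simpa using ht 1 b hb, by simpa using ht (-1) b hb⟩
    · have hg : g = r := hg
      subst hg
      rw [hr]
      constructor
      · have := hτ1 _ (ht N b hb)
        convert this using 1
        group
      · have := ht (-N) _ (hτ2 b hb)
        convert this using 1
        group
end CommLemma

end FibProd

namespace FibProd
open Group Subgroup

section PPsec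
open Monoid
variable {G : Bool → Type*} [∀ i, Group (G i)] {H : Type*} [Group H] (φ : ∀ i, H →* G i)

inductive PRed : Bool → Bool → PushoutI φ → Prop
  | single {i : Bool} (g : G i) (hg : g ∉ (φ i).range) : PRed i i (PushoutI.of i g)
  | append {i j k l : Bool} {p q : PushoutI φ} (hp : PRed i j p) (h : j ≠ k) (hq : PRed k l q) :
      PRed i l (p * q)

variable {φ}

theorem PRed.inv {i j : Bool} {p : PushoutI φ} (h : PRed φ i j p) : PRed φ j i p⁻¹ := by
  induction h with
  | single g hg =>
    rw [← map_inv]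
    exact PRed.single _ (fun h => hg (by simpa using inv_mem h))
  | append hp h hq ih1 ih2 =>
    rw [mul_inv_rev]
    exact PRed.append ih2 (Ne.symm h) ih1

theorem PRed.exists_word {i j : Bool} {p : PushoutI φ} (h : PRed φ i j p) :
    ∃ w : CoprodI.NeWord G i j, (∀ l ∈ w.toList, l.2 ∉ (φ l.1).range) ∧
      PushoutI.ofCoprodI w.prod = p := by
  induction h with
  | @single i g hg =>
    refine ⟨CoprodI.NeWord.singleton g (fun h => hg (h ▸ one_mem _)), ?_, ?_⟩
    · intro l hl
      simp [CoprodI.NeWord.toList] at hl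
      subst hl; exact hg
    · simp
  | append hp h hq ih1 ih2 =>
    obtain ⟨w1, h1, rfl⟩ := ih1
    obtain ⟨w2, h2, rfl⟩ := ih2
    refine ⟨CoprodI.NeWord.append w1 h w2, ?_, ?_⟩
    · intro l hl
      simp only [CoprodI.NeWord.toList, List.mem_append] at hl
      rcases hl with hl | hl
      · exact h1 l hl
      · exact h2 l hl
    · simp

theorem PRed.ne_one (hφ : ∀ i, Function.Injective (φ i)) {i j : Bool} {p : PushoutI φ}
    (h : PRed φ i j p) : p ≠ 1 := by
  obtain ⟨w, hw, rfl⟩ := h.exists_word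
  intro h1
  have hr : PushoutI.Reduced φ w.toWord := by
    rintro ⟨i, g⟩ hl
    exact hw ⟨i, g⟩ hl
  have := hr.eq_empty_of_mem_range hφ (by
    change PushoutI.ofCoprodI w.prod ∈ _
    rw [h1]; exact one_mem _)
  exact w.toList_ne_nil (congrArg CoprodI.Word.toList this)

theorem freeGroup_unit_zpow (x : FreeGroup Unit) : ∃ n : ℤ, x = FreeGroup.of () ^ n := by
  induction x using FreeGroup.induction_on with
  | C1 => exact ⟨0, by simp⟩
  | of i => exact ⟨1, by simp⟩
  | inv_of i h => exact ⟨-1, by simp⟩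
  | mul x y hx hy =>
    obtain ⟨a, rfl⟩ := hx
    obtain ⟨b, rfl⟩ := hy
    exact ⟨a + b, by rw [zpow_add]⟩

theorem free_of_PRed (hφ : ∀ i, Function.Injective (φ i)) (e : Fin 2 → Bool)
    (he : Function.Injective e) (z : Fin 2 → PushoutI φ)
    (hz : ∀ i (n : ℤ), n ≠ 0 → PRed φ (e i) (e i) (z i ^ n)) :
    Function.Injective (FreeGroup.lift z) := by
  set ψ : CoprodI (fun _ : Fin 2 => FreeGroup Unit) →* PushoutI φ :=
    CoprodI.lift (fun i => FreeGroup.lift (fun _ => z i)) with hψ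
  have hcomp : FreeGroup.lift z = ψ.comp (freeGroupEquivCoprodI (ι := Fin 2)).toMonoidHom := by
    ext i
    simp [hψ]
  have key : ∀ {i j} (w : CoprodI.NeWord (fun _ : Fin 2 => FreeGroup Unit) i j),
      PRed φ (e i) (e j) (ψ w.prod) := by
    intro i j w
    induction w with
    | singleton x hx =>
      obtain ⟨n, rfl⟩ := freeGroup_unit_zpow x
      have hn : n ≠ 0 := by rintro rfl; simp at hx
      simpa [hψ] using hz _ n hn
    | append w1 h w2 ih1 ih2 =>
      rw [CoprodI.NeWord.append_prod, map_mul]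
      exact PRed.append ih1 (fun h' => h (he h')) ih2
  rw [injective_iff_map_eq_one]
  intro a ha
  by_contra hne
  have h1 : freeGroupEquivCoprodI a ≠ 1 := fun h => hne ((map_eq_one_iff _ (freeGroupEquivCoprodI (ι := Fin 2)).injective).1 h)
  have h2 : CoprodI.Word.equiv (freeGroupEquivCoprodI a) ≠ CoprodI.Word.empty := by
    intro h
    apply h1
    have := congrArg CoprodI.Word.prod h
    have h3 : CoprodI.Word.prod (CoprodI.Word.equiv (freeGroupEquivCoprodI a)) = freeGroupEquivCoprodI a :=
      CoprodI.Word.equiv.symm_apply_apply _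
    rw [h3] at this
    simpa using this
  obtain ⟨i, j, w, hw⟩ := CoprodI.NeWord.of_word _ h2
  apply (key w).ne_one hφ
  have h3 : CoprodI.Word.prod (CoprodI.Word.equiv (freeGroupEquivCoprodI a)) = freeGroupEquivCoprodI a :=
      CoprodI.Word.equiv.symm_apply_apply _
  have h4 : w.prod = freeGroupEquivCoprodI a := by
    rw [← h3, ← hw]; rfl
  rw [h4]
  rw [hcomp] at ha
  simpa using ha

theorem free_in_pushout (hφ : ∀ i, Function.Injective (φ i)) (a : G true) (b₁ b₂ : G false)
    (ha : a ∉ (φ true).range) (hb₁ : b₁ ∉ (φ false).range) (hb₂ : b₂ ∉ (φ false).range)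
    (hb : b₂⁻¹ * b₁ ∉ (φ false).range) :
    Function.Injective (FreeGroup.lift (fun i : Fin 2 => if i = 0 then
      (PushoutI.of false b₁ * PushoutI.of true a * (PushoutI.of false b₂)⁻¹ : PushoutI φ) else
      PushoutI.of true a * (PushoutI.of false b₁ * PushoutI.of true a * (PushoutI.of false b₂)⁻¹) *
        (PushoutI.of true a)⁻¹)) := by
  set x : PushoutI φ := PushoutI.of false b₁ * PushoutI.of true a * (PushoutI.of false b₂)⁻¹ with hx
  have hA : PRed φ true true (PushoutI.of true a) := PRed.single a ha
  have hB1 : PRed φ false false (PushoutI.of false b₁) := PRed.single _ hb₁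
  have hB2 : PRed φ false false (PushoutI.of false b₂)⁻¹ := (PRed.single _ hb₂).inv
  have hB : PRed φ false false ((PushoutI.of false b₂)⁻¹ * PushoutI.of false b₁) := by
    rw [← map_inv, ← map_mul]; exact PRed.single _ hb
  have hpos : ∀ n : ℕ, ∃ p : PushoutI φ, PRed φ true true p ∧
      x ^ (n+1) = PushoutI.of false b₁ * p * (PushoutI.of false b₂)⁻¹ := by
    intro n
    induction n with
    | zero => exact ⟨_, hA, by simp [hx]⟩
    | succ n ih =>
      obtain ⟨p, hp, he⟩ := ih
      refine ⟨_, (hA.append (by simp) hB).append (by simp) hp, ?_⟩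
      rw [pow_succ', he, hx]
      group
  have hpos' : ∀ n : ℕ, PRed φ false false (x ^ (n+1)) := by
    intro n
    obtain ⟨p, hp, he⟩ := hpos n
    rw [he]
    exact (hB1.append (by simp) hp).append (by simp) hB2
  have hall : ∀ n : ℤ, n ≠ 0 → PRed φ false false (x ^ n) := by
    intro n hn
    obtain ⟨m, rfl | rfl⟩ := n.eq_nat_or_neg
    · obtain ⟨k, rfl⟩ := Nat.exists_eq_succ_of_ne_zero (n := m) (by simpa using hn)
      rw [zpow_natCast]; exact hpos' k
    · obtain ⟨k, rfl⟩ := Nat.exists_eq_succ_of_ne_zero (n := m) (by simpa using hn)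
      rw [zpow_neg, zpow_natCast]; exact (hpos' k).inv
  refine free_of_PRed hφ (fun i => if i = 0 then false else true) ?_ _ ?_
  · intro i j; fin_cases i <;> fin_cases j <;> simp
  · intro i n hn
    fin_cases i
    · simpa using hall n hn
    · simp only [Fin.mk_one, Fin.isValue, one_ne_zero, ↓reduceIte, conj_zpow]
      exact (hA.append (by simp) (hall n hn)).append (by simp) hA.inv
end PPsec
end FibProd

namespace FibProd
open Group Subgroup

section Reach
variable {G : Type*} [Group G]

inductive Reach (S : Set G) (χ : G → ℝ) (I : Set ℝ) : G → Prop
  | one : (0:ℝ) ∈ I → Reach S χ I 1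
  | step {s g : G} : Reach S χ I g → s ∈ S → χ (s * g) ∈ I → Reach S χ I (s * g)

variable {S : Set G} {χ : G → ℝ} {I J : Set ℝ}

theorem chi_one (hχ : ∀ a b, χ (a * b) = χ a + χ b) : χ 1 = 0 := by
  have := hχ 1 1
  simpa using this

theorem chi_inv (hχ : ∀ a b, χ (a * b) = χ a + χ b) (a : G) : χ a⁻¹ = - χ a := by
  have := hχ a a⁻¹
  rw [mul_inv_cancel, chi_one hχ] at this
  linarith

theorem Reach.mono (hIJ : I ⊆ J) {g : G} (h : Reach S χ I g) : Reach S χ J g := by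
  induction h with
  | one h => exact .one (hIJ h)
  | step h hs hm ih => exact .step ih hs (hIJ hm)

theorem Reach.mem (hχ : ∀ a b, χ (a * b) = χ a + χ b) {g : G} (h : Reach S χ I g) : χ g ∈ I := by
  cases h with
  | one h => rwa [chi_one hχ]
  | step h hs hm => exact hm

theorem Reach.zero_mem {g : G} (h : Reach S χ I g) : (0:ℝ) ∈ I := by
  induction h with
  | one h => exact h
  | step h hs hm ih => exact ih

theorem Reach.mul (hχ : ∀ a b, χ (a * b) = χ a + χ b) {a b : G} (ha : Reach S χ I a)
    (hb : Reach S χ {x | x + χ a ∈ I} b) : Reach S χ I (b * a) := by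
  induction hb with
  | one h => simpa using ha
  | step h hs hm ih =>
    rw [mul_assoc]
    refine .step ih hs ?_
    rw [← mul_assoc, hχ]; exact hm

theorem Reach.inv (hχ : ∀ a b, χ (a * b) = χ a + χ b) (hS : ∀ s ∈ S, s⁻¹ ∈ S) {g : G}
    (h : Reach S χ I g) : Reach S χ {x | x + χ g ∈ I} g⁻¹ := by
  induction h with
  | one h => simpa using Reach.one (S := S) (χ := χ) (I := {x | x + χ 1 ∈ I}) (by simpa [chi_one hχ] using h)
  | @step s g h hs hm ih =>
    rw [mul_inv_rev]
    have h1 : Reach S χ {x | x + χ (s * g) ∈ I} s⁻¹ := by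
      have := Reach.step (S := S) (χ := χ) (I := {x | x + χ (s * g) ∈ I}) (g := 1) (.one (by simpa using hm)) (hS s hs) (by
        simp only [mul_one, Set.mem_setOf_eq, hχ, chi_inv hχ]
        have := h.mem hχ
        rwa [neg_add_cancel_left])
      simpa using this
    refine Reach.mul hχ h1 (ih.mono ?_)
    intro x hx
    simp only [Set.mem_setOf_eq, hχ, chi_inv hχ] at hx ⊢
    convert hx using 1; ring

theorem Reach.inv_mul (hχ : ∀ a b, χ (a * b) = χ a + χ b) (hS : ∀ s ∈ S, s⁻¹ ∈ S) {a b : G}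
    (ha : Reach S χ I a) (hb : Reach S χ I b) (hab : χ a = χ b) : Reach S χ I (b⁻¹ * a) := by
  refine Reach.mul hχ ha ?_
  rw [hab]; exact hb.inv hχ hS

theorem reach_univ (hS : ∀ s ∈ S, s⁻¹ ∈ S) (hgen : closure S = ⊤) (g : G) :
    Reach S χ Set.univ g := by
  have hg : g ∈ closure S := by rw [hgen]; trivial
  induction hg using Subgroup.closure_induction_left with
  | one => exact .one trivial
  | mul_left s hs y hy ih => exact .step ih hs trivial
  | inv_mul_cancel s hs y hy ih => exact .step ih (hS s hs) trivial

/-- kernel elements reachable in `I` -/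
def Nsub (S : Set G) (χ : G → ℝ) (hχ : ∀ a b, χ (a * b) = χ a + χ b) (hS : ∀ s ∈ S, s⁻¹ ∈ S)
    (I : Set ℝ) (hI : (0:ℝ) ∈ I) : Subgroup G where
  carrier := {g | χ g = 0 ∧ Reach S χ I g}
  one_mem' := ⟨chi_one hχ, .one hI⟩
  mul_mem' := by
    rintro a b ⟨ha, ha'⟩ ⟨hb, hb'⟩
    refine ⟨by rw [hχ, ha, hb, add_zero], Reach.mul hχ hb' ?_⟩
    simpa [hb] using ha'
  inv_mem' := by
    rintro a ⟨ha, ha'⟩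
    refine ⟨by rw [chi_inv hχ, ha, neg_zero], ?_⟩
    simpa [ha] using ha'.inv hχ hS

theorem Reach.bounded_below (hχ : ∀ a b, χ (a * b) = χ a + χ b) {c : ℝ} {g : G}
    (h : Reach S χ (Set.Iic c) g) : ∃ c', Reach S χ (Set.Icc (-c') c) g := by
  induction h with
  | one h => exact ⟨0, .one (by simpa using h)⟩
  | @step s g h hs hm ih =>
    obtain ⟨c', hc'⟩ := ih
    refine ⟨max c' (-χ (s * g)), .step (hc'.mono ?_) hs ?_⟩
    · exact Set.Icc_subset_Icc (by simp) le_rfl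
    · refine ⟨?_, hm⟩
      have := le_max_right c' (-χ (s * g))
      linarith

theorem Reach.word (hχ : ∀ a b, χ (a * b) = χ a + χ b) (g : G) (h : Reach S χ I g) :
    ∃ L : List G, (∀ s ∈ L, s ∈ S) ∧ (L.map χ).sum = χ g := by
  induction h with
  | one h => exact ⟨[], by simp, by simp [chi_one hχ]⟩
  | @step s g h hs hm ih =>
    obtain ⟨L, hL, hL'⟩ := ih
    refine ⟨s :: L, ?_, by simp [hL', hχ]⟩
    simp only [List.mem_cons, forall_eq_or_imp]
    exact ⟨hs, hL⟩

theorem reach_interval_aux (hχ : ∀ a b, χ (a * b) = χ a + χ b) (hI : I.OrdConnected) (m : ℝ)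
    (hm : ∀ s ∈ S, |χ s| ≤ m) (hmI : Set.Icc (-m) m ⊆ I) (h0 : (0:ℝ) ∈ I) : ∀ (n : ℕ) (L : List G), L.length = n →
    (∀ s ∈ L, s ∈ S) → (L.map χ).sum ∈ I → ∃ g, Reach S χ I g ∧ χ g = (L.map χ).sum := by
  classical
  intro n
  induction n with
  | zero =>
    intro L hL _ _
    rw [List.length_eq_zero_iff] at hL
    subst hL
    exact ⟨1, .one h0, by simp [chi_one hχ]⟩
  | succ n ih =>
    intro L hL hLS hq
    set q := (L.map χ).sum with hqdef
    have key : ∀ s ∈ L, q - χ s ∈ I → ∃ g, Reach S χ I g ∧ χ g = q := by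
      intro s hs hqs
      have he := List.sum_map_erase χ hs
      have he' : ((L.erase s).map χ).sum = q - χ s := by rw [hqdef]; linarith
      obtain ⟨g, hg, hg'⟩ := ih (L.erase s) (by rw [List.length_erase_of_mem hs, hL]; rfl)
        (fun x hx => hLS x (List.mem_of_mem_erase hx)) (by rw [he']; exact hqs)
      have : χ (s * g) = q := by rw [hχ, hg', he']; ring
      exact ⟨s * g, .step hg (hLS s hs) (by rwa [this]), this⟩
    rcases lt_trichotomy q 0 with hq0 | hq0 | hq0
    · have : ∃ s ∈ L, χ s < 0 := by
        by_contra hcon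
        push Not at hcon
        have : 0 ≤ q := List.sum_nonneg (by
          intro x hx
          obtain ⟨s, hs, rfl⟩ := List.mem_map.1 hx
          exact hcon s hs)
        linarith
      obtain ⟨s, hs, hs0⟩ := this
      have h1 := abs_le.1 (hm s (hLS s hs))
      exact key s hs (hI.out hq (hmI (Set.right_mem_Icc.2 (by linarith))) ⟨by linarith, by linarith⟩)
    · exact ⟨1, .one h0, by rw [chi_one hχ, hq0]⟩
    · have : ∃ s ∈ L, 0 < χ s := by
        by_contra hcon
        push Not at hcon
        have : q ≤ 0 := by
          have := List.sum_le_sum (f := χ) (g := fun _ => 0) hcon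
          simpa using this
        linarith
      obtain ⟨s, hs, hs0⟩ := this
      have h1 := abs_le.1 (hm s (hLS s hs))
      exact key s hs (hI.out (hmI (Set.left_mem_Icc.2 (by linarith))) hq ⟨by linarith, by linarith⟩)

theorem reach_interval (hχ : ∀ a b, χ (a * b) = χ a + χ b) (hS : ∀ s ∈ S, s⁻¹ ∈ S)
    (hgen : closure S = ⊤) (hI : I.OrdConnected) (m : ℝ)
    (hm : ∀ s ∈ S, |χ s| ≤ m) (hmI : Set.Icc (-m) m ⊆ I) (h0 : (0:ℝ) ∈ I) (g : G) (hg : χ g ∈ I) :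
    ∃ g', Reach S χ I g' ∧ χ g' = χ g := by
  obtain ⟨L, hL, hL'⟩ := (reach_univ (χ := χ) hS hgen g).word hχ
  have := reach_interval_aux hχ hI m hm hmI h0 _ L rfl hL (by rwa [hL'])
  rwa [hL'] at this

end Reach
end FibProd

namespace FibProd
open Group Subgroup

section Phi
variable {G : Type*} [Group G]

def letters {n : ℕ} (f : FreeGroup (Fin n) →* G) : Set G :=
  {g | ∃ i, g = f (FreeGroup.of i) ∨ g = (f (FreeGroup.of i))⁻¹}

theorem letters_inv {n : ℕ} (f : FreeGroup (Fin n) →* G) : ∀ s ∈ letters f, s⁻¹ ∈ letters f := by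
  rintro s ⟨i, rfl | rfl⟩
  · exact ⟨i, Or.inr rfl⟩
  · exact ⟨i, Or.inl (inv_inv _)⟩

theorem letters_finite {n : ℕ} (f : FreeGroup (Fin n) →* G) : (letters f).Finite := by
  have : letters f = Set.range (fun i => f (FreeGroup.of i)) ∪ Set.range (fun i => (f (FreeGroup.of i))⁻¹) := by
    ext g
    simp only [letters, Set.mem_setOf_eq, Set.mem_union, Set.mem_range, exists_or, eq_comm]
  rw [this]
  exact (Set.finite_range _).union (Set.finite_range _)

theorem letters_gen {n : ℕ} (f : FreeGroup (Fin n) →* G) (hf : Function.Surjective f) :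
    closure (letters f) = ⊤ := by
  rw [eq_top_iff, ← MonoidHom.range_eq_top.2 hf, MonoidHom.range_eq_map, ← FreeGroup.closure_range_of,
    MonoidHom.map_closure]
  apply Subgroup.closure_mono
  rintro _ ⟨_, ⟨i, rfl⟩, rfl⟩
  exact ⟨i, Or.inl rfl⟩

/-- path of a word (last letters first) starting at height `q` stays in `I` -/
def PathIn {n : ℕ} (f : FreeGroup (Fin n) →* G) (χ : G → ℝ) (I : Set ℝ) (q : ℝ) :
    List (Fin n × Bool) → Prop
  | [] => q ∈ I
  | l :: L => PathIn f χ I q L ∧ χ (f (FreeGroup.mk (l :: L))) + q ∈ I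

theorem PathIn.last {n : ℕ} {f : FreeGroup (Fin n) →* G} {χ : G → ℝ} {I : Set ℝ} {q : ℝ}
    (hχ : ∀ a b, χ (a * b) = χ a + χ b)
    {L : List (Fin n × Bool)} (h : PathIn f χ I q L) : χ (f (FreeGroup.mk L)) + q ∈ I := by
  cases L with
  | nil =>
    have : (FreeGroup.mk [] : FreeGroup (Fin n)) = 1 := rfl
    rw [this, map_one, chi_one hχ, zero_add]; exact h
  | cons l L => exact h.2

theorem mk_cons {n : ℕ} (i : Fin n) (b : Bool) (L : List (Fin n × Bool)) :
    (FreeGroup.mk ((i, b) :: L) : FreeGroup (Fin n)) =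
      (bif b then FreeGroup.of i else (FreeGroup.of i)⁻¹) * FreeGroup.mk L := by
  cases b <;> simp [FreeGroup.of, FreeGroup.inv_mk, FreeGroup.mul_mk, FreeGroup.invRev]

theorem reach_pathIn {n : ℕ} (f : FreeGroup (Fin n) →* G) (χ : G → ℝ) (I : Set ℝ) (g : G)
    (h : Reach (letters f) χ I g) : ∃ L, PathIn f χ I 0 L ∧ f (FreeGroup.mk L) = g := by
  induction h with
  | one h => exact ⟨[], h, map_one f⟩
  | @step s g h hs hm ih =>
    obtain ⟨L, hL, rfl⟩ := ih
    obtain ⟨i, rfl | rfl⟩ := hs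
    · have : f (FreeGroup.mk ((i, true) :: L)) = f (FreeGroup.of i) * f (FreeGroup.mk L) := by
        rw [mk_cons, map_mul]; rfl
      exact ⟨(i, true) :: L, ⟨hL, by rw [this, add_zero]; exact hm⟩, this⟩
    · have : f (FreeGroup.mk ((i, false) :: L)) = (f (FreeGroup.of i))⁻¹ * f (FreeGroup.mk L) := by
        rw [mk_cons, map_mul]; simp
      exact ⟨(i, false) :: L, ⟨hL, by rw [this, add_zero]; exact hm⟩, this⟩

theorem chi_word_bound {n : ℕ} (f : FreeGroup (Fin n) →* G) (χ : G → ℝ)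
    (hχ : ∀ a b, χ (a * b) = χ a + χ b) (m : ℝ) (hm : ∀ s ∈ letters f, |χ s| ≤ m)
    (L : List (Fin n × Bool)) : |χ (f (FreeGroup.mk L))| ≤ L.length * m := by
  induction L with
  | nil =>
    have : (FreeGroup.mk [] : FreeGroup (Fin n)) = 1 := rfl
    simp [this, chi_one hχ]
  | cons l L ih =>
    obtain ⟨i, b⟩ := l
    rw [mk_cons, map_mul, hχ]
    have h1 : |χ (f (bif b then FreeGroup.of i else (FreeGroup.of i)⁻¹))| ≤ m := by
      apply hm
      cases b
      · exact ⟨i, Or.inr (by simp)⟩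
      · exact ⟨i, Or.inl rfl⟩
    refine (abs_add_le _ _).trans ?_
    push_cast [List.length_cons]
    linarith

theorem pathIn_of_bound {n : ℕ} (f : FreeGroup (Fin n) →* G) (χ : G → ℝ)
    (hχ : ∀ a b, χ (a * b) = χ a + χ b) (m : ℝ) (hm0 : 0 ≤ m) (hm : ∀ s ∈ letters f, |χ s| ≤ m)
    (I : Set ℝ) (q c : ℝ) (hI : Set.Icc (q - c) (q + c) ⊆ I)
    (L : List (Fin n × Bool)) (hL : L.length * m ≤ c) : PathIn f χ I q L := by
  have hc : 0 ≤ c := le_trans (by positivity) hL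
  induction L with
  | nil => exact hI ⟨by linarith, by linarith⟩
  | cons l L ih =>
    refine ⟨ih ?_, hI ?_⟩
    · refine le_trans ?_ hL
      gcongr
      simp
    · have := abs_le.1 ((chi_word_bound f χ hχ m hm (l :: L)).trans hL)
      exact ⟨by linarith, by linarith⟩

theorem exists_sigma (S : Set G) (hS : ∀ s ∈ S, s⁻¹ ∈ S) (hgen : closure S = ⊤) (χ : G → ℝ)
    (hχ : ∀ a b, χ (a * b) = χ a + χ b) (m : ℝ) (hm0 : 0 ≤ m) (hm : ∀ s ∈ S, |χ s| ≤ m)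
    (c₁ c₂ : ℝ) (h₁ : m ≤ c₁) (h₂ : m ≤ c₂) :
    ∃ σ : ℝ → G, σ 0 = 1 ∧ (∀ g, χ (σ (χ g)) = χ g) ∧
      (∀ g, χ g ∈ Set.Icc (-c₁) c₂ → Reach S χ (Set.Icc (-c₁) c₂) (σ (χ g))) ∧
      (∀ g, χ g ∈ Set.Ici (-c₁) → Reach S χ (Set.Ici (-c₁)) (σ (χ g))) ∧
      (∀ g, χ g ∈ Set.Iic c₂ → Reach S χ (Set.Iic c₂) (σ (χ g))) := by
  have : ∀ q : ℝ, ∃ x : G, (q = 0 → x = 1) ∧ ∀ g, χ g = q → χ x = q ∧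
      (q ∈ Set.Icc (-c₁) c₂ → Reach S χ (Set.Icc (-c₁) c₂) x) ∧
      (q ∈ Set.Ici (-c₁) → Reach S χ (Set.Ici (-c₁)) x) ∧
      (q ∈ Set.Iic c₂ → Reach S χ (Set.Iic c₂) x) := by
    intro q
    by_cases hq0 : q = 0
    · refine ⟨1, fun _ => rfl, fun g hg => ⟨by rw [chi_one hχ, hq0], fun h => .one (hq0 ▸ h),
        fun h => .one (hq0 ▸ h), fun h => .one (hq0 ▸ h)⟩⟩
    by_cases hr : ∃ g, χ g = q
    swap
    · exact ⟨1, fun h => absurd h hq0, fun g hg => absurd ⟨g, hg⟩ hr⟩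
    obtain ⟨g, hg⟩ := hr
    have k1 : Set.Icc (-c₁) c₂ ⊆ Set.Ici (-c₁) := fun x hx => hx.1
    have k2 : Set.Icc (-c₁) c₂ ⊆ Set.Iic c₂ := fun x hx => hx.2
    have k3 : Set.Icc (-m) m ⊆ Set.Icc (-c₁) c₂ := Set.Icc_subset_Icc (by linarith) h₂
    have k0 : (0:ℝ) ∈ Set.Icc (-c₁) c₂ := ⟨by linarith, by linarith⟩
    by_cases hI : q ∈ Set.Icc (-c₁) c₂
    · obtain ⟨x, hx, hx'⟩ := reach_interval hχ hS hgen Set.ordConnected_Icc m hm k3 k0 g (hg ▸ hI)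
      exact ⟨x, fun h => absurd h hq0, fun _ _ => ⟨hx'.trans hg, fun _ => hx, fun _ => hx.mono k1, fun _ => hx.mono k2⟩⟩
    by_cases hI' : q ∈ Set.Ici (-c₁)
    · obtain ⟨x, hx, hx'⟩ := reach_interval hχ hS hgen Set.ordConnected_Ici m hm (k3.trans k1) (k1 k0) g (hg ▸ hI')
      exact ⟨x, fun h => absurd h hq0, fun _ _ => ⟨hx'.trans hg, fun h => absurd h hI, fun _ => hx, fun h => absurd ⟨hI', h⟩ hI⟩⟩
    have hI2 : q ∈ Set.Iic c₂ := by
      simp only [Set.mem_Ici, not_le, Set.mem_Iic] at hI' ⊢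
      linarith
    obtain ⟨x, hx, hx'⟩ := reach_interval hχ hS hgen Set.ordConnected_Iic m hm (k3.trans k2) (k2 k0) g (hg ▸ hI2)
    exact ⟨x, fun h => absurd h hq0, fun _ _ => ⟨hx'.trans hg, fun h => absurd h hI, fun h => absurd h hI', fun _ => hx⟩⟩
  choose σ h1 h2 using this
  exact ⟨σ, h1 0 rfl, fun g => (h2 _ g rfl).1, fun g => (h2 _ g rfl).2.1, fun g => (h2 _ g rfl).2.2.1,
    fun g => (h2 _ g rfl).2.2.2⟩

/-- the kernel is generated by the two halves -/
theorem ker_gen (S : Set G) (hS : ∀ s ∈ S, s⁻¹ ∈ S) (hgen : closure S = ⊤) (χ : G → ℝ)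
    (hχ : ∀ a b, χ (a * b) = χ a + χ b) (m : ℝ) (hm0 : 0 ≤ m) (hm : ∀ s ∈ S, |χ s| ≤ m)
    (c₁ c₂ : ℝ) (h₁ : m ≤ c₁) (h₂ : m ≤ c₂) (K : Subgroup G)
    (hK₁ : ∀ g, χ g = 0 → Reach S χ (Set.Ici (-c₁)) g → g ∈ K)
    (hK₂ : ∀ g, χ g = 0 → Reach S χ (Set.Iic c₂) g → g ∈ K) (g : G) (hg : χ g = 0) : g ∈ K := by
  obtain ⟨σ, hσ0, hσ, -, hσ1, hσ2⟩ := exists_sigma S hS hgen χ hχ m hm0 hm c₁ c₂ h₁ h₂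
  have key : (σ (χ g))⁻¹ * g ∈ K := by
    clear hg
    have := reach_univ (χ := χ) hS hgen g
    induction this with
    | one h => rw [chi_one hχ, hσ0]; simp [one_mem]
    | @step s g h hs hm' ih =>
      have e : (σ (χ (s * g)))⁻¹ * (s * g) = ((σ (χ (s * g)))⁻¹ * (s * σ (χ g))) * ((σ (χ g))⁻¹ * g) := by group
      rw [e]
      refine mul_mem ?_ ih
      have h0 : χ (s * σ (χ g)) = χ (σ (χ (s * g))) := by rw [hσ, hχ, hχ, hσ]
      have h00 : χ (s * σ (χ g)) = χ (s * g) := by rw [h0, hσ]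
      have habs := abs_le.1 (hm s hs)
      have hz : χ ((σ (χ (s * g)))⁻¹ * (s * σ (χ g))) = 0 := by
        rw [hχ, chi_inv hχ, h0]; ring
      rcases le_total 0 (χ g) with hp | hp
      · have m1 : χ g ∈ Set.Ici (-c₁) := by simp; linarith
        have m2 : χ (s * g) ∈ Set.Ici (-c₁) := by simp [hχ]; linarith
        exact hK₁ _ hz (Reach.inv_mul hχ hS (.step (hσ1 _ m1) hs (by rwa [h00])) (hσ1 _ m2) h0)
      · have m1 : χ g ∈ Set.Iic c₂ := by simp; linarith
        have m2 : χ (s * g) ∈ Set.Iic c₂ := by simp [hχ]; linarith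
        exact hK₂ _ hz (Reach.inv_mul hχ hS (.step (hσ2 _ m1) hs (by rwa [h00])) (hσ2 _ m2) h0)
  rw [hg, hσ0] at key
  simpa using key
end Phi
end FibProd

namespace FibProd
open Group Subgroup

section Phi
variable {G : Type*} [Group G]

def JJ (c₁ c₂ : ℝ) (b : Bool) : Set ℝ := bif b then Set.Ici (-c₁) else Set.Iic c₂

theorem phi_exists {n : ℕ} (f : FreeGroup (Fin n) →* G) (hf : Function.Surjective f)
    (R : Set (FreeGroup (Fin n))) (hR : f.ker = normalClosure R) (χ : G → ℝ)
    (hχ : ∀ a b, χ (a * b) = χ a + χ b) (m : ℝ) (hm0 : 0 ≤ m) (hm : ∀ s ∈ letters f, |χ s| ≤ m)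
    (c₁ c₂ : ℝ) (h₁ : m ≤ c₁) (h₂ : m ≤ c₂) (hR₁ : ∀ r ∈ R, (FreeGroup.toWord r).length * m ≤ c₁)
    (hR₂ : ∀ r ∈ R, (FreeGroup.toWord r).length * m ≤ c₂)
    {P : Type*} [Group P] (ι : Bool → G → P)
    (hι : ∀ b x y, χ x = 0 → χ y = 0 → Reach (letters f) χ (JJ c₁ c₂ b) x →
      Reach (letters f) χ (JJ c₁ c₂ b) y → ι b (x * y) = ι b x * ι b y)
    (hι0 : ∀ x, χ x = 0 → Reach (letters f) χ (Set.Icc (-c₁) c₂) x → ι true x = ι false x) :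
    ∃ Φ : G → P, (∀ x y, χ x = 0 → χ y = 0 → Φ (x * y) = Φ x * Φ y) ∧
      ∀ b x, χ x = 0 → Reach (letters f) χ (JJ c₁ c₂ b) x → Φ x = ι b x := by
  classical
  set S := letters f with hSdef
  have hS : ∀ s ∈ S, s⁻¹ ∈ S := letters_inv f
  have hgen : closure S = ⊤ := letters_gen f hf
  obtain ⟨σ, hσ0, hσ, hσI, hσ1, hσ2⟩ := exists_sigma S hS hgen χ hχ m hm0 hm c₁ c₂ h₁ h₂
  have hσJ : ∀ b g, χ g ∈ JJ c₁ c₂ b → Reach S χ (JJ c₁ c₂ b) (σ (χ g)) := by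
    intro b; cases b
    · exact hσ2
    · exact hσ1
  have h0J : ∀ b, (0:ℝ) ∈ JJ c₁ c₂ b := by
    intro b; cases b
    · change (0:ℝ) ≤ c₂; linarith
    · change -c₁ ≤ (0:ℝ); linarith
  set nn : G → G → G := fun g h => (σ (χ (g * h)))⁻¹ * (g * σ (χ h)) with hnn
  have nn_mul : ∀ g g' h, nn (g * g') h = nn g (g' * h) * nn g' h := by
    intro g g' h
    simp only [hnn, mul_assoc]; group
  have nn_one : ∀ h, nn 1 h = 1 := by intro h; simp [hnn]
  have nn_inv : ∀ g h, nn g⁻¹ h = (nn g (g⁻¹ * h))⁻¹ := by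
    intro g h
    rw [eq_inv_iff_mul_eq_one, ← nn_one (g⁻¹ * h), ← inv_mul_cancel g, nn_mul]
    simp
  have chi_nn : ∀ g h, χ (nn g h) = 0 := by
    intro g h
    simp only [hnn, hχ, chi_inv hχ]
    rw [← hχ, hσ, hσ, hχ]; ring
  have nn_congr : ∀ g h h', χ h = χ h' → nn g h = nn g h' := by
    intro g h h' e
    simp only [hnn, hχ, e]
  have nn_letter : ∀ (I : Set ℝ), (∀ g, χ g ∈ I → Reach S χ I (σ (χ g))) → ∀ s ∈ S, ∀ h, χ h ∈ I →
      χ (s * h) ∈ I → Reach S χ I (nn s h) := by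
    intro I hI s hs h hh hsh
    have h0 : χ (s * σ (χ h)) = χ (s * h) := by rw [hχ, hσ, hχ]
    exact Reach.inv_mul hχ hS (.step (hI _ hh) hs (by rwa [h0])) (hI _ hsh) (by rw [h0, hσ])
  have hι1 : ∀ b, ι b 1 = 1 := by
    intro b
    have := hι b 1 1 (chi_one hχ) (chi_one hχ) (.one (h0J b)) (.one (h0J b))
    simpa using this
  have hιinv : ∀ b x, χ x = 0 → Reach S χ (JJ c₁ c₂ b) x → ι b x⁻¹ = (ι b x)⁻¹ := by
    intro b x hx hr
    have hr' : Reach S χ (JJ c₁ c₂ b) x⁻¹ := by simpa [hx] using hr.inv hχ hS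
    have := hι b x⁻¹ x (by rw [chi_inv hχ, hx, neg_zero]) hx hr' hr
    rw [inv_mul_cancel, hι1] at this
    exact eq_inv_of_mul_eq_one_left this.symm
  set sg : Fin n → G := fun i => f (FreeGroup.of i) with hsg
  have hsgS : ∀ i, sg i ∈ S := fun i => ⟨i, Or.inl rfl⟩
  set α : Fin n → G → P := fun i h => if χ h ∈ Set.Ici (-c₁) ∧ χ (sg i * h) ∈ Set.Ici (-c₁) then
    ι true (nn (sg i) h) else ι false (nn (sg i) h) with hαdef
  have hα : ∀ b i h, χ h ∈ JJ c₁ c₂ b → χ (sg i * h) ∈ JJ c₁ c₂ b → α i h = ι b (nn (sg i) h) := by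
    intro b i h hh hsh
    cases b
    · simp only [hαdef]
      split_ifs with hc
      · exact hι0 _ (chi_nn _ _) (nn_letter _ hσI _ (hsgS i) _ ⟨hc.1, hh⟩ ⟨hc.2, hsh⟩)
      · rfl
    · exact if_pos ⟨hh, hsh⟩
  have α_congr : ∀ i h h', χ h = χ h' → α i h = α i h' := by
    intro i h h' e
    simp only [hαdef, nn_congr _ _ _ e, hχ, e]
  let E : Fin n → Equiv.Perm (P × G) := fun i =>
    { toFun := fun x => (α i x.2 * x.1, sg i * x.2)
      invFun := fun x => ((α i ((sg i)⁻¹ * x.2))⁻¹ * x.1, (sg i)⁻¹ * x.2)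
      left_inv := by rintro ⟨p, h⟩; simp
      right_inv := by rintro ⟨p, h⟩; simp }
  let T : FreeGroup (Fin n) →* Equiv.Perm (P × G) := FreeGroup.lift E
  have T_of : ∀ i p h, T (FreeGroup.of i) (p, h) = (α i h * p, sg i * h) := by
    intro i p h; simp only [T, FreeGroup.lift_apply_of]; rfl
  have T_of_inv : ∀ i p h, T (FreeGroup.of i)⁻¹ (p, h) = ((α i ((sg i)⁻¹ * h))⁻¹ * p, (sg i)⁻¹ * h) := by
    intro i p h; rw [map_inv]; simp only [T, FreeGroup.lift_apply_of]; rfl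
  have T_path : ∀ b (L : List (Fin n × Bool)) p h, PathIn f χ (JJ c₁ c₂ b) (χ h) L →
      T (FreeGroup.mk L) (p, h) = (ι b (nn (f (FreeGroup.mk L)) h) * p, f (FreeGroup.mk L) * h) ∧
      Reach S χ (JJ c₁ c₂ b) (nn (f (FreeGroup.mk L)) h) := by
    intro b L p h
    induction L with
    | nil =>
      intro _
      have : (FreeGroup.mk [] : FreeGroup (Fin n)) = 1 := rfl
      rw [this, map_one, map_one, nn_one, hι1]
      simp only [Equiv.Perm.coe_one, id_eq, one_mul, true_and]
      exact .one (h0J b)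
    | cons l L ih =>
      intro hp
      obtain ⟨ih1, ih2⟩ := ih hp.1
      have hlast := hp.1.last hχ
      have hnew := hp.2
      obtain ⟨i, b'⟩ := l
      rw [mk_cons] at hnew ⊢
      rw [← hχ] at hlast
      rw [map_mul, ← hχ, mul_assoc] at hnew
      rw [map_mul, map_mul, Equiv.Perm.mul_apply, ih1, nn_mul]
      set h' := f (FreeGroup.mk L) * h with hh'
      have goal2 : Reach S χ (JJ c₁ c₂ b) (nn (f (bif b' then FreeGroup.of i else (FreeGroup.of i)⁻¹)) h') := by
        refine nn_letter _ (hσJ b) _ ?_ _ hlast hnew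
        cases b'
        · exact hS _ (hsgS i) |> fun h => by simpa using h
        · exact hsgS i
      refine ⟨?_, ?_⟩
      · rw [hι b _ _ (chi_nn _ _) (chi_nn _ _) goal2 ih2]
        cases b'
        · simp only [cond_false, map_inv] at hnew goal2 ⊢
          rw [← map_inv, T_of_inv]
          have e1 : α i ((sg i)⁻¹ * h') = ι b (nn (sg i) ((sg i)⁻¹ * h')) := by
            refine hα b i _ hnew ?_
            rw [mul_inv_cancel_left]; exact hlast
          have e2 : ι b (nn (sg i) ((sg i)⁻¹ * h'))⁻¹ = (ι b (nn (sg i) ((sg i)⁻¹ * h')))⁻¹ := by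
            refine hιinv b _ (chi_nn _ _) (nn_letter _ (hσJ b) _ (hsgS i) _ hnew ?_)
            rw [mul_inv_cancel_left]; exact hlast
          rw [e1, ← e2, ← nn_inv, mul_assoc, mul_assoc]
        · simp only [cond_true] at hnew goal2 ⊢
          rw [T_of, hα b i h' hlast hnew, mul_assoc, mul_assoc]
      · exact Reach.mul hχ ih2 (by simpa [chi_nn] using goal2)
  have T_R : ∀ r ∈ R, T r = 1 := by
    intro r hr
    have hfr : f r = 1 := by
      have : r ∈ f.ker := by rw [hR]; exact subset_normalClosure hr
      exact this
    ext1 ⟨p, h⟩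
    have : ∃ b, PathIn f χ (JJ c₁ c₂ b) (χ h) r.toWord := by
      rcases le_total 0 (χ h) with hp | hp
      · refine ⟨true, pathIn_of_bound f χ hχ m hm0 hm _ _ c₁ ?_ _ (hR₁ r hr)⟩
        intro x hx
        change -c₁ ≤ x
        linarith [hx.1]
      · refine ⟨false, pathIn_of_bound f χ hχ m hm0 hm _ _ c₂ ?_ _ (hR₂ r hr)⟩
        intro x hx
        change x ≤ c₂
        linarith [hx.2]
    obtain ⟨b, hb⟩ := this
    have := (T_path b _ p h hb).1
    rw [FreeGroup.mk_toWord, hfr, nn_one, hι1] at this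
    simpa using this
  have T_ker : ∀ w, f w = 1 → T w = 1 := by
    intro w hw
    have h1 : w ∈ f.ker := hw
    rw [hR] at h1
    have h2 : normalClosure R ≤ T.ker := normalClosure_le_normal T_R
    exact h2 h1
  have T_eq : ∀ w w', f w = f w' → T w = T w' := by
    intro w w' h
    have := T_ker (w * w'⁻¹) (by simp [h])
    rw [map_mul, map_inv, mul_inv_eq_one] at this
    exact this
  have T_equiv : ∀ w q, ∃ β : P, ∀ p h, χ h = q → T w (p, h) = (β * p, f w * h) := by
    intro w
    induction w using FreeGroup.induction_on with
    | C1 => intro q; exact ⟨1, by simp⟩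
    | of i =>
      intro q
      by_cases hq : ∃ h, χ h = q
      · obtain ⟨h0, hh0⟩ := hq
        exact ⟨α i h0, fun p h hh => by rw [T_of, α_congr i h h0 (hh.trans hh0.symm)]⟩
      · exact ⟨1, fun p h hh => absurd ⟨h, hh⟩ hq⟩
    | inv_of i _ =>
      intro q
      by_cases hq : ∃ h, χ h = q
      · obtain ⟨h0, hh0⟩ := hq
        refine ⟨(α i ((sg i)⁻¹ * h0))⁻¹, fun p h hh => ?_⟩
        rw [T_of_inv, α_congr i ((sg i)⁻¹ * h) ((sg i)⁻¹ * h0) (by rw [hχ, hχ, hh, hh0]), map_inv]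
      · exact ⟨1, fun p h hh => absurd ⟨h, hh⟩ hq⟩
    | mul x y hx hy =>
      intro q
      obtain ⟨β, hβ⟩ := hy q
      obtain ⟨β', hβ'⟩ := hx (χ (f y) + q)
      refine ⟨β' * β, fun p h hh => ?_⟩
      rw [map_mul, Equiv.Perm.mul_apply, hβ p h hh, hβ' _ _ (by rw [hχ, hh]), map_mul, mul_assoc, mul_assoc]
  choose w hw using hf
  refine ⟨fun g => (T (w g) (1, 1)).1, ?_, ?_⟩
  · intro x y hx hy
    simp only
    rw [T_eq (w (x * y)) (w x * w y) (by simp [hw]), map_mul, Equiv.Perm.mul_apply]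
    obtain ⟨β, hβ⟩ := T_equiv (w x) 0
    obtain ⟨β', hβ'⟩ := T_equiv (w y) 0
    rw [hβ' 1 1 (chi_one hχ), hβ 1 1 (chi_one hχ), hβ _ _ (by simp [hw, hy])]
    simp
  · intro b x hx hr
    obtain ⟨L, hL, hLx⟩ := reach_pathIn f χ _ x hr
    simp only
    rw [T_eq (w x) (FreeGroup.mk L) (by rw [hw, hLx])]
    have h0 : PathIn f χ (JJ c₁ c₂ b) (χ 1) L := by rwa [chi_one hχ]
    rw [(T_path b L 1 1 h0).1, hLx]
    simp [hnn, hx, chi_one hχ, hσ0]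
end Phi
end FibProd

namespace FibProd
open Group Subgroup

section ThmC
variable {G : Type*} [Group G]

theorem theoremC {n : ℕ} (f : FreeGroup (Fin n) →* G) (hf : Function.Surjective f)
    (R : Set (FreeGroup (Fin n))) (hRfin : R.Finite) (hR : f.ker = normalClosure R)
    (hfree : ∀ f : FreeGroup (Fin 2) →* G, ¬ Function.Injective f) (χ : G → ℝ)
    (hχ : ∀ a b, χ (a * b) = χ a + χ b) :
    (∃ c : ℝ, ∀ g, χ g = 0 → Reach (letters f) χ (Set.Ici (-c)) g) ∨
    (∃ c : ℝ, ∀ g, χ g = 0 → Reach (letters f) χ (Set.Iic c) g) := by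
  classical
  by_contra hcon
  push Not at hcon
  obtain ⟨hc1, hc2⟩ := hcon
  set S := letters f with hSdef
  have hS : ∀ s ∈ S, s⁻¹ ∈ S := letters_inv f
  have hgen : closure S = ⊤ := letters_gen f hf
  obtain ⟨m₀, hm₀⟩ := ((letters_finite f).image (fun s => |χ s|)).bddAbove
  set m := max m₀ 0
  have hm0 : 0 ≤ m := le_max_right _ _
  have hm : ∀ s ∈ S, |χ s| ≤ m := fun s hs => (hm₀ ⟨s, hs, rfl⟩).trans (le_max_left _ _)
  obtain ⟨c₀, hc₀⟩ := (hRfin.image (fun r => ((FreeGroup.toWord r).length : ℝ) * m)).bddAbove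
  set c := max c₀ m
  have hmc : m ≤ c := le_max_right _ _
  have hRc : ∀ r ∈ R, ((FreeGroup.toWord r).length : ℝ) * m ≤ c :=
    fun r hr => (hc₀ ⟨r, hr, rfl⟩).trans (le_max_left _ _)
  have h0J : ∀ b, (0:ℝ) ∈ JJ c c b := by
    intro b; cases b
    · change (0:ℝ) ≤ c; linarith
    · change -c ≤ (0:ℝ); linarith
  have h0I : (0:ℝ) ∈ Set.Icc (-c) c := ⟨by linarith, by linarith⟩
  have hIJ : ∀ b, Set.Icc (-c) c ⊆ JJ c c b := by
    intro b; cases b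
    · exact fun x hx => hx.2
    · exact fun x hx => hx.1
  let NJ : Bool → Subgroup G := fun b => Nsub S χ hχ hS (JJ c c b) (h0J b)
  let N0 : Subgroup G := Nsub S χ hχ hS (Set.Icc (-c) c) h0I
  have hle : ∀ b, N0 ≤ NJ b := fun b x hx => ⟨hx.1, hx.2.mono (hIJ b)⟩
  let φ : ∀ b, N0 →* NJ b := fun b => Subgroup.inclusion (hle b)
  have hφ : ∀ b, Function.Injective (φ b) := fun b => Subgroup.inclusion_injective (hle b)
  have hrange : ∀ b (x : NJ b), x ∈ (φ b).range → (x : G) ∈ N0 := by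
    rintro b _ ⟨y, rfl⟩; exact y.2
  -- choose a
  obtain ⟨a, ha1, ha2⟩ : ∃ a ∈ NJ true, a ∉ N0 := by
    by_contra hno
    push Not at hno
    obtain ⟨g, hg, hg'⟩ := hc2 c
    have := ker_gen S hS hgen χ hχ m hm0 hm c c hmc hmc (NJ false)
      (fun g hg hr => hle _ (hno g ⟨hg, hr⟩)) (fun g hg hr => ⟨hg, hr⟩) g hg
    exact hg' this.2
  have key : ∀ c' ≥ c, ∃ b ∈ NJ false, ¬ Reach S χ (Set.Icc (-c') c) b := by
    intro c' hc'
    by_contra hno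
    push Not at hno
    have h00 : (0:ℝ) ∈ Set.Ici (-c') := by simp; linarith
    obtain ⟨g, hg, hg'⟩ := hc1 c'
    have := ker_gen S hS hgen χ hχ m hm0 hm c' c (by linarith) hmc (Nsub S χ hχ hS (Set.Ici (-c')) h00)
      (fun g hg hr => ⟨hg, hr⟩) (fun g hg hr => ⟨hg, (hno g ⟨hg, hr⟩).mono (fun x hx => hx.1)⟩) g hg
    exact hg' this.2
  obtain ⟨b, hb1, hb2⟩ := key c le_rfl
  obtain ⟨c'', hc''⟩ := Reach.bounded_below hχ (show Reach S χ (Set.Iic c) b from hb1.2)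
  set c' := max c c''
  have hbr : Reach S χ (Set.Icc (-c') c) b :=
    hc''.mono (Set.Icc_subset_Icc (neg_le_neg (le_max_right _ _)) le_rfl)
  obtain ⟨b', hb'1, hb'2⟩ := key c' (le_max_left _ _)
  have hsub : Set.Icc (-c) c ⊆ Set.Icc (-c') c := Set.Icc_subset_Icc (neg_le_neg (le_max_left _ _)) le_rfl
  have hbb : b⁻¹ * b' ∉ N0 := by
    intro h
    apply hb'2
    have : Reach S χ (Set.Icc (-c') c) (b * (b⁻¹ * b')) := by
      refine Reach.mul hχ (h.2.mono hsub) ?_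
      rw [h.1]; exact hbr.mono (fun x hx => by simpa using hx)
    simpa using this
  -- the pushout
  let P := Monoid.PushoutI φ
  let ι : Bool → G → P := fun i x => if h : x ∈ NJ i then Monoid.PushoutI.of i ⟨x, h⟩ else 1
  obtain ⟨Φ, hΦ1, hΦ2⟩ := phi_exists f hf R hR χ hχ m hm0 hm c c hmc hmc hRc hRc ι (by
      intro i x y hx hy hrx hry
      have hx' : x ∈ NJ i := ⟨hx, hrx⟩
      have hy' : y ∈ NJ i := ⟨hy, hry⟩
      simp only [ι, dif_pos hx', dif_pos hy', dif_pos (mul_mem hx' hy'), ← map_mul]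
      rfl) (by
      intro x hx hr
      have h0 : x ∈ N0 := ⟨hx, hr⟩
      simp only [ι, dif_pos (hle _ h0)]
      exact (Monoid.PushoutI.of_apply_eq_base φ true ⟨x, h0⟩).trans
        (Monoid.PushoutI.of_apply_eq_base φ false ⟨x, h0⟩).symm)
  let K : Subgroup G := Nsub S χ hχ hS Set.univ trivial
  have hK : ∀ g, χ g = 0 → g ∈ K := fun g hg => ⟨hg, reach_univ hS hgen g⟩
  let Ψ : K →* P := MonoidHom.mk' (fun k => Φ k) (fun x y => hΦ1 _ _ x.2.1 y.2.1)
  have hΨ : ∀ i (x : G) (hx : x ∈ NJ i), Ψ ⟨x, hK x hx.1⟩ = Monoid.PushoutI.of i ⟨x, hx⟩ := by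
    intro i x hx
    change Φ x = _
    rw [hΦ2 i x hx.1 hx.2]
    simp only [ι, dif_pos hx]
  have hinj := free_in_pushout hφ ⟨a, ha1⟩ ⟨b', hb'1⟩ ⟨b, hb1⟩ (fun h => ha2 (hrange _ _ h))
    (fun h => hb'2 ((hrange _ _ h).2.mono hsub)) (fun h => hb2 (hrange _ _ h).2)
    (fun h => hbb (hrange _ _ h))
  let ka : K := ⟨a, hK a ha1.1⟩
  let kb : K := ⟨b, hK b hb1.1⟩
  let kb' : K := ⟨b', hK b' hb'1.1⟩
  let F : FreeGroup (Fin 2) →* K := FreeGroup.lift (fun i : Fin 2 => if i = 0 then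
      kb' * ka * kb⁻¹ else ka * (kb' * ka * kb⁻¹) * ka⁻¹)
  have hcomp : Ψ.comp F = FreeGroup.lift (fun i : Fin 2 => if i = 0 then
      (Monoid.PushoutI.of false ⟨b', hb'1⟩ * Monoid.PushoutI.of true ⟨a, ha1⟩ * (Monoid.PushoutI.of false ⟨b, hb1⟩)⁻¹ : P) else
      Monoid.PushoutI.of true ⟨a, ha1⟩ * (Monoid.PushoutI.of false ⟨b', hb'1⟩ * Monoid.PushoutI.of true ⟨a, ha1⟩ * (Monoid.PushoutI.of false ⟨b, hb1⟩)⁻¹) *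
        (Monoid.PushoutI.of true ⟨a, ha1⟩)⁻¹) := by
    ext i
    simp only [MonoidHom.comp_apply, F, FreeGroup.lift_apply_of]
    split_ifs
    · simp only [map_mul, map_inv, ka, kb, kb', hΨ _ _ ha1, hΨ _ _ hb1, hΨ _ _ hb'1]
    · simp only [map_mul, map_inv, ka, kb, kb', hΨ _ _ ha1, hΨ _ _ hb1, hΨ _ _ hb'1]
  rw [← hcomp, MonoidHom.coe_comp] at hinj
  exact hfree (K.subtype.comp F) (Subtype.val_injective.comp hinj.of_comp)
end ThmC
end FibProd

namespace FibProd
open Group Subgroup Filter Topology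

section Sig
variable {G : Type*} [Group G] {S : Set G} {χ : G → ℝ}

theorem chi_pow (hχ : ∀ a b, χ (a * b) = χ a + χ b) (a : G) (k : ℕ) : χ (a ^ k) = k * χ a := by
  induction k with
  | zero => simp [chi_one hχ]
  | succ k ih => rw [pow_succ, hχ, ih]; push_cast; ring

theorem Reach.neg {I : Set ℝ} {g : G} (h : Reach S χ I g) :
    Reach S (fun x => - χ x) {x | -x ∈ I} g := by
  induction h with
  | one h => exact .one (by simpa using h)
  | step h hs hm ih => exact .step ih hs (by simpa using hm)

theorem Reach.smul {g : G} (a : ℝ) (ha : 0 ≤ a) (h : Reach S χ (Set.Ici 0) g) :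
    Reach S (fun x => a * χ x) (Set.Ici 0) g := by
  induction h with
  | one h => exact .one (by simp)
  | step h hs hm ih => exact .step ih hs (mul_nonneg ha hm)

theorem Reach.Ioi_lemma {b : ℝ} {g : G} (h : Reach S χ (Set.Ioi b) g) :
    ∃ ε > 0, ∀ ε' ≤ ε, Reach S χ (Set.Ici (b + ε')) g := by
  induction h with
  | one h =>
    refine ⟨-b, by simpa using h, fun ε' h' => .one ?_⟩
    simp; linarith
  | @step s g h hs hm ih =>
    obtain ⟨ε, h0, hε⟩ := ih
    have hm' : b < χ (s * g) := hm
    refine ⟨min ε (χ (s * g) - b), lt_min h0 (by linarith), fun ε' h' => ?_⟩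
    refine .step (hε _ (h'.trans (min_le_left _ _))) hs ?_
    have := h'.trans (min_le_right _ _)
    change b + ε' ≤ _
    linarith

theorem Reach.bounded_below' {g : G} (h : Reach S χ Set.univ g) :
    ∃ c, 0 ≤ c ∧ Reach S χ (Set.Ici (-c)) g := by
  induction h with
  | one h => exact ⟨0, le_rfl, .one (by simp)⟩
  | @step s g h hs hm ih =>
    obtain ⟨c', h0, hc'⟩ := ih
    refine ⟨max c' (-χ (s * g)), h0.trans (le_max_left _ _), .step (hc'.mono ?_) hs ?_⟩
    · exact Set.Ici_subset_Ici.2 (by simp)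
    · have := le_max_right c' (-χ (s * g))
      simp only [Set.mem_Ici]
      linarith

/-- the open criterion -/
def Crit (S : Set G) (χ : G → ℝ) : Prop :=
  ∃ t ∈ S, 0 < χ t ∧ ∃ k : ℕ, ∀ s ∈ S, Reach S χ (Set.Ioi (-(k * χ t))) (t ^ k * s * (t ^ k)⁻¹)

theorem reach_pow (hχ : ∀ a b, χ (a * b) = χ a + χ b) {t : G} (ht : t ∈ S) (h0 : 0 ≤ χ t) (k : ℕ) :
    Reach S χ (Set.Ici 0) (t ^ k) := by
  induction k with
  | zero => rw [pow_zero]; exact .one (by simp)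
  | succ k ih =>
    rw [pow_succ']
    refine .step ih ht ?_
    rw [hχ, chi_pow hχ]
    simp only [Set.mem_Ici]; positivity

theorem crit_raise (hχ : ∀ a b, χ (a * b) = χ a + χ b) (hS : ∀ s ∈ S, s⁻¹ ∈ S)
    {t : G} (ht : t ∈ S) (h0 : 0 < χ t) (k : ℕ) (ε : ℝ)
    (hk : ∀ s ∈ S, Reach S χ (Set.Ici (-(k * χ t) + ε)) (t ^ k * s * (t ^ k)⁻¹))
    (d : ℝ) (g : G) (hg : χ g = 0) (h : Reach S χ (Set.Ici (-d)) g) :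
    Reach S χ (Set.Ici (min 0 (-d + ε))) g := by
  have hkt : 0 ≤ k * χ t := by positivity
  have h1 : (t ^ k * g * (t ^ k)⁻¹) = 1 ∨ Reach S χ (Set.Ici (min 0 (-d - k * χ t + ε))) (t ^ k * g * (t ^ k)⁻¹) := by
    right
    clear hg
    induction h with
    | one h =>
      simp only [mul_one, mul_inv_cancel]
      exact .one (by simp)
    | @step s g h hs hm ih =>
      have e : t ^ k * (s * g) * (t ^ k)⁻¹ = (t ^ k * s * (t ^ k)⁻¹) * (t ^ k * g * (t ^ k)⁻¹) := by group
      rw [e]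
      refine Reach.mul hχ ih ((hk s hs).mono ?_)
      intro x hx
      have hg' : χ (t ^ k * g * (t ^ k)⁻¹) = χ g := by rw [hχ, hχ, chi_inv hχ]; ring
      simp only [Set.mem_Ici, Set.mem_setOf_eq, hg'] at hx ⊢
      have h2 : -d ≤ χ g := h.mem hχ
      exact (min_le_right _ _).trans (by linarith)
  have h2 : Reach S χ (Set.Ici (min 0 (-d - k * χ t + ε))) (t ^ k * g * (t ^ k)⁻¹) := by
    rcases h1 with h1 | h1
    · rw [h1]; exact .one (by simp)
    · exact h1
  have hp := reach_pow (S := S) hχ ht h0.le k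
  have e : g = (t ^ k)⁻¹ * ((t ^ k * g * (t ^ k)⁻¹) * t ^ k) := by group
  rw [e]
  have h3 : Reach S χ (Set.Ici (min 0 (-d + ε))) ((t ^ k * g * (t ^ k)⁻¹) * t ^ k) := by
    refine Reach.mul hχ (hp.mono (Set.Ici_subset_Ici.2 (by simp))) (h2.mono ?_)
    intro x hx
    simp only [Set.mem_Ici, Set.mem_setOf_eq, chi_pow hχ] at hx ⊢
    rcases min_le_iff.1 hx with h | h
    · exact (min_le_left _ _).trans (by linarith)
    · exact (min_le_right _ _).trans (by linarith)
  refine Reach.mul hχ h3 ((hp.inv hχ hS).mono ?_)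
  intro x hx
  simp only [Set.mem_Ici, Set.mem_setOf_eq, hχ, chi_inv hχ, hg] at hx ⊢
  exact (min_le_left _ _).trans (by linarith)

theorem crit_sig (hχ : ∀ a b, χ (a * b) = χ a + χ b) (hS : ∀ s ∈ S, s⁻¹ ∈ S)
    (hgen : closure S = ⊤) (hfin : S.Finite) (h : Crit S χ) (g : G) (hg : χ g = 0) :
    Reach S χ (Set.Ici 0) g := by
  obtain ⟨t, ht, h0, k, hk⟩ := h
  have : ∃ ε > 0, ∀ s ∈ S, Reach S χ (Set.Ici (-(k * χ t) + ε)) (t ^ k * s * (t ^ k)⁻¹) := by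
    have : ∀ s ∈ S, ∀ᶠ ε in 𝓝[>] (0:ℝ), Reach S χ (Set.Ici (-(k * χ t) + ε)) (t ^ k * s * (t ^ k)⁻¹) := by
      intro s hs
      obtain ⟨ε, hε, h⟩ := (hk s hs).Ioi_lemma
      filter_upwards [Ioo_mem_nhdsGT hε] with e he using h e he.2.le
    have h2 := (hfin.eventually_all).2 this
    obtain ⟨ε, h3, h4⟩ := (h2.and self_mem_nhdsWithin).exists
    exact ⟨ε, h4, h3⟩
  obtain ⟨ε, hε, hk'⟩ := this
  obtain ⟨d, hd, hr⟩ := (reach_univ (χ := χ) hS hgen g).bounded_below'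
  have key : ∀ j : ℕ, Reach S χ (Set.Ici (min 0 (-d + j * ε))) g := by
    intro j
    induction j with
    | zero => simpa [hd] using hr
    | succ j ih =>
      have := crit_raise hχ hS ht h0 k ε hk' (-(min 0 (-d + j * ε))) g hg (by simpa using ih)
      refine this.mono (Set.Ici_subset_Ici.2 ?_)
      rw [neg_neg]
      push_cast
      refine le_min (min_le_left _ _) ?_
      rcases min_choice 0 (-d + j * ε) with h | h
      · rw [h]; exact (min_le_left _ _).trans (by linarith)
      · rw [h]; exact (min_le_right _ _).trans (by linarith)
  obtain ⟨j, hj⟩ := exists_nat_gt (d / ε)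
  have := key j
  rw [min_eq_left] at this
  · exact this
  · rw [div_lt_iff₀ hε] at hj; linarith

theorem sig_crit (hχ : ∀ a b, χ (a * b) = χ a + χ b)
    (hfin : S.Finite) (t : G) (ht : t ∈ S) (h0 : 0 < χ t) (c : ℝ)
    (hc : ∀ g, χ g = 0 → Reach S χ (Set.Ici (-c)) g) : Crit S χ := by
  obtain ⟨m, hm⟩ := (hfin.image (fun s => |χ s|)).bddAbove
  have hm : ∀ s ∈ S, |χ s| ≤ m := fun s hs => hm ⟨s, hs, rfl⟩
  have hm0 : 0 ≤ m := (abs_nonneg _).trans (hm t ht)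
  obtain ⟨k, hk⟩ := exists_nat_gt ((m + |c|) / χ t)
  rw [div_lt_iff₀ h0] at hk
  refine ⟨t, ht, h0, k, fun s hs => ?_⟩
  set g := t ^ k * s * (t ^ k)⁻¹ with hgdef
  have hg : χ (g * s⁻¹) = 0 := by simp only [hgdef, hχ, chi_inv hχ]; ring
  have h1 : Reach S χ (Set.Ici (-(m + |c|))) s := by
    have : Reach S χ (Set.Ici (-(m + |c|))) (s * 1) := by
      refine .step (.one ?_) hs ?_
      · simp only [Set.mem_Ici]; have := abs_nonneg c; linarith
      · simp only [Set.mem_Ici, mul_one]; have := abs_nonneg c; have := (abs_le.1 (hm s hs)).1; linarith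
    simpa using this
  have h2 : Reach S χ (Set.Ici (-(m + |c|))) ((g * s⁻¹) * s) := by
    refine Reach.mul hχ h1 ((hc _ hg).mono ?_)
    intro x hx
    simp only [Set.mem_Ici, Set.mem_setOf_eq] at hx ⊢
    have := (abs_le.1 (hm s hs)).1
    have := le_abs_self c
    linarith
  rw [inv_mul_cancel_right] at h2
  refine h2.mono ?_
  intro x hx
  simp only [Set.mem_Ici, Set.mem_Ioi] at hx ⊢
  linarith

theorem reach_open {V : Type*} [TopologicalSpace V] (X : V → G → ℝ) (hX : ∀ g, Continuous fun v => X v g)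
    (b : V → ℝ) (hb : Continuous b) (v₀ : V) (g : G) (h : Reach S (X v₀) (Set.Ioi (b v₀)) g) :
    ∀ᶠ v in 𝓝 v₀, Reach S (X v) (Set.Ioi (b v)) g := by
  induction h with
  | one h =>
    filter_upwards [(hb.tendsto v₀).eventually_lt_const h] with v hv using .one hv
  | @step s g h hs hm ih =>
    filter_upwards [ih, (hb.tendsto v₀).eventually_lt ((hX (s * g)).tendsto v₀) hm] with v h1 h2
    exact .step h1 hs h2

theorem crit_open {V : Type*} [TopologicalSpace V] (X : V → G → ℝ) (hX : ∀ g, Continuous fun v => X v g)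
    (hfin : S.Finite) : IsOpen {v | Crit S (X v)} := by
  rw [isOpen_iff_eventually]
  rintro v₀ ⟨t, ht, h0, k, hk⟩
  have h1 : ∀ᶠ v in 𝓝 v₀, 0 < X v t := ((hX t).tendsto v₀).eventually_const_lt h0
  have h2 : ∀ᶠ v in 𝓝 v₀, ∀ s ∈ S, Reach S (X v) (Set.Ioi (-(k * X v t))) (t ^ k * s * (t ^ k)⁻¹) := by
    refine hfin.eventually_all.2 fun s hs => ?_
    exact reach_open X hX (fun v => -(k * X v t)) (by have := hX t; fun_prop) v₀ _ (hk s hs)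
  filter_upwards [h1, h2] with v a b using ⟨t, ht, a, k, b⟩

theorem exists_pos (hχ : ∀ a b, χ (a * b) = χ a + χ b) (hS : ∀ s ∈ S, s⁻¹ ∈ S)
    (hgen : closure S = ⊤) (h : ∃ g, χ g ≠ 0) : ∃ t ∈ S, 0 < χ t := by
  by_contra hno
  push Not at hno
  obtain ⟨g, hg⟩ := h
  apply hg
  have h0 : ∀ s ∈ S, χ s = 0 := fun s hs => le_antisymm (hno s hs) (by
    have := hno _ (hS s hs); rw [chi_inv hχ] at this; linarith)
  have hu := reach_univ (χ := χ) hS hgen g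
  clear hg
  induction hu with
  | one h => exact chi_one hχ
  | step h hs hm ih => rw [hχ, ih, h0 _ hs, add_zero]

end Sig

theorem exists_rational_sig {G : Type*} [Group G] {n : ℕ} (f : FreeGroup (Fin n) →* G) (hf : Function.Surjective f)
    (R : Set (FreeGroup (Fin n))) (hRfin : R.Finite) (hR : f.ker = normalClosure R)
    (hfree : ∀ f : FreeGroup (Fin 2) →* G, ¬ Function.Injective f) (φ₁ φ₂ : G → ℤ)
    (h₁ : ∀ a b, φ₁ (a * b) = φ₁ a + φ₁ b) (h₂ : ∀ a b, φ₂ (a * b) = φ₂ a + φ₂ b)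
    (hsurj : ∀ x y, ∃ g, φ₁ g = x ∧ φ₂ g = y) :
    ∃ a b : ℤ, IsCoprime a b ∧ ∀ g, a * φ₁ g + b * φ₂ g = 0 →
      Reach (letters f) (fun g => ((a * φ₁ g + b * φ₂ g : ℤ) : ℝ)) (Set.Ici 0) g ∧
      Reach (letters f) (fun g => - ((a * φ₁ g + b * φ₂ g : ℤ) : ℝ)) (Set.Ici 0) g := by
  set S := letters f with hSdef
  have hS : ∀ s ∈ S, s⁻¹ ∈ S := letters_inv f
  have hgen : closure S = ⊤ := letters_gen f hf
  have hfin : S.Finite := letters_finite f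
  let X : ℝ × ℝ → G → ℝ := fun v g => v.1 * φ₁ g + v.2 * φ₂ g
  have hX : ∀ g, Continuous fun v => X v g := by intro g; simp only [X]; fun_prop
  have hXa : ∀ v a b, X v (a * b) = X v a + X v b := by
    intro v a b; simp only [X, h₁, h₂]; push_cast; ring
  have hXneg : ∀ v, X (-v) = fun g => - X v g := by
    intro v; ext g; simp only [X, Prod.fst_neg, Prod.snd_neg]; ring
  have hXne : ∀ v, v ≠ 0 → ∃ g, X v g ≠ 0 := by
    intro v hv
    by_contra hno
    push Not at hno
    apply hv
    obtain ⟨g, hg1, hg2⟩ := hsurj 1 0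
    obtain ⟨g', hg1', hg2'⟩ := hsurj 0 1
    have e1 := hno g
    have e2 := hno g'
    simp [X, hg1, hg2, hg1', hg2'] at e1 e2
    exact Prod.ext e1 e2
  let U : Set (ℝ × ℝ) := {v | Crit S (X v)}
  have hU : IsOpen U := crit_open X hX hfin
  let U' : Set (ℝ × ℝ) := {v | -v ∈ U}
  have hU' : IsOpen U' := hU.preimage continuous_neg
  have hcov : ({0}ᶜ : Set (ℝ × ℝ)) ⊆ U ∪ U' := by
    intro v hv
    have hv : v ≠ 0 := hv
    rcases theoremC f hf R hRfin hR hfree (X v) (hXa v) with ⟨c, hc⟩ | ⟨c, hc⟩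
    · obtain ⟨t, ht, h0⟩ := exists_pos (hXa v) hS hgen (hXne v hv)
      exact Or.inl (sig_crit (hXa v) hfin t ht h0 c hc)
    · obtain ⟨t, ht, h0⟩ := exists_pos (hXa (-v)) hS hgen (hXne (-v) (by simpa using hv))
      refine Or.inr (sig_crit (hXa (-v)) hfin t ht h0 c ?_)
      intro g hg
      have hg' : X v g = 0 := by rw [hXneg] at hg; simpa using hg
      rw [hXneg]
      refine (hc g hg').neg.mono ?_
      intro x hx
      simp only [Set.mem_Iic, Set.mem_setOf_eq, Set.mem_Ici] at hx ⊢
      linarith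
  have hconn : IsConnected ({0}ᶜ : Set (ℝ × ℝ)) := by
    apply isConnected_compl_singleton_of_one_lt_rank
    rw [rank_prod', Module.rank_self]
    norm_num
  have h0U : (0 : ℝ × ℝ) ∉ U := by
    rintro ⟨t, ht, h0, -⟩
    simp [X] at h0
  have hne : ∃ v, v ∈ ({0}ᶜ : Set (ℝ × ℝ)) ∩ U := by
    obtain ⟨v, hv⟩ := hconn.nonempty
    rcases hcov hv with h | h
    · exact ⟨v, hv, h⟩
    · exact ⟨-v, by simpa using hv, h⟩
  have hne' : ∃ v, v ∈ ({0}ᶜ : Set (ℝ × ℝ)) ∩ U' := by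
    obtain ⟨v, hv, hv'⟩ := hne
    exact ⟨-v, by simpa using hv, by simpa [U'] using hv'⟩
  obtain ⟨v, hv, hvU, hvU'⟩ := hconn.isPreconnected U U' hU hU' hcov hne hne'
  have hd : DenseRange (Prod.map ((↑) : ℚ → ℝ) ((↑) : ℚ → ℝ)) :=
    Rat.denseRange_cast.prodMap Rat.denseRange_cast
  obtain ⟨⟨p, q⟩, hpq⟩ := hd.exists_mem_open (hU.inter hU') ⟨v, hvU, hvU'⟩
  have hpq0 : ¬ (p = 0 ∧ q = 0) := by
    rintro ⟨rfl, rfl⟩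
    exact h0U (by simpa [← Prod.mk_zero_zero] using hpq.1)
  set A : ℤ := p.num * q.den with hA
  set B : ℤ := q.num * p.den with hB
  have hAB : ¬ (A = 0 ∧ B = 0) := by
    rintro ⟨ha, hb⟩
    apply hpq0
    simpa [hA, hB] using And.intro ha hb
  have hgcd : 0 < Int.gcd A B := by
    rw [Int.gcd_pos_iff]
    by_contra hno; push Not at hno; exact hAB hno
  obtain ⟨a, ha⟩ : (Int.gcd A B : ℤ) ∣ A := Int.gcd_dvd_left ..
  obtain ⟨b, hb⟩ : (Int.gcd A B : ℤ) ∣ B := Int.gcd_dvd_right ..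
  have hcop : IsCoprime a b := by
    have := Int.gcd_eq_gcd_ab A B
    refine ⟨Int.gcdA A B, Int.gcdB A B, ?_⟩
    have hg : (Int.gcd A B : ℤ) ≠ 0 := by exact_mod_cast hgcd.ne'
    apply mul_left_cancel₀ hg
    linear_combination (-(Int.gcdA A B)) * ha - Int.gcdB A B * hb - this
  set μ : ℝ := (p.den * q.den : ℝ) / (Int.gcd A B : ℝ) with hμ
  have hμ0 : 0 ≤ μ := by positivity
  have hg0 : (Int.gcd A B : ℝ) ≠ 0 := by exact_mod_cast hgcd.ne'
  have hp0 : (p.den : ℝ) ≠ 0 := by exact_mod_cast p.den_ne_zero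
  have hq0 : (q.den : ℝ) ≠ 0 := by exact_mod_cast q.den_ne_zero
  have hpr : (p : ℝ) * p.den = p.num := by exact_mod_cast Rat.mul_den_eq_num p
  have hqr : (q : ℝ) * q.den = q.num := by exact_mod_cast Rat.mul_den_eq_num q
  have haR : (p.num : ℝ) * q.den = Int.gcd A B * a := by rw [hA] at ha; exact_mod_cast ha
  have hbR : (q.num : ℝ) * p.den = Int.gcd A B * b := by rw [hB] at hb; exact_mod_cast hb
  have ea : (a : ℝ) = μ * p := by
    rw [hμ, div_mul_eq_mul_div, eq_div_iff hg0]
    linear_combination -haR - q.den * hpr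
  have eb : (b : ℝ) = μ * q := by
    rw [hμ, div_mul_eq_mul_div, eq_div_iff hg0]
    linear_combination -hbR - p.den * hqr
  set v' : ℝ × ℝ := ((p : ℝ), (q : ℝ)) with hv'
  have e : (fun g => ((a * φ₁ g + b * φ₂ g : ℤ) : ℝ)) = fun g => μ * X v' g := by
    ext g
    push_cast
    rw [ea, eb]; simp only [X, hv']; ring
  have e' : (fun g => - ((a * φ₁ g + b * φ₂ g : ℤ) : ℝ)) = fun g => μ * X (-v') g := by
    ext g
    push_cast
    rw [ea, eb]; simp only [X, hv', Prod.fst_neg, Prod.snd_neg]; ring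
  refine ⟨a, b, hcop, fun g hg => ?_⟩
  have hμ1 : μ ≠ 0 := by positivity
  have hXg : X v' g = 0 := by
    have h1 := congrFun e g
    simp only [hg, Int.cast_zero] at h1
    simpa [hμ1] using h1.symm
  have hXg' : X (-v') g = 0 := by rw [hXneg]; simp [hXg]
  rw [e, e']
  exact ⟨(crit_sig (hXa v') hS hgen hfin hpq.1 g hXg).smul μ hμ0,
    (crit_sig (hXa (-v')) hS hgen hfin hpq.2 g hXg').smul μ hμ0⟩
end FibProd

namespace FibProd
open Group Subgroup

section A3
variable {G : Type*} [Group G]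

theorem zchi_one {χ : G → ℤ} (hχ : ∀ a b, χ (a * b) = χ a + χ b) : χ 1 = 0 := by
  have := hχ 1 1
  simpa using this

theorem zchi_inv {χ : G → ℤ} (hχ : ∀ a b, χ (a * b) = χ a + χ b) (a : G) : χ a⁻¹ = - χ a := by
  have := hχ a a⁻¹
  rw [mul_inv_cancel, zchi_one hχ] at this
  linarith

theorem zchi_zpow {χ : G → ℤ} (hχ : ∀ a b, χ (a * b) = χ a + χ b) (a : G) (k : ℤ) :
    χ (a ^ k) = k * χ a := by
  induction k with
  | zero => simp [zchi_one hχ]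
  | succ i h => rw [zpow_add_one, hχ, h]; ring
  | pred i h => rw [zpow_sub_one, hχ, h, zchi_inv hχ]; ring

/-- kernel of an additive function to `ℤ` -/
def kerZ (χ : G → ℤ) (hχ : ∀ a b, χ (a * b) = χ a + χ b) : Subgroup G where
  carrier := {g | χ g = 0}
  one_mem' := zchi_one hχ
  mul_mem' := by intro a b ha hb; simp only [Set.mem_setOf_eq] at *; rw [hχ, ha, hb, add_zero]
  inv_mem' := by intro a ha; simp only [Set.mem_setOf_eq] at *; rw [zchi_inv hχ, ha, neg_zero]

theorem mem_kerZ {χ : G → ℤ} {hχ : ∀ a b, χ (a * b) = χ a + χ b} {g : G} : g ∈ kerZ χ hχ ↔ χ g = 0 :=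
  Iff.rfl

/-- `N` is an ascending union of conjugates of a finitely generated group -/
def Asc (N : Subgroup G) (t : G) : Prop :=
  ∃ Z : Set G, Z.Finite ∧ Z ⊆ N ∧ (∀ z ∈ Z, t⁻¹ * z * t ∈ closure Z) ∧
    ∀ n ∈ N, ∃ k : ℕ, (t ^ k)⁻¹ * n * t ^ k ∈ closure Z

theorem conj_mem_of_closure (Z : Set G) (H : Subgroup G) (t : G) (h : ∀ z ∈ Z, t⁻¹ * z * t ∈ H) :
    ∀ z ∈ closure Z, t⁻¹ * z * t ∈ H := by
  intro z hz
  have h1 : closure Z ≤ H.comap (MulAut.conj t⁻¹).toMonoidHom := by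
    rw [closure_le]
    intro x hx
    simpa [Subgroup.mem_comap] using h x hx
  simpa using h1 hz

theorem conj_mem_closure (Z : Set G) (t : G) (h : ∀ z ∈ Z, t⁻¹ * z * t ∈ closure Z) :
    ∀ z ∈ closure Z, t⁻¹ * z * t ∈ closure Z := by
  intro z hz
  have h1 : closure Z ≤ (closure Z).comap (MulAut.conj t⁻¹).toMonoidHom := by
    rw [closure_le]
    intro x hx
    simpa [Subgroup.mem_comap] using h x hx
  simpa using h1 hz

theorem conj_pow_mem_closure (Z : Set G) (t : G) (h : ∀ z ∈ Z, t⁻¹ * z * t ∈ closure Z) (k : ℕ) :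
    ∀ z ∈ closure Z, (t ^ k)⁻¹ * z * t ^ k ∈ closure Z := by
  induction k with
  | zero => simp
  | succ k ih =>
    intro z hz
    have := conj_mem_closure Z t h _ (ih z hz)
    convert this using 1
    rw [pow_succ]; group

theorem fg_of_asc (N : Subgroup G) (t : G) (hN : ∀ n ∈ N, t * n * t⁻¹ ∈ N) (h1 : Asc N t) (h2 : Asc N t⁻¹) : N.FG := by
  obtain ⟨Z, hZ, hZN, hZt, hZa⟩ := h1
  obtain ⟨Z', hZ', hZN', hZt', hZa'⟩ := h2
  -- common k with t^{-k} Z' t^k in closure Z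
  have : ∃ k : ℕ, ∀ z ∈ Z', (t ^ k)⁻¹ * z * t ^ k ∈ closure Z := by
    choose! k hk using hZa
    obtain ⟨K, hK⟩ := (hZ'.image k).bddAbove
    refine ⟨K, fun z hz => ?_⟩
    have hle : k z ≤ K := hK ⟨z, hz, rfl⟩
    have := conj_pow_mem_closure Z t hZt (K - k z) _ (hk z (hZN' hz))
    convert this using 1
    obtain ⟨d, rfl⟩ := Nat.exists_eq_add_of_le hle
    rw [Nat.add_sub_cancel_left, pow_add]; group
  obtain ⟨k, hk⟩ := this
  -- N = t^k ⟨Z⟩ t^{-k}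
  have hNk : ∀ (k : ℕ), ∀ n ∈ N, t ^ k * n * (t ^ k)⁻¹ ∈ N := by
    intro k
    induction k with
    | zero => simp
    | succ k ih =>
      intro n hn
      have := hN _ (ih n hn)
      convert this using 1
      rw [pow_succ']; group
  have hgen : N = closure ((MulAut.conj (t ^ k)) '' Z) := by
    apply le_antisymm
    · intro n hn
      obtain ⟨j, hj⟩ := hZa' n hn
      -- t^j n t^{-j} ∈ ⟨Z'⟩
      have h3 : ∀ z ∈ closure Z', (t ^ k)⁻¹ * z * t ^ k ∈ closure Z := by
        exact conj_mem_of_closure Z' _ (t ^ k) hk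
      have h4 := conj_pow_mem_closure Z t hZt j _ (h3 _ hj)
      have h5 : (t ^ k)⁻¹ * n * t ^ k ∈ closure Z := by
        convert h4 using 1
        have : t ^ k * t ^ j = t ^ j * t ^ k := by rw [← pow_add, ← pow_add, add_comm]
        have h6 : t ^ j * (t ^ k)⁻¹ = (t ^ k)⁻¹ * t ^ j := by
          rw [eq_inv_mul_iff_mul_eq, ← mul_assoc, this]; group
        simp only [inv_pow, inv_inv]
        have : (t ^ j)⁻¹ * (t ^ k)⁻¹ = (t ^ k)⁻¹ * (t ^ j)⁻¹ := by
          rw [← mul_inv_rev, ← mul_inv_rev, this]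
        calc (t ^ k)⁻¹ * n * t ^ k = ((t ^ k)⁻¹ * (t ^ j)⁻¹) * (t ^ j * n * (t ^ j)⁻¹) * (t ^ j * t ^ k) := by group
          _ = ((t ^ j)⁻¹ * (t ^ k)⁻¹) * (t ^ j * n * (t ^ j)⁻¹) * (t ^ k * t ^ j) := by rw [this, ‹t ^ k * t ^ j = _›]
          _ = _ := by group
      change n ∈ closure ((MulAut.conj (t ^ k)).toMonoidHom '' Z)
      rw [← MonoidHom.map_closure]
      refine ⟨_, h5, ?_⟩
      change t ^ k * ((t ^ k)⁻¹ * n * t ^ k) * (t ^ k)⁻¹ = n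
      group
    · rw [closure_le]
      rintro _ ⟨z, hz, rfl⟩
      exact hNk k z (hZN hz)
  rw [hgen]
  exact ⟨(hZ.image (MulAut.conj (t ^ k))).toFinset, by rw [Set.Finite.coe_toFinset]⟩

theorem asc_of_reach (S : Set G) (hfin : S.Finite) (χ : G → ℤ) (hχ : ∀ a b, χ (a * b) = χ a + χ b) (t : G)
    (ht : χ t = 1) (c : ℝ) (h : ∀ g, χ g = 0 → Reach S (fun g => (χ g : ℝ)) (Set.Ici (-c)) g) :
    Asc (kerZ χ hχ) t⁻¹ := by
  obtain ⟨C, hC⟩ := exists_nat_ge c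
  -- generators w s q = t^{C-q} (t^{-χ s} s) t^{q-C}
  set w : G → ℕ → G := fun s q => t ^ ((C : ℤ) - q) * (t ^ (-χ s) * s) * t ^ ((q : ℤ) - C) with hw
  set D : ℕ → Set G := fun K => {x | ∃ s ∈ S, ∃ q ≤ K, x = w s q} with hD
  have hDmono : ∀ K K', K ≤ K' → closure (D K) ≤ closure (D K') := by
    intro K K' hKK
    apply Subgroup.closure_mono
    rintro _ ⟨s, hs, q, hq, rfl⟩
    exact ⟨s, hs, q, hq.trans hKK, rfl⟩
  have hwN : ∀ s q, χ (w s q) = 0 := by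
    intro s q
    simp only [hw, hχ, zchi_zpow hχ, ht]; ring
  have hwconj : ∀ s q, t * w s (q+1) * t⁻¹ = w s q := by
    intro s q
    have e1 : t ^ ((C : ℤ) - q) = t * t ^ ((C : ℤ) - ((q+1 : ℕ) : ℤ)) := by
      rw [← zpow_one_add]; congr 1; push_cast; ring
    have e2 : t ^ ((q : ℤ) - C) = t ^ (((q+1 : ℕ) : ℤ) - C) * t⁻¹ := by
      rw [← zpow_sub_one]; congr 1; push_cast; ring
    simp only [hw]
    rw [e1, e2]; group
  have key : ∀ g, Reach S (fun g => (χ g : ℝ)) (Set.Ici (-c)) g → ∃ K, t ^ (-χ g) * g ∈ closure (D K) := by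
    intro g hg
    induction hg with
    | one h => exact ⟨0, by rw [zchi_one hχ]; simp [one_mem]⟩
    | @step s g hg hs hm ih =>
      obtain ⟨K, hK⟩ := ih
      have hgc : -c ≤ (χ g : ℝ) := hg.mem (fun a b => by simp [hχ])
      have hgC : -(C : ℤ) ≤ χ g := by
        have : (-(C:ℝ)) ≤ (χ g : ℝ) := by linarith
        exact_mod_cast this
      obtain ⟨q, hq⟩ := Int.eq_ofNat_of_zero_le (a := χ g + C) (by linarith)
      refine ⟨max K q, ?_⟩
      have e : t ^ (-χ (s * g)) * (s * g) = w s q * (t ^ (-χ g) * g) := by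
        simp only [hw, hχ]
        rw [show (C : ℤ) - q = - χ g by omega, show (q : ℤ) - C = χ g by omega]
        rw [show -(χ s + χ g) = - χ g + (- χ s) by ring, zpow_add]
        group
      rw [e]
      exact mul_mem (subset_closure ⟨s, hs, q, le_max_right _ _, rfl⟩) (hDmono _ _ (le_max_left _ _) hK)
  have key' : ∀ g, χ g = 0 → ∃ K, g ∈ closure (D K) := by
    intro g hg
    obtain ⟨K, hK⟩ := key g (h g hg)
    exact ⟨K, by simpa [hg] using hK⟩
  have hK0 : ∃ K, ∀ s ∈ S, t * w s 0 * t⁻¹ ∈ closure (D K) := by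
    have : ∀ s, ∃ K, t * w s 0 * t⁻¹ ∈ closure (D K) := fun s => key' _ (by
      simp only [hχ, hwN, zchi_inv hχ]; ring)
    choose k hk using this
    obtain ⟨K, hK⟩ := (hfin.image k).bddAbove
    exact ⟨K, fun s hs => hDmono _ _ (hK ⟨s, hs, rfl⟩) (hk s)⟩
  obtain ⟨K, hK⟩ := hK0
  have hstep : ∀ K', K ≤ K' → ∀ z ∈ D K', (t⁻¹)⁻¹ * z * t⁻¹ ∈ closure (D K') := by
    rintro K' hKK' _ ⟨s, hs, q, hq, rfl⟩
    rw [inv_inv]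
    cases q with
    | zero => exact hDmono _ _ hKK' (hK s hs)
    | succ q =>
      rw [hwconj]
      exact subset_closure ⟨s, hs, q, by omega, rfl⟩
  have hdown : ∀ d, ∀ x ∈ closure (D (K + d)), (t⁻¹ ^ d)⁻¹ * x * t⁻¹ ^ d ∈ closure (D K) := by
    intro d
    induction d with
    | zero => simp
    | succ d ih =>
      intro x hx
      have h1 : (t⁻¹)⁻¹ * x * t⁻¹ ∈ closure (D (K + d)) := by
        refine conj_mem_of_closure (D (K + (d+1))) (closure (D (K + d))) t⁻¹ ?_ x hx
        rintro _ ⟨s, hs, q, hq, rfl⟩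
        rw [inv_inv]
        cases q with
        | zero => exact hDmono _ _ (by omega) (hK s hs)
        | succ q =>
          rw [hwconj]
          exact subset_closure ⟨s, hs, q, by omega, rfl⟩
      have := ih _ h1
      convert this using 1
      rw [pow_succ']; group
  refine ⟨D K, ?_, ?_, hstep K le_rfl, ?_⟩
  · have : D K ⊆ Set.image2 w S (Set.Iic K) := by
      rintro _ ⟨s, hs, q, hq, rfl⟩
      exact ⟨s, hs, q, hq, rfl⟩
    exact (hfin.image2 _ (Set.finite_Iic K)).subset this
  · rintro _ ⟨s, hs, q, hq, rfl⟩
    exact hwN s q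
  · intro n hn
    obtain ⟨K', hK'⟩ := key' n hn
    exact ⟨K', hdown K' n (hDmono _ _ (by omega) hK')⟩

theorem asc_of_reach_neg (S : Set G) (hfin : S.Finite) (χ : G → ℤ) (hχ : ∀ a b, χ (a * b) = χ a + χ b) (t : G)
    (ht : χ t = 1) (c : ℝ) (h : ∀ g, χ g = 0 → Reach S (fun g => -(χ g : ℝ)) (Set.Ici (-c)) g) :
    Asc (kerZ χ hχ) t := by
  have hχ' : ∀ a b, (fun g => - χ g) (a * b) = (fun g => - χ g) a + (fun g => - χ g) b := by
    intro a b; simp only [hχ]; ring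
  have := asc_of_reach S hfin (fun g => - χ g) hχ' t⁻¹ (by simp [zchi_inv hχ, ht]) c (by
    intro g hg
    simpa using h g (by simpa using hg))
  have e : kerZ (fun g => - χ g) hχ' = kerZ χ hχ := by ext g; simp [mem_kerZ]
  rw [e, inv_inv] at this
  exact this

/-- (A') -/
theorem exists_fg_ker [Group.IsFinitelyPresented G]
    (hfree : ∀ f : FreeGroup (Fin 2) →* G, ¬ Function.Injective f) (φ₁ φ₂ : G → ℤ)
    (h₁ : ∀ a b, φ₁ (a * b) = φ₁ a + φ₁ b) (h₂ : ∀ a b, φ₂ (a * b) = φ₂ a + φ₂ b)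
    (hsurj : ∀ x y, ∃ g, φ₁ g = x ∧ φ₂ g = y) :
    ∃ a b : ℤ, IsCoprime a b ∧ ∃ K : Subgroup G, K.FG ∧ ∀ g, g ∈ K ↔ a * φ₁ g + b * φ₂ g = 0 := by
  obtain ⟨n, f, R, hf, hR⟩ := (fp_iff (G := G)).2 inferInstance
  obtain ⟨a, b, hab, h⟩ := exists_rational_sig f hf R R.finite_toSet hR hfree φ₁ φ₂ h₁ h₂ hsurj
  set χ : G → ℤ := fun g => a * φ₁ g + b * φ₂ g with hχdef
  have hχ : ∀ x y, χ (x * y) = χ x + χ y := by intro x y; simp only [hχdef, h₁, h₂]; ring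
  obtain ⟨x, y, hxy⟩ := hab
  obtain ⟨t, ht1, ht2⟩ := hsurj x y
  have ht : χ t = 1 := by simp only [hχdef, ht1, ht2]; linarith
  refine ⟨a, b, ⟨x, y, hxy⟩, kerZ χ hχ, ?_, fun g => Iff.rfl⟩
  refine fg_of_asc _ t ?_ (asc_of_reach_neg _ (letters_finite f) χ hχ t ht 0 (fun g hg => by rw [neg_zero]; exact (h g hg).2))
    (asc_of_reach _ (letters_finite f) χ hχ t ht 0 (fun g hg => by rw [neg_zero]; exact (h g hg).1))
  intro n hn
  rw [mem_kerZ] at hn ⊢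
  rw [hχ, hχ, hn, zchi_inv hχ]; ring

/-- for `n = 1` -/
theorem exists_asc [Group.IsFinitelyPresented G]
    (hfree : ∀ f : FreeGroup (Fin 2) →* G, ¬ Function.Injective f) (χ : G → ℤ)
    (hχ : ∀ a b, χ (a * b) = χ a + χ b) (t : G) (ht : χ t = 1) :
    Asc (kerZ χ hχ) t ∨ Asc (kerZ χ hχ) t⁻¹ := by
  obtain ⟨n, f, R, hf, hR⟩ := (fp_iff (G := G)).2 inferInstance
  rcases theoremC f hf R R.finite_toSet hR hfree (fun g => (χ g : ℝ)) (by intro a b; simp [hχ]) with ⟨c, hc⟩ | ⟨c, hc⟩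
  · right
    exact asc_of_reach _ (letters_finite f) χ hχ t ht c (fun g hg => hc g (by simpa using hg))
  · left
    refine asc_of_reach_neg _ (letters_finite f) χ hχ t ht c (fun g hg => ?_)
    refine (hc g (by simpa using hg)).neg.mono ?_
    intro x hx
    simp only [Set.mem_Iic, Set.mem_setOf_eq, Set.mem_Ici] at hx ⊢
    linarith
end A3
end FibProd

namespace FibProd
open Group Subgroup
open scoped commutatorElement

theorem swap_step (M : Subgroup (Equiv.Perm ℤ))
    (hM : ∀ x y : ℤ, ∀ m ∈ M, Equiv.swap x y * m * (Equiv.swap x y)⁻¹ ∈ M) (hne : M ≠ ⊥) :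
    (⁅M, M⁆ ≠ ⊥) ∧ ∀ x y : ℤ, ∀ m ∈ ⁅M, M⁆, Equiv.swap x y * m * (Equiv.swap x y)⁻¹ ∈ ⁅M, M⁆ := by
  constructor
  · intro hbot
    have hcomm : ∀ a ∈ M, ∀ b ∈ M, a * b = b * a := by
      intro a ha b hb
      have := commutator_mem_commutator ha hb
      rw [hbot, mem_bot, commutatorElement_eq_one_iff_mul_comm] at this
      exact this
    apply hne
    rw [eq_bot_iff]
    intro a ha
    rw [mem_bot]
    by_contra hane
    obtain ⟨x, hx⟩ : ∃ x, a x ≠ x := by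
      by_contra hno
      push Not at hno
      exact hane (Equiv.ext hno)
    -- choose y
    obtain ⟨y, hy⟩ := Infinite.exists_notMem_finset ({x, a x, a.symm x, a.symm (a x)} : Finset ℤ)
    simp only [Finset.mem_insert, Finset.mem_singleton, not_or] at hy
    obtain ⟨hy1, hy2, hy3, hy4⟩ := hy
    have hayx : a y ≠ x := fun h => hy3 (by rw [← h]; simp)
    set b := a * (Equiv.swap x y * a⁻¹ * (Equiv.swap x y)⁻¹) with hb
    have hbM : b ∈ M := mul_mem ha (hM _ _ _ (inv_mem ha))
    have hb' : b = Equiv.swap (a x) (a y) * Equiv.swap x y := by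
      rw [hb, Equiv.swap_apply_apply, Equiv.swap_inv]; group
    have hbx : b x ≠ x := by
      rw [hb', Equiv.Perm.mul_apply, Equiv.swap_apply_left]
      intro h
      have h2 := congrArg (Equiv.swap (a x) (a y)) h
      rw [Equiv.swap_apply_self, Equiv.swap_apply_of_ne_of_ne hx.symm hayx.symm] at h2
      exact hy1 h2
    obtain ⟨z, hz⟩ := Infinite.exists_notMem_finset ({x, y, a x, a y, b x} : Finset ℤ)
    simp only [Finset.mem_insert, Finset.mem_singleton, not_or] at hz
    obtain ⟨hz1, hz2, hz3, hz4, hz5⟩ := hz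
    have hbz : b z = z := by
      rw [hb', Equiv.Perm.mul_apply, Equiv.swap_apply_of_ne_of_ne hz1 hz2,
        Equiv.swap_apply_of_ne_of_ne hz3 hz4]
    have hc := congrArg (fun p : Equiv.Perm ℤ => p x) (hcomm b hbM _ (hM (b x) z b hbM))
    simp only [Equiv.Perm.mul_apply, Equiv.swap_inv, Equiv.swap_apply_left, hbz,
      Equiv.swap_apply_of_ne_of_ne hbx.symm (Ne.symm hz1), Equiv.swap_apply_right] at hc
    exact hz5 hc
  · intro x y m hm
    have h1 : map (MulAut.conj (Equiv.swap x y)).toMonoidHom ⁅M, M⁆ ≤ ⁅M, M⁆ := by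
      rw [map_commutator]
      have : map (MulAut.conj (Equiv.swap x y)).toMonoidHom M ≤ M := by
        rintro _ ⟨m, hm, rfl⟩
        exact hM x y m hm
      exact commutator_mono this this
    exact h1 ⟨m, hm, rfl⟩

theorem not_solvable_of_swap (M : Subgroup (Equiv.Perm ℤ))
    (hM : ∀ x y : ℤ, ∀ m ∈ M, Equiv.swap x y * m * (Equiv.swap x y)⁻¹ ∈ M) (hne : M ≠ ⊥)
    (hsol : Group.IsSolvable M) : False := by
  have key : ∀ n, (map M.subtype (derivedSeries M n) ≠ ⊥) ∧ ∀ x y : ℤ,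
      ∀ m ∈ map M.subtype (derivedSeries M n),
        Equiv.swap x y * m * (Equiv.swap x y)⁻¹ ∈ map M.subtype (derivedSeries M n) := by
    intro n
    induction n with
    | zero =>
      have : map M.subtype (derivedSeries M 0) = M := by
        simp [derivedSeries_zero, ← MonoidHom.range_eq_map]
      rw [this]; exact ⟨hne, hM⟩
    | succ n ih =>
      rw [derivedSeries_succ, map_commutator]
      exact swap_step _ ih.2 ih.1
  obtain ⟨n, hn⟩ := hsol.solvable
  apply (key n).1
  rw [hn, Subgroup.map_bot]

theorem swap_mem_of_shift (Γ : Subgroup (Equiv.Perm ℤ)) (h0 : Equiv.swap 0 1 ∈ Γ)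
    (h1 : Equiv.addRight (1:ℤ) ∈ Γ) : ∀ x y : ℤ, Equiv.swap x y ∈ Γ := by
  have hsh : ∀ (k x : ℤ), ((Equiv.addRight (1:ℤ)) ^ k : Equiv.Perm ℤ) x = x + k := by
    intro k
    induction k with
    | zero => simp
    | succ i h => intro x; rw [zpow_add_one, Equiv.Perm.mul_apply, h]; simp; ring
    | pred i h =>
      intro x; rw [zpow_sub_one, Equiv.Perm.mul_apply, h]
      have : (Equiv.addRight (1:ℤ) : Equiv.Perm ℤ)⁻¹ x = x - 1 := by
        rw [Equiv.Perm.inv_eq_iff_eq]; simp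
      rw [this]; ring
  have hadj : ∀ x : ℤ, Equiv.swap x (x+1) ∈ Γ := by
    intro x
    have := Equiv.swap_apply_apply ((Equiv.addRight (1:ℤ)) ^ x : Equiv.Perm ℤ) 0 1
    rw [hsh, hsh, zero_add, add_comm] at this
    rw [this]
    exact mul_mem (mul_mem (zpow_mem h1 x) h0) (inv_mem (zpow_mem h1 x))
  have hnat : ∀ (k : ℕ) (x : ℤ), Equiv.swap x (x + k) ∈ Γ := by
    intro k
    induction k with
    | zero => intro x; rw [Nat.cast_zero, add_zero, Equiv.swap_self]; exact one_mem Γ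
    | succ k ih =>
      intro x
      rcases Nat.eq_zero_or_pos k with rfl | hk
      · simpa using hadj x
      have h2 := mul_mem (mul_mem (hadj (x + k)) (ih x)) (inv_mem (hadj (x + k)))
      rw [← Equiv.swap_apply_apply, Equiv.swap_apply_left, Equiv.swap_apply_of_ne_of_ne (by omega) (by omega)] at h2
      push_cast
      rwa [← add_assoc]
  intro x y
  rcases le_total x y with h | h
  · obtain ⟨k, hk⟩ := Int.eq_ofNat_of_zero_le (a := y - x) (by linarith)
    have := hnat k x
    rwa [show x + k = y by omega] at this
  · obtain ⟨k, hk⟩ := Int.eq_ofNat_of_zero_le (a := x - y) (by linarith)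
    have := hnat k y
    rw [show y + k = x by omega] at this
    rwa [Equiv.swap_comm]

theorem no_free_of_virt_solvable {G : Type*} [Group G] (H : Subgroup G) (hfi : H.FiniteIndex)
    (hsol : Group.IsSolvable H) (f : FreeGroup (Fin 2) →* G) : ¬ Function.Injective f := by
  intro hinj
  let D := (H.comap f).normalCore
  have hD : D.FiniteIndex := by
    have : (H.comap f).FiniteIndex := ⟨by
      rw [index_comap]
      exact (isFiniteRelIndex_of_finiteIndex (h := hfi)).relIndex_ne_zero⟩
    exact inferInstanceAs ((H.comap f).normalCore.FiniteIndex)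
  have hDn : D.Normal := Subgroup.normalCore_normal _
  have hDle : ∀ d ∈ D, f d ∈ H := fun d hd => Subgroup.normalCore_le (H.comap f) hd
  have hDs : Group.IsSolvable D := by
    let g : D →* H := (f.comp D.subtype).codRestrict H (fun d => hDle d d.2)
    refine solvable_of_solvable_injective (f := g) ?_
    intro a b hab
    have : f a = f b := congrArg Subtype.val hab
    exact Subtype.ext (hinj this)
  let π : FreeGroup (Fin 2) →* Equiv.Perm ℤ :=
    FreeGroup.lift (fun i => if i = 0 then Equiv.swap 0 1 else Equiv.addRight (1:ℤ))
  have h0 : Equiv.swap 0 1 ∈ π.range := ⟨FreeGroup.of 0, by simp [π]⟩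
  have hs : π (FreeGroup.of 1) = Equiv.addRight (1:ℤ) := by simp [π]
  have h1 : Equiv.addRight (1:ℤ) ∈ π.range := ⟨FreeGroup.of 1, hs⟩
  refine not_solvable_of_swap (D.map π) ?_ ?_ ?_
  · rintro x y _ ⟨d, hd, rfl⟩
    obtain ⟨w, hw⟩ := swap_mem_of_shift π.range h0 h1 x y
    rw [← hw, ← map_inv, ← map_mul, ← map_mul]
    exact ⟨_, hDn.conj_mem d hd w, rfl⟩
  · intro hbot
    obtain ⟨k, hk, -, hkD⟩ := Subgroup.exists_pow_mem_of_index_ne_zero hD.index_ne_zero (FreeGroup.of (1 : Fin 2))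
    have : π (FreeGroup.of 1 ^ k) ∈ D.map π := ⟨_, hkD, rfl⟩
    rw [hbot, mem_bot, map_pow, hs] at this
    have h3 : ∀ (k : ℕ) (x : ℤ), ((Equiv.addRight (1:ℤ)) ^ k : Equiv.Perm ℤ) x = x + k := by
      intro k
      induction k with
      | zero => simp
      | succ i h => intro x; rw [pow_succ, Equiv.Perm.mul_apply, h]; simp; ring
    have h4 := h3 k 0
    rw [this] at h4
    simp at h4
    omega
  · exact solvable_of_surjective (π.subgroupMap_surjective D)

end FibProd

namespace FibProd
open Module

section Rep
variable {K : Type*} [NormedField K] [IsUltrametricDist K] {V : Type*} [AddCommGroup V] [Module K V]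
  [FiniteDimensional K V] {G : Type*} [Group G] (ρ : G →* (V →ₗ[K] V))

/-- vectors whose `M`-orbit is bounded modulo `S` -/
def Bv (M : Subgroup G) (S : Submodule K V) : Submodule K V where
  carrier := {v | ∀ l : Dual K V, (∀ x ∈ S, l x = 0) → ∃ C : ℝ, ∀ m ∈ M, ‖l (ρ m v)‖ ≤ C}
  add_mem' := by
    intro a b ha hb l hl
    obtain ⟨C, hC⟩ := ha l hl
    obtain ⟨D, hD⟩ := hb l hl
    refine ⟨C + D, fun m hm => ?_⟩
    rw [map_add, map_add]
    exact (norm_add_le _ _).trans (add_le_add (hC m hm) (hD m hm))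
  zero_mem' := by
    intro l hl
    exact ⟨0, fun m hm => by simp⟩
  smul_mem' := by
    intro c a ha l hl
    obtain ⟨C, hC⟩ := ha l hl
    refine ⟨‖c‖ * C, fun m hm => ?_⟩
    rw [map_smul, map_smul, smul_eq_mul, norm_mul]
    exact mul_le_mul_of_nonneg_left (hC m hm) (norm_nonneg _)

theorem mem_Bv {M : Subgroup G} {S : Submodule K V} {v : V} : v ∈ Bv ρ M S ↔
    ∀ l : Dual K V, (∀ x ∈ S, l x = 0) → ∃ C : ℝ, ∀ m ∈ M, ‖l (ρ m v)‖ ≤ C := Iff.rfl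

theorem Bv_mono {M M' : Subgroup G} (h : M ≤ M') (S : Submodule K V) : Bv ρ M' S ≤ Bv ρ M S := by
  intro v hv l hl
  obtain ⟨C, hC⟩ := hv l hl
  exact ⟨C, fun m hm => hC m (h hm)⟩

theorem Bv_inv {M : Subgroup G} (hM : M.Normal) {S : Submodule K V}
    (hS : ∀ g, ∀ x ∈ S, ρ g x ∈ S) (g : G) : ∀ x ∈ Bv ρ M S, ρ g x ∈ Bv ρ M S := by
  intro x hx l hl
  obtain ⟨C, hC⟩ := hx (l.comp (ρ g)) (fun y hy => hl _ (hS g y hy))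
  refine ⟨C, fun m hm => ?_⟩
  have := hC (g⁻¹ * m * g) (by simpa using hM.conj_mem m hm g⁻¹)
  have e : ρ g (ρ (g⁻¹ * m * g) x) = ρ m (ρ g x) := by
    rw [← Module.End.mul_apply, ← map_mul, ← Module.End.mul_apply, ← map_mul]
    congr 2; group
  simpa [e] using this

theorem Bv_bdd {J : Type*} (M : Subgroup G) (S : Submodule K V) (d : J → V)
    (hd : ∀ j, d j ∈ Bv ρ M S) (hb : ∀ l : Dual K V, ∃ C : ℝ, ∀ j, ‖l (d j)‖ ≤ C)
    (l : Dual K V) (hl : ∀ x ∈ S, l x = 0) :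
    ∃ C : ℝ, ∀ j, ∀ m ∈ M, ‖l (ρ m (d j))‖ ≤ C := by
  classical
  let b := Module.finBasis K (Bv ρ M S)
  have hext : ∀ i, ∃ c : Dual K V, ∀ x : Bv ρ M S, c x = b.repr x i := by
    intro i
    obtain ⟨c, hc⟩ := LinearMap.exists_extend (b.coord i)
    exact ⟨c, fun x => by rw [← Submodule.subtype_apply, ← LinearMap.comp_apply, hc]; rfl⟩
  choose c hc using hext
  choose C hC using fun i => hb (c i)
  choose D hD using fun i => (b i).2 l hl
  refine ⟨∑ i, C i * D i, fun j m hm => ?_⟩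
  have e : d j = ∑ i, c i (d j) • (b i : V) := by
    have := congrArg Subtype.val (b.sum_repr ⟨d j, hd j⟩)
    simp only [AddSubmonoidClass.coe_finset_sum, Submodule.coe_smul] at this
    conv_lhs => rw [← this]
    exact Finset.sum_congr rfl fun i _ => by rw [← hc i ⟨d j, hd j⟩]
  have e2 : l (ρ m (d j)) = ∑ i, c i (d j) * l (ρ m (b i)) := by
    conv_lhs => rw [e]
    simp [map_sum]
  rw [e2]
  refine (norm_sum_le _ _).trans (Finset.sum_le_sum fun i _ => ?_)
  rw [norm_mul]
  exact mul_le_mul (hC i j) (hD i m hm) (norm_nonneg _) ((norm_nonneg _).trans (hC i j))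

/-- extension lemma -/
theorem Bv_ext [hG : Group.FG G] : Bv ρ ⊤ (Bv ρ ⊤ ⊥) ≤ Bv ρ ⊤ ⊥ := by
  classical
  intro v hv l _
  set S := Bv ρ ⊤ ⊥ with hS
  have hSinv : ∀ g, ∀ x ∈ S, ρ g x ∈ S := fun g => Bv_inv ρ inferInstance (by simp) g
  obtain ⟨T, hT⟩ := Submodule.exists_isCompl S
  obtain ⟨P, hP⟩ : ∃ P : V →ₗ[K] S, ∀ x : S, P x = x :=
    ⟨S.projectionOnto T hT, fun x => by simp⟩
  obtain ⟨F, hF⟩ := hG.out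
  have hFfin : (F : Set G).Finite := F.finite_toSet
  let y : G → V := fun g => ρ g v - P (ρ g v)
  have hy : ∀ l : Dual K V, ∃ C : ℝ, ∀ g, ‖l (y g)‖ ≤ C := by
    intro l
    obtain ⟨C, hC⟩ := hv (l - l.comp (S.subtype.comp P)) (by
      intro x hx
      simp [hP ⟨x, hx⟩])
    refine ⟨C, fun g => ?_⟩
    simpa [y] using hC g trivial
  have hall : ∀ s : G, ∃ C : ℝ, ∀ g, ∀ h : G, ‖l (ρ h (P (ρ s (y g))))‖ ≤ C := by
    intro s
    obtain ⟨C, hC⟩ := Bv_bdd ρ ⊤ ⊥ (fun g => (P (ρ s (y g)) : V)) (fun g => (P _).2)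
      (fun l => hy (l.comp (S.subtype.comp (P.comp (ρ s))))) l (by simp)
    exact ⟨C, fun g h => hC g h trivial⟩
  choose C hC using hall
  obtain ⟨C0, hC0⟩ := (P v).2 l (by simp)
  obtain ⟨B, hB⟩ : ∃ B : ℝ, C0 ≤ B ∧ ∀ s ∈ F, C s ≤ B ∧ C s⁻¹ ≤ B := by
    have h1 : ((fun s => max (C s) (C s⁻¹)) '' (F : Set G)).Finite := hFfin.image _
    obtain ⟨B, hB⟩ := h1.bddAbove
    refine ⟨max C0 B, le_max_left _ _, fun s hs => ?_⟩
    have := hB ⟨s, hs, rfl⟩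
    exact ⟨(le_max_left _ _).trans (this.trans (le_max_right _ _)),
      (le_max_right _ _).trans (this.trans (le_max_right _ _))⟩
  have step : ∀ s g, C s ≤ B → (∀ h, ‖l (ρ h (P (ρ g v)))‖ ≤ B) →
      ∀ h, ‖l (ρ h (P (ρ (s * g) v)))‖ ≤ B := by
    intro s g hs hg h
    have e : (P (ρ (s * g) v) : V) = ρ s (P (ρ g v)) + P (ρ s (y g)) := by
      have e1 : ρ (s * g) v = ρ s (P (ρ g v)) + ρ s (y g) := by
        rw [← map_add, map_mul, Module.End.mul_apply]; simp [y]
      rw [e1, map_add]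
      rw [hP ⟨_, hSinv s _ (P (ρ g v)).2⟩]; simp
    rw [e, map_add, map_add, ← Module.End.mul_apply, ← map_mul]
    exact (IsUltrametricDist.norm_add_le_max _ _).trans (max_le (hg _) ((hC s g h).trans hs))
  have key : ∀ g : G, ∀ h, ‖l (ρ h (P (ρ g v)))‖ ≤ B := by
    intro g
    have hg : g ∈ Subgroup.closure (F : Set G) := by rw [hF]; trivial
    induction hg using Subgroup.closure_induction_left with
    | one => intro h; simpa using (hC0 h trivial).trans hB.1
    | mul_left s hs g hg ih => exact step s g (hB.2 s hs).1 ih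
    | inv_mul_cancel s hs g hg ih => exact step s⁻¹ g (hB.2 s hs).2 ih
  obtain ⟨D, hD⟩ := hy l
  refine ⟨B + D, fun g _ => ?_⟩
  have e : ρ g v = P (ρ g v) + y g := by simp [y]
  rw [e, map_add]
  refine (norm_add_le _ _).trans (add_le_add ?_ (hD g))
  simpa using key g 1

theorem Bv_pair {M M' : Subgroup G} (hM : M.Normal) (hM' : M'.Normal)
    (hfi : (M ⊔ M').FiniteIndex) {S : Submodule K V}
    (hS : ∀ g, ∀ x ∈ S, ρ g x ∈ S) (b : V) (hb : b ∈ Bv ρ M' ⊥) (hb' : b ∈ Bv ρ M S) :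
    b ∈ Bv ρ ⊤ S := by
  classical
  have h1 : ∀ l : Dual K V, (∀ x ∈ S, l x = 0) → ∃ C : ℝ, ∀ g ∈ M ⊔ M', ‖l (ρ g b)‖ ≤ C := by
    intro l hl
    obtain ⟨C, hC⟩ := Bv_bdd ρ M S (fun h : M' => ρ h b) (fun h => Bv_inv ρ hM hS h b hb')
      (fun l => by
        obtain ⟨C, hC⟩ := hb l (by simp)
        exact ⟨C, fun h => hC h h.2⟩) l hl
    refine ⟨C, fun g hg => ?_⟩
    obtain ⟨m, hm, h, hh, rfl⟩ : ∃ m ∈ M, ∃ h ∈ M', m * h = g := by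
      have hg' : g ∈ ((M ⊔ M' : Subgroup G) : Set G) := hg
      rw [Subgroup.mul_normal M M'] at hg'
      exact Set.mem_mul.1 hg'
    rw [map_mul]
    exact hC ⟨h, hh⟩ m hm
  intro l hl
  haveI : Finite (G ⧸ (M ⊔ M')) := Subgroup.finite_quotient_of_finiteIndex
  have h2 : ∀ q : G ⧸ (M ⊔ M'), ∃ C : ℝ, ∀ g ∈ M ⊔ M', ‖l (ρ q.out (ρ g b))‖ ≤ C :=
    fun q => h1 (l.comp (ρ q.out)) (fun x hx => hl _ (hS _ x hx))
  choose C hC using h2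
  obtain ⟨B, hB⟩ := (Set.finite_range C).bddAbove
  refine ⟨B, fun g _ => ?_⟩
  have := hC (g : G ⧸ (M ⊔ M')) ((g : G ⧸ (M ⊔ M')).out⁻¹ * g) (by
    rw [← QuotientGroup.eq]; simp)
  rw [← Module.End.mul_apply, ← map_mul, mul_inv_cancel_left] at this
  exact this.trans (hB ⟨_, rfl⟩)

theorem bad_finite [hG : Group.FG G] {ι : Type*} (M : ι → Subgroup G) (hM : ∀ i, (M i).Normal)
    (hfi : ∀ i j, i ≠ j → (M i ⊔ M j).FiniteIndex) :
    {i | ¬ Bv ρ (M i) ⊥ ≤ Bv ρ ⊤ ⊥}.Finite := by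
  classical
  set S := Bv ρ ⊤ ⊥ with hS
  have hSinv : ∀ g, ∀ x ∈ S, ρ g x ∈ S := fun g => Bv_inv ρ inferInstance (by simp) g
  let B : ι → Submodule K V := fun i => Bv ρ (M i) ⊥
  have hBinv : ∀ i g, ∀ x ∈ B i, ρ g x ∈ B i := fun i g => Bv_inv ρ (hM i) (by simp) g
  have hSB : ∀ i, S ≤ B i := fun i => Bv_mono ρ le_top _
  let X : Finset ι → Submodule K V := fun F => S ⊔ F.sup B
  have hXinv : ∀ F g, ∀ x ∈ X F, ρ g x ∈ X F := by
    intro F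
    induction F using Finset.induction_on with
    | empty => intro g x hx; simp only [X, Finset.sup_empty, sup_bot_eq] at hx ⊢; exact hSinv g x hx
    | insert i F hi ih =>
      intro g x hx
      have e : X (insert i F) = B i ⊔ X F := by
        simp only [X, Finset.sup_insert]; rw [sup_left_comm]
      rw [e] at hx ⊢
      obtain ⟨u, hu, w, hw, rfl⟩ := Submodule.mem_sup.1 hx
      rw [map_add]
      exact Submodule.add_mem_sup (hBinv i g u hu) (ih g w hw)
  have key : ∀ F : Finset ι, ∀ j ∉ F, X F ⊓ B j ≤ S := by
    intro F
    induction F using Finset.induction_on with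
    | empty => intro j _; simp only [X, Finset.sup_empty, sup_bot_eq]; exact inf_le_left
    | insert i F hi ih =>
      intro j hj w hw
      have hji : j ≠ i := fun h => hj (h ▸ Finset.mem_insert_self _ _)
      have hjF : j ∉ F := fun h => hj (Finset.mem_insert_of_mem h)
      have e : X (insert i F) = B i ⊔ X F := by
        simp only [X, Finset.sup_insert]; rw [sup_left_comm]
      rw [e] at hw
      obtain ⟨hw1, hw2⟩ := hw
      obtain ⟨b, hb, x, hx, rfl⟩ := Submodule.mem_sup.1 hw1
      have hbS : b ∈ Bv ρ (M j) S := by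
        intro l hl
        have hl' : l ∈ (X F ⊓ B i).dualAnnihilator := by
          rw [Submodule.mem_dualAnnihilator]
          exact fun y hy => hl y (ih i hi hy)
        rw [Subspace.dualAnnihilator_inf_eq] at hl'
        obtain ⟨l1, h1, l2, h2, rfl⟩ := Submodule.mem_sup.1 hl'
        rw [Submodule.mem_dualAnnihilator] at h1 h2
        obtain ⟨C, hC⟩ := hw2 l1 (by simp)
        refine ⟨C, fun m hm => ?_⟩
        have := hC m hm
        rw [map_add, map_add, h1 _ (hXinv F m x hx), add_zero] at this
        rwa [LinearMap.add_apply, h2 _ (hBinv i m b hb), add_zero]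
      have hb2 : b ∈ S := Bv_ext ρ (Bv_pair ρ (hM j) (hM i) (hfi j i hji) hSinv b hb hbS)
      have hx2 : x ∈ S := by
        refine ih j hjF ⟨hx, ?_⟩
        have := (B j).sub_mem hw2 (hSB j hb2)
        simpa using this
      exact S.add_mem hb2 hx2
  by_contra hinf
  obtain ⟨F, hF, hcard⟩ := (show Set.Infinite {i | ¬ B i ≤ S} from hinf).exists_subset_card_eq
    (finrank K V + 1)
  have hdim : ∀ F : Finset ι, (F : Set ι) ⊆ {i | ¬ B i ≤ S} → F.card ≤ finrank K (X F) := by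
    intro F
    induction F using Finset.induction_on with
    | empty => simp
    | insert i F hi ih =>
      intro hF
      rw [Finset.card_insert_of_notMem hi]
      have h1 := ih (fun j hj => hF (by simp [Finset.mem_coe.1 hj]))
      have e : X (insert i F) = B i ⊔ X F := by
        simp only [X, Finset.sup_insert]; rw [sup_left_comm]
      have hlt : X F < X (insert i F) := by
        rw [e]
        refine lt_of_le_of_ne le_sup_right fun h => ?_
        have h2 : B i ≤ X F := by rw [h]; exact le_sup_left
        exact hF (Finset.mem_coe.2 (Finset.mem_insert_self i F)) (fun y hy => key F i hi ⟨h2 hy, hy⟩)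
      have := Submodule.finrank_lt_finrank_of_lt hlt
      omega
  have h1 := hdim F hF
  have h2 := Submodule.finrank_le (X F)
  omega

end Rep
end FibProd

namespace FibProd

section Lift
variable {A : Type*} [AddCommGroup A]

/-- the p-adic integers as an additive subgroup -/
def ZpS (p : ℕ) [Fact p.Prime] : AddSubgroup ℚ_[p] where
  carrier := {x | ‖x‖ ≤ 1}
  add_mem' := by
    intro a b ha hb
    exact (IsUltrametricDist.norm_add_le_max _ _).trans (max_le ha hb)
  zero_mem' := by simp
  neg_mem' := by intro a ha; simpa using ha

theorem mem_ZpS {p : ℕ} [Fact p.Prime] {x : ℚ_[p]} : x ∈ ZpS p ↔ ‖x‖ ≤ 1 := Iff.rfl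

theorem exists_char (U : AddSubgroup A) (x : A) (p : ℕ) [hp : Fact p.Prime] (hx : x ∉ U)
    (hpx : p • x ∈ U) : ∃ χ : A →+ (ℚ_[p] ⧸ ZpS p), (∀ u ∈ U, χ u = 0) ∧ χ x ≠ 0 := by
  let Q := ℚ_[p] ⧸ ZpS p
  have hp0 : (p : ℚ_[p]) ≠ 0 := by exact_mod_cast hp.out.ne_zero
  have hbaer : Module.Baer ℤ Q := by
    letI : DivisibleBy Q ℤ := divisibleByOfSMulRightSurj Q ℤ (by
      intro n hn y
      obtain ⟨y, rfl⟩ := QuotientAddGroup.mk_surjective y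
      refine ⟨((n : ℚ_[p])⁻¹ * y : ℚ_[p]), ?_⟩
      have hn' : (n : ℚ_[p]) ≠ 0 := by exact_mod_cast hn
      show n • ((((n : ℚ_[p])⁻¹ * y : ℚ_[p])) : Q) = _
      rw [← QuotientAddGroup.mk_zsmul, zsmul_eq_mul, mul_inv_cancel_left₀ hn'])
    exact Module.Baer.of_divisible Q
  let xb : A ⧸ U := (x : A ⧸ U)
  have hxb : xb ≠ 0 := by
    intro h; exact hx ((QuotientAddGroup.eq_zero_iff x).1 h)
  have hpxb : (p : ℤ) • xb = 0 := by
    show (p : ℤ) • (x : A ⧸ U) = 0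
    rw [← QuotientAddGroup.mk_zsmul, QuotientAddGroup.eq_zero_iff]
    simpa using hpx
  let yb : Q := (((p : ℚ_[p])⁻¹ : ℚ_[p]) : Q)
  have hyb : yb ≠ 0 := by
    intro h
    have := (QuotientAddGroup.eq_zero_iff ((p : ℚ_[p])⁻¹)).1 h
    rw [mem_ZpS, norm_inv, Padic.norm_p, inv_inv] at this
    have h2 := hp.out.one_lt
    have h3 : (p : ℝ) > 1 := by exact_mod_cast h2
    linarith
  have hpyb : (p : ℤ) • yb = 0 := by
    show (p : ℤ) • (((p : ℚ_[p])⁻¹ : ℚ_[p]) : Q) = 0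
    rw [← QuotientAddGroup.mk_zsmul, QuotientAddGroup.eq_zero_iff, mem_ZpS, zsmul_eq_mul]
    simp [hp0]
  let f : ZMod p →+ A ⧸ U := ZMod.lift p ⟨zmultiplesHom _ xb, by simpa using hpxb⟩
  let g : ZMod p →+ Q := ZMod.lift p ⟨zmultiplesHom _ yb, by simpa using hpyb⟩
  have hf : Function.Injective f := by
    rw [ZMod.lift_injective]
    intro m hm
    by_contra hne
    have hcop : IsCoprime (m : ℤ) p := by
      rw [ZMod.intCast_zmod_eq_zero_iff_dvd] at hne
      exact ((Nat.prime_iff_prime_int.1 hp.out).coprime_iff_not_dvd.2 hne).symm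
    obtain ⟨u, v, huv⟩ := hcop
    apply hxb
    have h1 : m • xb = 0 := by simpa using hm
    calc xb = (1 : ℤ) • xb := (one_zsmul _).symm
      _ = u • (m • xb) + v • ((p : ℤ) • xb) := by rw [← huv, add_zsmul, mul_zsmul, mul_zsmul]
      _ = 0 := by rw [h1, hpxb]; simp
  obtain ⟨h, hh⟩ := Module.Baer.extension_property_addMonoidHom hbaer f hf g
  refine ⟨h.comp (QuotientAddGroup.mk' U), fun u hu => ?_, ?_⟩
  · have : QuotientAddGroup.mk' U u = 0 := (QuotientAddGroup.eq_zero_iff u).2 hu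
    rw [AddMonoidHom.comp_apply, this, map_zero]
  · have h1 : f 1 = xb := by
      have := ZMod.lift_coe p ⟨zmultiplesHom _ xb, by simpa using hpxb⟩ 1
      simpa [f] using this
    have h2 : g 1 = yb := by
      have := ZMod.lift_coe p ⟨zmultiplesHom _ yb, by simpa using hpyb⟩ 1
      simpa [g] using this
    have h3 := DFunLike.congr_fun hh 1
    rw [AddMonoidHom.comp_apply, h1, h2] at h3
    show h xb ≠ 0
    rw [h3]; exact hyb

theorem exists_lift [IsAddTorsionFree A] (p : ℕ) [hp : Fact p.Prime]
    (χ : A →+ (ℚ_[p] ⧸ ZpS p)) :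
    ∃ f : A →+ ℚ_[p], ∀ a, ((f a : ℚ_[p]) : ℚ_[p] ⧸ ZpS p) = χ a := by
  classical
  choose q hq using fun a => QuotientAddGroup.mk_surjective (χ a)
  let C : A × A → Set (A → ℤ_[p]) := fun ab =>
    {z | q (ab.1 + ab.2) + z (ab.1 + ab.2) = (q ab.1 + z ab.1) + (q ab.2 + z ab.2)}
  have hne : (⋂ i, C i).Nonempty := by
    apply CompactSpace.iInter_nonempty
    · rintro ⟨a, b⟩
      apply isClosed_eq <;> fun_prop
    · intro s
      let B : Submodule ℤ A := Submodule.span ℤ ((s.image Prod.fst ∪ s.image Prod.snd : Finset A) : Set A)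
      haveI : Module.Finite ℤ B := Module.Finite.iff_fg.2 ⟨_, rfl⟩
      haveI : Module.IsTorsionFree ℤ B := inferInstance
      haveI : Module.Free ℤ B := inferInstance
      obtain ⟨h, hh⟩ := Module.projective_lifting_property
        (QuotientAddGroup.mk' (ZpS p)).toIntLinearMap (χ.toIntLinearMap.comp B.subtype)
        (QuotientAddGroup.mk'_surjective _)
      have hh' : ∀ b : B, ((h b : ℚ_[p]) : ℚ_[p] ⧸ ZpS p) = χ b := fun b =>
        LinearMap.congr_fun hh b
      have hn : ∀ b : B, ‖h b - q b‖ ≤ 1 := by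
        intro b
        rw [← mem_ZpS, ← QuotientAddGroup.eq_zero_iff, QuotientAddGroup.mk_sub, hh', hq, sub_self]
      let z : A → ℤ_[p] := fun a => if ha : a ∈ B then ⟨h ⟨a, ha⟩ - q a, hn ⟨a, ha⟩⟩ else 0
      have hz : ∀ (a : A) (ha : a ∈ B), q a + z a = h ⟨a, ha⟩ := by
        intro a ha
        have e : (z a : ℚ_[p]) = h ⟨a, ha⟩ - q a := by
          have : z a = ⟨h ⟨a, ha⟩ - q a, hn ⟨a, ha⟩⟩ := dif_pos ha
          rw [this]
        rw [e]; ring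
      refine ⟨z, ?_⟩
      simp only [Set.mem_iInter]
      rintro ⟨a, b⟩ hab
      have ha : a ∈ B := Submodule.subset_span (by
        simp only [Finset.coe_union, Finset.coe_image]; exact Or.inl ⟨_, hab, rfl⟩)
      have hb : b ∈ B := Submodule.subset_span (by
        simp only [Finset.coe_union, Finset.coe_image]; exact Or.inr ⟨_, hab, rfl⟩)
      show q (a + b) + z (a + b) = (q a + z a) + (q b + z b)
      rw [hz _ ha, hz _ hb, hz _ (B.add_mem ha hb), ← map_add]; rfl
  obtain ⟨z, hz⟩ := hne
  rw [Set.mem_iInter] at hz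
  refine ⟨AddMonoidHom.mk' (fun a => q a + z a) (fun a b => hz (a, b)), fun a => ?_⟩
  show ((q a + z a : ℚ_[p]) : ℚ_[p] ⧸ ZpS p) = χ a
  rw [QuotientAddGroup.mk_add, hq, (QuotientAddGroup.eq_zero_iff (z a : ℚ_[p])).2 (z a).2, add_zero]

theorem exists_hom_sep [IsAddTorsionFree A] (U : AddSubgroup A) (x : A) (p : ℕ) [hp : Fact p.Prime]
    (hx : x ∉ U) (hpx : p • x ∈ U) :
    ∃ f : A →+ ℚ_[p], (∀ u ∈ U, ‖f u‖ ≤ 1) ∧ ¬ ‖f x‖ ≤ 1 := by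
  obtain ⟨χ, h1, h2⟩ := exists_char U x p hx hpx
  obtain ⟨f, hf⟩ := exists_lift p χ
  refine ⟨f, fun u hu => ?_, fun h => ?_⟩
  · rw [← mem_ZpS, ← QuotientAddGroup.eq_zero_iff, hf, h1 u hu]
  · rw [← mem_ZpS, ← QuotientAddGroup.eq_zero_iff, hf] at h
    exact h2 h

end Lift
end FibProd

namespace FibProd
open Module

section TF
variable {A : Type*} [AddCommGroup A] {G : Type*} [Group G] (α : G →* AddMonoid.End A)
  (p : ℕ) [hp : Fact p.Prime]

/-- the dual representation on `Hom(A, ℚ_p)` -/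
noncomputable def dualRep : G →* ((A →+ ℚ_[p]) →ₗ[ℚ_[p]] (A →+ ℚ_[p])) where
  toFun g :=
    { toFun := fun f => f.comp (α g⁻¹)
      map_add' := fun f f' => by ext a; rfl
      map_smul' := fun c f => by ext a; rfl }
  map_one' := by
    ext f a
    simp
    rfl
  map_mul' := by
    intro g h
    ext f a
    simp
    rfl

theorem dualRep_apply (g : G) (f : A →+ ℚ_[p]) (a : A) : dualRep α p g f a = f (α g⁻¹ a) := rfl

/-- evaluation -/
noncomputable def evL {d : ℕ} (a : Fin d → A) : (A →+ ℚ_[p]) →ₗ[ℚ_[p]] (Fin d → ℚ_[p]) where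
  toFun f := fun i => f (a i)
  map_add' := fun f f' => by ext i; rfl
  map_smul' := fun c f => by ext i; rfl

/-- evaluation at one point -/
noncomputable def ev1 (x : A) : Dual ℚ_[p] (A →+ ℚ_[p]) where
  toFun f := f x
  map_add' := fun f f' => rfl
  map_smul' := fun c f => rfl

variable {d : ℕ} (a : Fin d → A)

theorem evL_inj
    (ha : ∀ x : A, ∃ e : ℕ, 0 < e ∧ e • x ∈ AddSubgroup.closure (Set.range a)) : Function.Injective (evL p a) := by
  rw [injective_iff_map_eq_zero]
  intro f hf
  ext x
  obtain ⟨e, he, hx⟩ := ha x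
  have h0 : AddSubgroup.closure (Set.range a) ≤ f.ker := by
    rw [AddSubgroup.closure_le]
    rintro _ ⟨i, rfl⟩
    exact congrFun hf i
  have h1 : f (e • x) = 0 := h0 hx
  rw [map_nsmul, nsmul_eq_mul] at h1
  rcases mul_eq_zero.1 h1 with h | h
  · exact absurd (by exact_mod_cast h) he.ne'
  · exact h

theorem finDim
    (ha : ∀ x : A, ∃ e : ℕ, 0 < e ∧ e • x ∈ AddSubgroup.closure (Set.range a)) : FiniteDimensional ℚ_[p] (A →+ ℚ_[p]) :=
  FiniteDimensional.of_injective (evL p a) (evL_inj p a ha)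

theorem bdd_of_eval
    (ha : ∀ x : A, ∃ e : ℕ, 0 < e ∧ e • x ∈ AddSubgroup.closure (Set.range a)) {J : Type*} (F : J → (A →+ ℚ_[p])) (hF : ∀ i, ∃ C : ℝ, ∀ j, ‖F j (a i)‖ ≤ C)
    (l : Dual ℚ_[p] (A →+ ℚ_[p])) : ∃ C : ℝ, ∀ j, ‖l (F j)‖ ≤ C := by
  classical
  obtain ⟨r, hr⟩ := LinearMap.exists_leftInverse_of_injective (evL p a)
    (LinearMap.ker_eq_bot.2 (evL_inj p a ha))
  choose C hC using hF
  have e : ∀ f, l f = ∑ i, f (a i) * l (r (Pi.single i 1)) := by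
    intro f
    have h1 : f = r (evL p a f) := by
      rw [← LinearMap.comp_apply, hr]; rfl
    have h2 : evL p a f = ∑ i, f (a i) • (Pi.single i 1 : Fin d → ℚ_[p]) := by
      ext i
      simp [evL, Finset.sum_apply, Pi.single_apply]
    conv_lhs => rw [h1, h2]
    simp [map_sum]
  refine ⟨∑ i, C i * ‖l (r (Pi.single i 1))‖, fun j => ?_⟩
  rw [e]
  refine (norm_sum_le _ _).trans (Finset.sum_le_sum fun i _ => ?_)
  rw [norm_mul]
  exact mul_le_mul_of_nonneg_right (hC i j) (norm_nonneg _)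

theorem norm_nsmul_le (f : A →+ ℚ_[p]) (e : ℕ) (he : 0 < e) (x : A) (C : ℝ)
    (h : ‖f (e • x)‖ ≤ C) : ‖f x‖ ≤ C / ‖(e : ℚ_[p])‖ := by
  rw [map_nsmul, nsmul_eq_mul, norm_mul] at h
  have : 0 < ‖(e : ℚ_[p])‖ := by
    rw [norm_pos_iff]; exact_mod_cast he.ne'
  rw [le_div_iff₀ this, mul_comm]; exact h

/-- a prime not dividing the denominators: everything is bounded -/
theorem norm_of_coprime (f : A →+ ℚ_[p]) (e : ℕ) (he : ¬ p ∣ e) (x : A)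
    (h : ‖f (e • x)‖ ≤ 1) : ‖f x‖ ≤ 1 := by
  rw [map_nsmul, nsmul_eq_mul, norm_mul] at h
  have h1 : ‖((e : ℤ) : ℚ_[p])‖ = 1 := by
    refine le_antisymm (Padic.norm_int_le_one _) (not_lt.1 fun hlt => he ?_)
    rw [Padic.norm_intCast_lt_one_iff] at hlt
    exact_mod_cast hlt
  rw [Int.cast_natCast] at h1
  simpa [h1] using h

theorem pres_of_gens (U : AddSubgroup A) (F : Set G) (hF : Subgroup.closure F = ⊤) (e : ℕ)
    (he : ¬ p ∣ e) (h : ∀ s ∈ F, ∀ u ∈ U, e • α s u ∈ U ∧ e • α s⁻¹ u ∈ U)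
    (f : A →+ ℚ_[p]) (hf : ∀ u ∈ U, ‖f u‖ ≤ 1) (g : G) : ∀ u ∈ U, ‖dualRep α p g f u‖ ≤ 1 := by
  have hg : g ∈ Subgroup.closure F := by rw [hF]; trivial
  induction hg using Subgroup.closure_induction_left with
  | one => simpa using hf
  | mul_left s hs g hg ih =>
    intro u hu
    rw [map_mul, Module.End.mul_apply, dualRep_apply]
    exact norm_of_coprime p _ e he _ (ih _ (h s hs u hu).2)
  | inv_mul_cancel s hs g hg ih =>
    intro u hu
    rw [map_mul, Module.End.mul_apply, dualRep_apply, inv_inv]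
    exact norm_of_coprime p _ e he _ (ih _ (h s hs u hu).1)

theorem all_bdd
    (ha : ∀ x : A, ∃ e : ℕ, 0 < e ∧ e • x ∈ AddSubgroup.closure (Set.range a)) (F : Set G) (hF : Subgroup.closure F = ⊤) (e : ℕ)
    (he : ¬ p ∣ e) (h : ∀ s ∈ F, ∀ u ∈ AddSubgroup.closure (Set.range a),
      e • α s u ∈ AddSubgroup.closure (Set.range a) ∧ e • α s⁻¹ u ∈ AddSubgroup.closure (Set.range a)) :
    Bv (dualRep α p) ⊤ ⊥ = ⊤ := by
  rw [eq_top_iff]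
  intro f _ l _
  -- scale f
  obtain ⟨n, hn⟩ : ∃ n : ℕ, ∀ i, ‖f (a i)‖ ≤ (p : ℝ) ^ n := by
    obtain ⟨B, hB⟩ := (Set.finite_range fun i => ‖f (a i)‖).bddAbove
    obtain ⟨n, hn⟩ := pow_unbounded_of_one_lt B (show (1 : ℝ) < p by exact_mod_cast hp.out.one_lt)
    exact ⟨n, fun i => (hB ⟨i, rfl⟩).trans hn.le⟩
  let f' : A →+ ℚ_[p] := (p : ℚ_[p]) ^ n • f
  have hpp : (0 : ℝ) < p := by exact_mod_cast hp.out.pos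
  have hf' : AddSubgroup.closure (Set.range a) ≤ (ZpS p).comap f' := by
    rw [AddSubgroup.closure_le]
    rintro _ ⟨i, rfl⟩
    show ‖(p : ℚ_[p]) ^ n * f (a i)‖ ≤ 1
    rw [norm_mul, norm_pow, Padic.norm_p, inv_pow]
    rw [inv_mul_le_iff₀ (by positivity), mul_one]
    exact hn i
  have h2 := pres_of_gens α p _ F hF e he h f' (fun u hu => hf' hu)
  have h3 : ∃ C : ℝ, ∀ g : G, ‖l (dualRep α p g f)‖ ≤ C := by
    refine bdd_of_eval p a ha (fun g : G => dualRep α p g f) (fun i => ⟨(p : ℝ) ^ n, fun g => ?_⟩) l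
    have := h2 g (a i) (AddSubgroup.subset_closure ⟨i, rfl⟩)
    have e1 : dualRep α p g f' (a i) = (p : ℚ_[p]) ^ n * dualRep α p g f (a i) := rfl
    rw [e1, norm_mul, norm_pow, Padic.norm_p, inv_pow, inv_mul_le_iff₀ (by positivity), mul_one] at this
    exact this
  obtain ⟨C, hC⟩ := h3
  exact ⟨C, fun m _ => hC m⟩

theorem exists_pow_of_good
    (ha : ∀ x : A, ∃ e : ℕ, 0 < e ∧ e • x ∈ AddSubgroup.closure (Set.range a)) (U : AddSubgroup A) (hU : ∀ x : A, ∃ e : ℕ, 0 < e ∧ e • x ∈ U)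
    (M : Subgroup G) (hMU : ∀ m ∈ M, ∀ u ∈ U, α m u ∈ U)
    (hGU : ∀ g : G, ∃ e : ℕ, 0 < e ∧ ∀ u ∈ U, e • α g u ∈ U)
    (hgood : Bv (dualRep α p) M ⊥ ≤ Bv (dualRep α p) ⊤ ⊥) :
    ∃ k : ℕ, ∀ (f : A →+ ℚ_[p]), (∀ u ∈ U, ‖f u‖ ≤ 1) → ∀ g : G, ∀ u ∈ U,
      ‖(p : ℚ_[p]) ^ k * f (α g u)‖ ≤ 1 := by
  classical
  haveI := finDim p a ha
  let W : Submodule ℚ_[p] (A →+ ℚ_[p]) :=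
    { carrier := {f | ∃ C : ℝ, ∀ u ∈ U, ‖f u‖ ≤ C}
      add_mem' := by
        rintro f f' ⟨C, hC⟩ ⟨D, hD⟩
        exact ⟨C + D, fun u hu => (norm_add_le _ _).trans (add_le_add (hC u hu) (hD u hu))⟩
      zero_mem' := ⟨0, fun u hu => by simp⟩
      smul_mem' := by
        rintro c f ⟨C, hC⟩
        refine ⟨‖c‖ * C, fun u hu => ?_⟩
        show ‖c * f u‖ ≤ _
        rw [norm_mul]
        exact mul_le_mul_of_nonneg_left (hC u hu) (norm_nonneg _) }
  have hWinv : ∀ g : G, ∀ f ∈ W, dualRep α p g f ∈ W := by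
    rintro g f ⟨C, hC⟩
    obtain ⟨e, he, h⟩ := hGU g⁻¹
    exact ⟨_, fun u hu => norm_nsmul_le p f e he _ C (hC _ (h u hu))⟩
  have hWM : W ≤ Bv (dualRep α p) M ⊥ := by
    rintro f ⟨C, hC⟩ l _
    obtain ⟨D, hD⟩ := bdd_of_eval p a ha (fun m : M => dualRep α p m f) (fun i => by
      obtain ⟨e, he, h⟩ := hU (a i)
      refine ⟨C / ‖(e : ℚ_[p])‖, fun m => ?_⟩
      apply norm_nsmul_le p _ e he
      exact hC _ (hMU _ (inv_mem m.2) _ h)) l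
    exact ⟨D, fun m hm => hD ⟨m, hm⟩⟩
  have hWG := hWM.trans hgood
  let J := {f : A →+ ℚ_[p] // ∀ u ∈ U, ‖f u‖ ≤ 1}
  have hJ : ∀ l : Dual ℚ_[p] (A →+ ℚ_[p]), ∃ C : ℝ, ∀ j : J × G, ‖l (dualRep α p j.2 j.1.1)‖ ≤ C := by
    intro l
    obtain ⟨C, hC⟩ := Bv_bdd (dualRep α p) ⊤ ⊥ (fun j : J => j.1) (fun j => hWG ⟨1, j.2⟩)
      (bdd_of_eval p a ha _ (fun i => by
        obtain ⟨e, he, h⟩ := hU (a i)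
        exact ⟨1 / ‖(e : ℚ_[p])‖, fun f => norm_nsmul_le p _ e he _ 1 (f.2 _ h)⟩)) l (by simp)
    exact ⟨C, fun j => hC j.1 j.2 trivial⟩
  let b := Module.finBasis ℚ_[p] W
  have hext : ∀ i, ∃ c : Dual ℚ_[p] (A →+ ℚ_[p]), ∀ x : W, c x = b.repr x i := by
    intro i
    obtain ⟨c, hc⟩ := LinearMap.exists_extend (b.coord i)
    exact ⟨c, fun x => by rw [← Submodule.subtype_apply, ← LinearMap.comp_apply, hc]; rfl⟩
  choose c hc using hext
  choose C hC using fun i => hJ (c i)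
  choose D hD using fun i => (b i).2
  obtain ⟨k, hk⟩ := pow_unbounded_of_one_lt (∑ i, C i * D i)
    (show (1 : ℝ) < p by exact_mod_cast hp.out.one_lt)
  have hpp : (0 : ℝ) < p := by exact_mod_cast hp.out.pos
  refine ⟨k, fun f hf g u hu => ?_⟩
  set F : W := ⟨dualRep α p g⁻¹ f, hWinv _ f ⟨1, hf⟩⟩ with hFdef
  have hF : f (α g u) = (F : A →+ ℚ_[p]) u := by
    rw [hFdef, dualRep_apply, inv_inv]
  have e : (F : A →+ ℚ_[p]) = ∑ i, c i F • (b i : A →+ ℚ_[p]) := by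
    have := congrArg Subtype.val (b.sum_repr F)
    simp only [AddSubmonoidClass.coe_finset_sum, Submodule.coe_smul] at this
    conv_lhs => rw [← this]
    exact Finset.sum_congr rfl fun i _ => by rw [← hc i F]
  have e2 : (F : A →+ ℚ_[p]) u = ∑ i, c i F * (b i : A →+ ℚ_[p]) u := by
    have := congrArg (ev1 p u) e
    rw [map_sum] at this
    exact this
  rw [norm_mul, norm_pow, Padic.norm_p, inv_pow, inv_mul_le_iff₀ (by positivity), mul_one, hF, e2]
  refine le_trans ?_ hk.le
  refine (norm_sum_le _ _).trans (Finset.sum_le_sum fun i _ => ?_)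
  rw [norm_mul]
  have h1 := hC i (⟨f, hf⟩, g⁻¹)
  exact mul_le_mul h1 (hD i u hu) (norm_nonneg _) ((norm_nonneg _).trans h1)

end TF
end FibProd

namespace FibProd
open Module

section TF2
variable {A : Type*} [AddCommGroup A] {G : Type*} [Group G] (α : G →* AddMonoid.End A)

theorem dvd_smul_mem (U : AddSubgroup A) {e e' : ℕ} (h : e ∣ e') {x : A} (hx : e • x ∈ U) :
    e' • x ∈ U := by
  obtain ⟨c, rfl⟩ := h
  rw [mul_comm, mul_smul]
  exact U.nsmul_mem hx c

theorem common_e (U : AddSubgroup A) (hGU : ∀ g : G, ∃ e : ℕ, 0 < e ∧ ∀ u ∈ U, e • α g u ∈ U)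
    (F : Finset G) : ∃ e : ℕ, 0 < e ∧ ∀ s ∈ F, ∀ u ∈ U, e • α s u ∈ U ∧ e • α s⁻¹ u ∈ U := by
  choose E h0 hE using hGU
  refine ⟨∏ s ∈ F, (E s * E s⁻¹), Finset.prod_pos fun s _ => Nat.mul_pos (h0 _) (h0 _), ?_⟩
  intro s hs u hu
  have hd : E s * E s⁻¹ ∣ ∏ s ∈ F, (E s * E s⁻¹) := Finset.dvd_prod_of_mem (fun s => E s * E s⁻¹) hs
  exact ⟨dvd_smul_mem U ((Dvd.intro _ rfl).trans hd) (hE s u hu),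
    dvd_smul_mem U ((Dvd.intro_left _ rfl).trans hd) (hE s⁻¹ u hu)⟩

theorem exists_prime_mult (U : AddSubgroup A) (n : ℕ) : ∀ x : A, x ∉ U → n • x ∈ U → 0 < n →
    ∃ p c : ℕ, p.Prime ∧ c • x ∉ U ∧ p • (c • x) ∈ U := by
  induction n using Nat.recOnMul with
  | zero => intro x _ _ h; exact absurd h (lt_irrefl 0)
  | one => intro x hx h; rw [one_smul] at h; exact absurd h hx
  | prime p hp => intro x hx h _; exact ⟨p, 1, hp, by simpa using hx, by simpa using h⟩
  | mul m k hm hk =>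
    intro x hx h hpos
    by_cases h1 : k • x ∈ U
    · exact hk x hx h1 (Nat.pos_of_mul_pos_left hpos)
    · rw [mul_smul] at h
      obtain ⟨p, c, hp, h2, h3⟩ := hm (k • x) h1 h (Nat.pos_of_mul_pos_right hpos)
      exact ⟨p, c * k, hp, by rwa [mul_smul], by rwa [mul_smul]⟩

theorem tf_bad_finite [hG : Group.FG G] [IsAddTorsionFree A] {d : ℕ} (a : Fin d → A)
    (ha : ∀ x : A, ∃ e : ℕ, 0 < e ∧ e • x ∈ AddSubgroup.closure (Set.range a))
    {ι : Type*} (M : ι → Subgroup G) (hM : ∀ i, (M i).Normal)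
    (hfi : ∀ i j, i ≠ j → (M i ⊔ M j).FiniteIndex) :
    {i | ∃ U : AddSubgroup A, (∀ x : A, ∃ e : ℕ, 0 < e ∧ e • x ∈ U) ∧
      (∀ m ∈ M i, ∀ u ∈ U, α m u ∈ U) ∧
      (∀ g : G, ∃ e : ℕ, 0 < e ∧ ∀ u ∈ U, e • α g u ∈ U) ∧
      ¬ ∃ k : ℕ, 0 < k ∧ ∀ g : G, ∀ u ∈ U, k • α g u ∈ U}.Finite := by
  classical
  obtain ⟨F, hF⟩ := hG.out
  let bad : ∀ p : ℕ, Set ι := fun p => if hp : p.Prime then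
    letI : Fact p.Prime := ⟨hp⟩
    {i | ¬ Bv (dualRep α p) (M i) ⊥ ≤ Bv (dualRep α p) ⊤ ⊥} else ∅
  have hbadfin : ∀ p, (bad p).Finite := by
    intro p
    by_cases hp : p.Prime
    · simp only [bad, dif_pos hp]
      haveI : Fact p.Prime := ⟨hp⟩
      haveI := finDim p a ha
      exact bad_finite (dualRep α p) M hM hfi
    · simp [bad, dif_neg hp]
  obtain ⟨e0, he0, hE0⟩ := common_e α (AddSubgroup.closure (Set.range a)) (by
    intro g
    choose E h0 hE using fun i => ha (α g (a i))
    refine ⟨∏ i, E i, Finset.prod_pos fun i _ => h0 i, ?_⟩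
    have : AddSubgroup.closure (Set.range a) ≤ (AddSubgroup.closure (Set.range a)).comap
        ((∏ i, E i) • (α g : A →+ A)) := by
      rw [AddSubgroup.closure_le]
      rintro _ ⟨i, rfl⟩
      exact dvd_smul_mem _ (Finset.dvd_prod_of_mem E (Finset.mem_univ i)) (hE i)
    exact fun u hu => this hu) F
  have hbad0 : ∀ p, ¬ p ∣ e0 → bad p = ∅ := by
    intro p hpe
    by_cases hp : p.Prime
    · simp only [bad, dif_pos hp]
      haveI : Fact p.Prime := ⟨hp⟩
      rw [all_bdd α p a ha F hF e0 hpe hE0]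
      simp
    · simp [bad, dif_neg hp]
  have hfin : (⋃ p ∈ (e0.divisors : Set ℕ), bad p).Finite :=
    Set.Finite.biUnion (Finset.finite_toSet _) (fun p _ => hbadfin p)
  refine hfin.subset ?_
  rintro i ⟨U, hU, hMU, hGU, hno⟩
  by_contra hi
  have hgood : ∀ p, i ∉ bad p := by
    intro p hp
    by_cases hpe : p ∣ e0
    · exact hi (Set.mem_biUnion (Finset.mem_coe.2 (Nat.mem_divisors.2 ⟨hpe, he0.ne'⟩)) hp)
    · rw [hbad0 p hpe] at hp; exact hp
  apply hno
  obtain ⟨e1, he1, hE1⟩ := common_e α U hGU F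
  have hk : ∀ p : ℕ, ∃ k : ℕ, ∀ hp : p.Prime, letI : Fact p.Prime := ⟨hp⟩;
      ∀ (f : A →+ ℚ_[p]), (∀ u ∈ U, ‖f u‖ ≤ 1) → ∀ g : G, ∀ u ∈ U,
      ‖(p : ℚ_[p]) ^ k * f (α g u)‖ ≤ 1 := by
    intro p
    by_cases hp : p.Prime
    · haveI : Fact p.Prime := ⟨hp⟩
      have hg := hgood p
      simp only [bad, dif_pos hp, Set.mem_setOf_eq, not_not] at hg
      obtain ⟨k, hk⟩ := exists_pow_of_good α p a ha U hU (M i) hMU hGU hg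
      exact ⟨k, fun _ => hk⟩
    · exact ⟨0, fun h => absurd h hp⟩
  choose k hk using hk
  refine ⟨∏ p ∈ e1.primeFactors, p ^ k p, Finset.prod_pos fun p hp =>
    pow_pos (Nat.prime_of_mem_primeFactors hp).pos _, ?_⟩
  intro g u hu
  by_contra hx
  obtain ⟨n, hn, hnx⟩ := hU ((∏ p ∈ e1.primeFactors, p ^ k p) • α g u)
  obtain ⟨p, c, hp, h2, h3⟩ := exists_prime_mult U n _ hx hnx hn
  haveI : Fact p.Prime := ⟨hp⟩
  obtain ⟨f, hf, hfx⟩ := exists_hom_sep U _ p h2 h3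
  apply hfx
  rw [map_nsmul, map_nsmul, nsmul_eq_mul, nsmul_eq_mul]
  have hnat : ∀ n : ℕ, ‖(n : ℚ_[p])‖ ≤ 1 := fun n => by
    simpa using Padic.norm_int_le_one (p := p) (n : ℤ)
  have hmul : ∀ (n : ℕ) (y : ℚ_[p]), ‖y‖ ≤ 1 → ‖(n : ℚ_[p]) * y‖ ≤ 1 := fun n y hy => by
    rw [norm_mul]; exact mul_le_one₀ (hnat n) (norm_nonneg _) hy
  apply hmul
  by_cases hpe : p ∣ e1
  · have hmem : p ∈ e1.primeFactors := Nat.mem_primeFactors.2 ⟨hp, hpe, he1.ne'⟩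
    rw [← Finset.prod_erase_mul _ _ hmem, Nat.cast_mul, mul_assoc]
    apply hmul
    rw [Nat.cast_pow]
    exact hk p hp f hf g u hu
  · apply hmul
    have := pres_of_gens α p U F hF e1 hpe hE1 f hf g⁻¹ u hu
    rwa [dualRep_apply, inv_inv] at this

end TF2
end FibProd

namespace FibProd
open Group Subgroup

theorem fpr_of_surj {G H : Type*} [Group G] [Group H] (h : FinitePruferRank G) (f : G →* H)
    (hf : Function.Surjective f) : FinitePruferRank H := by
  classical
  obtain ⟨r, hr⟩ := h
  refine ⟨r, fun K hK => ?_⟩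
  obtain ⟨S, hS⟩ := hK
  choose σ hσ using hf
  obtain ⟨T, hT, hTc⟩ := hr (closure (σ '' S)) ⟨S.image σ, by simp⟩
  refine ⟨T.image f, Finset.card_image_le.trans hT, ?_⟩
  rw [Finset.coe_image, ← MonoidHom.map_closure, hTc, MonoidHom.map_closure, Set.image_image]
  simp only [hσ, Set.image_id', hS]

theorem fpr_subgroup {G : Type*} [Group G] (h : FinitePruferRank G) (H : Subgroup G) :
    FinitePruferRank H := by
  classical
  obtain ⟨r, hr⟩ := h
  refine ⟨r, fun K hK => ?_⟩
  obtain ⟨T, hT, hTc⟩ := hr (K.map H.subtype) (by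
    obtain ⟨S, hS⟩ := hK
    exact ⟨S.image H.subtype, by rw [Finset.coe_image, ← MonoidHom.map_closure, hS]⟩)
  have hTH : ∀ t ∈ T, t ∈ H := by
    intro t ht
    have : t ∈ K.map H.subtype := by rw [← hTc]; exact subset_closure ht
    obtain ⟨k, -, rfl⟩ := this
    exact k.2
  refine ⟨T.attach.image (fun t => ⟨t.1, hTH t.1 t.2⟩), Finset.card_image_le.trans (by simpa using hT), ?_⟩
  apply Subgroup.map_injective H.subtype_injective
  rw [← hTc, MonoidHom.map_closure]
  congr 1
  ext x
  constructor
  · rintro ⟨y, hy, rfl⟩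
    simp only [Finset.coe_image, Set.mem_image, Finset.mem_coe, Finset.mem_attach, true_and] at hy
    obtain ⟨t, rfl⟩ := hy
    exact t.2
  · intro hx
    exact ⟨⟨x, hTH x hx⟩, by simpa using hx, rfl⟩

theorem card_closure_le {Q : Type*} [CommGroup Q] (k : ℕ) (hk : 0 < k) (hQ : ∀ q : Q, q ^ k = 1)
    (S : Finset Q) : Finite (closure (S : Set Q)) ∧ Nat.card (closure (S : Set Q)) ≤ k ^ S.card := by
  classical
  induction S using Finset.induction_on with
  | empty =>
    rw [Finset.coe_empty, Subgroup.closure_empty]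
    exact ⟨inferInstance, by simp⟩
  | insert a S ha ih =>
    obtain ⟨h1, h2⟩ := ih
    have e : closure ((insert a S : Finset Q) : Set Q) = zpowers a ⊔ closure (S : Set Q) := by
      rw [Finset.coe_insert, Set.insert_eq, Subgroup.closure_union, zpowers_eq_closure]
    have hfo : IsOfFinOrder a := isOfFinOrder_iff_pow_eq_one.2 ⟨k, hk, hQ a⟩
    haveI : Finite (zpowers a) := by
      rw [← Nat.card_pos_iff.trans (and_iff_right ⟨⟨1, one_mem _⟩⟩), Nat.card_zpowers]
      exact hfo.orderOf_pos
    let f : zpowers a × closure (S : Set Q) → closure ((insert a S : Finset Q) : Set Q) :=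
      fun x => ⟨x.1 * x.2, by rw [e]; exact Subgroup.mul_mem_sup x.1.2 x.2.2⟩
    have hf : Function.Surjective f := by
      rintro ⟨x, hx⟩
      rw [e] at hx
      obtain ⟨y, hy, z, hz, rfl⟩ := Subgroup.mem_sup.1 hx
      exact ⟨(⟨y, hy⟩, ⟨z, hz⟩), rfl⟩
    refine ⟨Finite.of_surjective f hf, (Nat.card_le_card_of_surjective f hf).trans ?_⟩
    rw [Nat.card_prod, Finset.card_insert_of_notMem ha, pow_succ', Nat.card_zpowers]
    exact Nat.mul_le_mul (orderOf_le_of_pow_eq_one hk (hQ a)) h2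

theorem finite_of_exp {Q : Type*} [CommGroup Q] (h : FinitePruferRank Q) (k : ℕ) (hk : 0 < k)
    (hQ : ∀ q : Q, q ^ k = 1) : Finite Q := by
  classical
  obtain ⟨r, hr⟩ := h
  by_contra hinf
  haveI : Infinite Q := not_finite_iff_infinite.1 hinf
  obtain ⟨Z, hZ⟩ := Infinite.exists_subset_card_eq Q (k ^ r + 1)
  obtain ⟨S, hS, hSc⟩ := hr (closure (Z : Set Q)) ⟨Z, rfl⟩
  obtain ⟨h1, h2⟩ := card_closure_le k hk hQ S
  have h3 : Z.card ≤ Nat.card (closure (S : Set Q)) := by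
    have : Function.Injective (fun z : Z => (⟨z.1, by rw [hSc]; exact subset_closure z.2⟩ : closure (S : Set Q))) := by
      intro a b hab
      exact Subtype.ext (congrArg (fun t => t.1) hab)
    simpa using Nat.card_le_card_of_injective _ this
  have h4 : k ^ S.card ≤ k ^ r := Nat.pow_le_pow_right hk hS
  omega

/-- finitely many cosets in the `k`-torsion of `A/U` -/
theorem finite_cosets {G : Type*} [Group G] (h : FinitePruferRank G) (A U E : Subgroup G)
    (hA : ∀ a ∈ A, ∀ b ∈ A, a * b = b * a) (hU : U ≤ E) (hE : E ≤ A) (k : ℕ) (hk : 0 < k)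
    (hEk : ∀ x ∈ E, x ^ k ∈ U) :
    ∃ R : Set G, R.Finite ∧ R ⊆ E ∧ ∀ x ∈ E, ∃ r ∈ R, r⁻¹ * x ∈ U := by
  letI : CommGroup E := { (inferInstance : Group E) with
    mul_comm := fun a b => Subtype.ext (hA _ (hE a.2) _ (hE b.2)) }
  let U' : Subgroup E := U.comap E.subtype
  have hfin : Finite (E ⧸ U') := by
    refine finite_of_exp (fpr_of_surj (fpr_subgroup h E) (QuotientGroup.mk' U')
      (QuotientGroup.mk'_surjective U')) k hk ?_
    intro q
    obtain ⟨x, rfl⟩ := QuotientGroup.mk_surjective q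
    rw [← QuotientGroup.mk_pow, QuotientGroup.eq_one_iff]
    exact hEk x x.2
  refine ⟨Set.range (fun q : E ⧸ U' => (q.out : G)), Set.finite_range _, ?_, ?_⟩
  · rintro _ ⟨q, rfl⟩; exact q.out.2
  · intro x hx
    refine ⟨_, ⟨((⟨x, hx⟩ : E) : E ⧸ U'), rfl⟩, ?_⟩
    have : (((⟨x, hx⟩ : E) : E ⧸ U').out)⁻¹ * (⟨x, hx⟩ : E) ∈ U' := by
      rw [← QuotientGroup.eq]; simp
    exact this

theorem exists_tf_basis {A : Type*} [AddCommGroup A] (r : ℕ)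
    (hr : ∀ H : AddSubgroup A, H.FG → ∃ S : Finset A, S.card ≤ r ∧ AddSubgroup.closure (S : Set A) = H) :
    ∃ (d : ℕ) (a : Fin d → A), ∀ x : A, ∃ e : ℕ, 0 < e ∧ e • x ∈ AddSubgroup.closure (Set.range a) := by
  classical
  by_contra hno
  push Not at hno
  have key : ∀ m : ℕ, ∃ v : Fin m → A, LinearIndependent ℤ v := by
    intro m
    induction m with
    | zero => exact ⟨Fin.elim0, linearIndependent_empty_type⟩
    | succ m ih =>
      obtain ⟨v, hv⟩ := ih
      obtain ⟨x, hx⟩ := hno m v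
      refine ⟨_, LinearIndependent.finCons' x v hv ?_⟩
      intro c y hy hcy
      by_contra hc
      apply hx c.natAbs (Int.natAbs_pos.2 hc)
      have h1 : c • x ∈ AddSubgroup.closure (Set.range v) := by
        rw [eq_neg_of_add_eq_zero_left hcy]
        apply neg_mem
        rw [← Submodule.span_int_eq_addSubgroupClosure]
        exact hy
      rcases Int.natAbs_eq c with h | h
      · rw [h, natCast_zsmul] at h1; exact h1
      · rw [h, neg_smul, natCast_zsmul] at h1
        exact neg_mem_iff.1 h1
  obtain ⟨v, hv⟩ := key (r + 1)
  obtain ⟨S, hS, hSc⟩ := hr (AddSubgroup.closure (Set.range v))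
    ⟨Finset.univ.image v, by simp⟩
  have h1 : Submodule.span ℤ (Set.range v) = Submodule.span ℤ (S : Set A) := by
    apply Submodule.toAddSubgroup_injective
    rw [Submodule.span_int_eq_addSubgroupClosure, Submodule.span_int_eq_addSubgroupClosure, hSc]
  have h2 := linearIndependent_le_span_aux' v hv (S : Set A)  (by
    rw [← h1]; exact Submodule.subset_span)
  simp at h2
  omega

end FibProd

namespace FibProd
open Group Subgroup

section TL
variable {G : Type*} [Group G]

/-- elements of `A` whose `e`-th power is in `U` -/
def rootSub (A U : Subgroup G) (hA : ∀ a ∈ A, ∀ b ∈ A, a * b = b * a) (e : ℕ) : Subgroup G where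
  carrier := {x | x ∈ A ∧ x ^ e ∈ U}
  mul_mem' := by
    rintro x y ⟨hx, hx'⟩ ⟨hy, hy'⟩
    refine ⟨mul_mem hx hy, ?_⟩
    rw [(show Commute x y from hA x hx y hy).mul_pow]
    exact mul_mem hx' hy'
  one_mem' := ⟨one_mem _, by rw [one_pow]; exact one_mem _⟩
  inv_mem' := by
    rintro x ⟨hx, hx'⟩
    exact ⟨inv_mem hx, by rw [inv_pow]; exact inv_mem hx'⟩

theorem mem_rootSub {A U : Subgroup G} {hA : ∀ a ∈ A, ∀ b ∈ A, a * b = b * a} {e : ℕ} {x : G} :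
    x ∈ rootSub A U hA e ↔ x ∈ A ∧ x ^ e ∈ U := Iff.rfl

theorem conj_pow' (g x : G) (e : ℕ) : (g * x * g⁻¹) ^ e = g * x ^ e * g⁻¹ := conj_pow

theorem fg_sup_of_root (hpr : FinitePruferRank G) {A U E M : Subgroup G}
    (hA : ∀ a ∈ A, ∀ b ∈ A, a * b = b * a) (hU : U ≤ E) (hE : E ≤ A) (k : ℕ) (hk : 0 < k)
    (hEk : ∀ x ∈ E, x ^ k ∈ U) (hM : M.FG) (hUM : U ≤ M) : (M ⊔ E).FG := by
  obtain ⟨R, hR, hRE, hRc⟩ := finite_cosets hpr A U E hA hU hE k hk hEk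
  have : M ⊔ E = M ⊔ closure R := by
    refine le_antisymm (sup_le le_sup_left ?_) (sup_le le_sup_left ?_)
    · intro x hx
      obtain ⟨r, hr, h⟩ := hRc x hx
      have : x = r * (r⁻¹ * x) := by group
      rw [this]
      exact mul_mem ((le_sup_right : closure R ≤ M ⊔ closure R) (subset_closure hr))
        ((le_sup_left : M ≤ M ⊔ closure R) (hUM h))
    · exact ((closure_le _).2 hRE).trans le_sup_right
  rw [this]
  exact hM.sup (Subgroup.fg_iff _ |>.2 ⟨R, rfl, hR⟩)

theorem mem_sup_abel {M A : Subgroup G} (hA : A.Normal) {x : G} (hx : x ∈ M ⊔ A) :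
    ∃ m ∈ M, ∃ a ∈ A, x = m * a := by
  have hx' : x ∈ ((M ⊔ A : Subgroup G) : Set G) := hx
  rw [Subgroup.mul_normal M A] at hx'
  obtain ⟨m, hm, a, ha, rfl⟩ := Set.mem_mul.1 hx'
  exact ⟨m, hm, a, ha, rfl⟩

theorem exists_common_exp {A U : Subgroup G} {B : Set G} (hB : B.Finite)
    (h : ∀ b ∈ B, ∃ e : ℕ, 0 < e ∧ b ^ e ∈ U) : ∃ e : ℕ, 0 < e ∧ ∀ b ∈ B, b ^ e ∈ U := by
  classical
  choose! E h0 hE using h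
  refine ⟨∏ b ∈ hB.toFinset, E b, Finset.prod_pos fun b hb => h0 b (hB.mem_toFinset.1 hb), ?_⟩
  intro b hb
  obtain ⟨c, hc⟩ := Finset.dvd_prod_of_mem E (hB.mem_toFinset.2 hb)
  rw [hc, pow_mul]
  exact pow_mem (hE b hb) c

/-- torsion lemma -/
theorem torsion_lemma [hG : Group.FG G] (hpr : FinitePruferRank G) (A M : Subgroup G)
    (hAn : A.Normal) (hA : ∀ a ∈ A, ∀ b ∈ A, a * b = b * a) (hMn : M.Normal)
    (s : G) (hs : ∀ g : G, ∃ m ∈ M, ∃ n : ℤ, g = m * s ^ n) (hs0 : ∀ n : ℤ, s ^ n ∈ M → n = 0)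
    (U : Subgroup G) (hUn : U.Normal) (hUA : U ≤ A) (hUt : ∀ a ∈ A, ∃ e : ℕ, 0 < e ∧ a ^ e ∈ U)
    (M₀ : Subgroup G) (hM₀ : M₀.FG) (hUM : U ≤ M₀) (hM : M₀ ⊔ A = M) : M.FG := by
  classical
  obtain ⟨F, hF⟩ := hG.out
  choose m hm n hn using hs
  -- enlarge
  let M₁ := M₀ ⊔ closure (m '' F)
  have hM₁ : M₁.FG := hM₀.sup (Subgroup.fg_iff _ |>.2 ⟨_, rfl, F.finite_toSet.image m⟩)
  have hM₁M : M₁ ≤ M := sup_le (by rw [← hM]; exact le_sup_left) ((closure_le _).2 (by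
    rintro _ ⟨g, -, rfl⟩; exact hm g))
  have hM1 : M₁ ⊔ A = M := le_antisymm (sup_le hM₁M (by rw [← hM]; exact le_sup_right))
    (by rw [← hM]; exact sup_le_sup_right le_sup_left A)
  have hUM₁ : U ≤ M₁ := hUM.trans le_sup_left
  obtain ⟨X, hXc, hX⟩ := Subgroup.fg_iff _ |>.1 hM₁
  have hXM : ∀ x ∈ X, x ∈ M := fun x hx => hM₁M (by rw [← hXc]; exact subset_closure hx)
  have hdec : ∀ x ∈ M, ∃ a, a ∈ A ∧ x * a⁻¹ ∈ M₁ := by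
    intro x hx
    rw [← hM1] at hx
    obtain ⟨y, hy, a, ha, rfl⟩ := mem_sup_abel hAn hx
    exact ⟨a, ha, by simpa using hy⟩
  choose! β hβA hβ using hdec
  let B : Set G := (fun x => β (s * x * s⁻¹)) '' X ∪ (fun x => β (s⁻¹ * x * s)) '' X
  have hsM : ∀ x ∈ X, s * x * s⁻¹ ∈ M := fun x hx => hMn.conj_mem x (hXM x hx) s
  have hsM' : ∀ x ∈ X, s⁻¹ * x * s ∈ M := fun x hx => by
    simpa using hMn.conj_mem x (hXM x hx) s⁻¹
  obtain ⟨e, he, hBe⟩ := exists_common_exp (A := A) (U := U) (B := B)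
    ((hX.image _).union (hX.image _)) (by
      rintro b (⟨x, hx, rfl⟩ | ⟨x, hx, rfl⟩)
      · exact hUt _ (hβA _ (hsM x hx))
      · exact hUt _ (hβA _ (hsM' x hx)))
  let E := rootSub A U hA e
  have hEn : E.Normal := ⟨fun x hx g => ⟨hAn.conj_mem x hx.1 g, by
    rw [conj_pow']; exact hUn.conj_mem _ hx.2 g⟩⟩
  have hUE : U ≤ E := fun u hu => ⟨hUA hu, pow_mem hu e⟩
  have hEA : E ≤ A := fun x hx => hx.1
  let M₃ := M₁ ⊔ E
  have hM₃ : M₃.FG := fg_sup_of_root hpr hA hUE hEA e he (fun x hx => hx.2) hM₁ hUM₁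
  have hM₃M : M₃ ≤ M := sup_le hM₁M (hEA.trans (by rw [← hM]; exact le_sup_right))
  have hB3 : ∀ z ∈ M, β z ∈ B → z ∈ M₃ := by
    intro z hz hzB
    have : z = (z * (β z)⁻¹) * β z := by group
    rw [this]
    exact mul_mem ((le_sup_left : M₁ ≤ M₃) (hβ z hz))
      ((le_sup_right : E ≤ M₃) ⟨hβA z hz, hBe _ hzB⟩)
  have hc1 : ∀ x ∈ M₃, s * x * s⁻¹ ∈ M₃ := by
    have : M₃ ≤ M₃.comap (MulAut.conj s).toMonoidHom := by
      refine sup_le ?_ ?_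
      · rw [← hXc, closure_le]
        intro x hx
        exact hB3 _ (hsM x hx) (Or.inl ⟨x, hx, rfl⟩)
      · intro x hx
        exact (le_sup_right : E ≤ M₃) (hEn.conj_mem x hx s)
    exact fun x hx => this hx
  have hc2 : ∀ x ∈ M₃, s⁻¹ * x * s ∈ M₃ := by
    have : M₃ ≤ M₃.comap (MulAut.conj s⁻¹).toMonoidHom := by
      refine sup_le ?_ ?_
      · rw [← hXc, closure_le]
        intro x hx
        show s⁻¹ * x * s⁻¹⁻¹ ∈ M₃
        rw [inv_inv]
        exact hB3 _ (hsM' x hx) (Or.inr ⟨x, hx, rfl⟩)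
      · intro x hx
        exact (le_sup_right : E ≤ M₃) (hEn.conj_mem x hx s⁻¹)
    intro x hx
    simpa using this hx
  have hcz : ∀ n : ℤ, ∀ x ∈ M₃, s ^ n * x * s ^ (-n) ∈ M₃ := by
    intro n
    induction n with
    | zero => intro x hx; simpa using hx
    | succ i ih =>
      intro x hx
      have := hc1 _ (ih x hx)
      convert this using 1
      rw [zpow_add, zpow_neg, zpow_neg, zpow_add]; group
    | pred i ih =>
      intro x hx
      have := hc2 _ (ih x hx)
      convert this using 1
      group
  -- every element is in M₃ s^n
  have hall : ∀ g : G, ∃ z ∈ M₃, ∃ n : ℤ, g = z * s ^ n := by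
    intro g
    have hg : g ∈ closure (F : Set G) := by rw [hF]; trivial
    have hfm : ∀ f ∈ F, m f ∈ M₃ := fun f hf => (le_sup_left : M₁ ≤ M₃)
      ((le_sup_right : closure (m '' F) ≤ M₁) (subset_closure ⟨f, hf, rfl⟩))
    induction hg using Subgroup.closure_induction_left with
    | one => exact ⟨1, one_mem _, 0, by simp⟩
    | mul_left f hf g hg ih =>
      obtain ⟨z, hz, k, rfl⟩ := ih
      refine ⟨m f * (s ^ (n f) * z * s ^ (-(n f))), mul_mem (hfm f hf) (hcz _ z hz), n f + k, ?_⟩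
      conv_lhs => rw [hn f]
      group
    | inv_mul_cancel f hf g hg ih =>
      obtain ⟨z, hz, k, rfl⟩ := ih
      refine ⟨s ^ (-(n f)) * ((m f)⁻¹ * z) * s ^ (-(-(n f))), hcz _ _ (mul_mem (inv_mem (hfm f hf)) hz),
        -(n f) + k, ?_⟩
      conv_lhs => rw [hn f]
      group
  have : M = M₃ := by
    refine le_antisymm (fun x hx => ?_) hM₃M
    obtain ⟨z, hz, k, rfl⟩ := hall x
    have : s ^ k ∈ M := by
      have := mul_mem (inv_mem (hM₃M hz)) hx
      simpa using this
    rw [hs0 k this]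
    simpa using hz
  rw [this]; exact hM₃

end TL
end FibProd

namespace FibProd
open Group Subgroup

section TFL
variable {G : Type*} [Group G]

theorem tf_layer [hG : Group.FG G] (hpr : FinitePruferRank G) (A : Subgroup G)
    (hAn : A.Normal) (hA : ∀ a ∈ A, ∀ b ∈ A, a * b = b * a)
    (hAtf : ∀ a ∈ A, ∀ n : ℕ, 0 < n → a ^ n = 1 → a = 1)
    {ι : Type*} (M : ι → Subgroup G) (hMn : ∀ i, (M i).Normal)
    (s : ι → G) (hs : ∀ i, ∀ g : G, ∃ m ∈ M i, ∃ n : ℤ, g = m * s i ^ n)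
    (hs0 : ∀ i, ∀ n : ℤ, s i ^ n ∈ M i → n = 0)
    (hfi : ∀ i j, i ≠ j → (M i ⊔ M j).FiniteIndex) :
    {i | (∃ M₀ : Subgroup G, M₀.FG ∧ M₀ ⊔ A = M i) ∧ ¬ (M i).FG}.Finite := by
  classical
  letI : CommGroup A := { (inferInstance : Group A) with
    mul_comm := fun a b => Subtype.ext (hA _ a.2 _ b.2) }
  let α : G →* AddMonoid.End (Additive A) :=
    { toFun := fun g => MonoidHom.toAdditive ((MulAut.conjNormal g : MulAut A).toMonoidHom)
      map_one' := by ext x; simp; rfl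
      map_mul' := by intro g h; ext x; simp; rfl }
  have hα : ∀ (g : G) (x : Additive A), ((Additive.toMul (α g x) : A) : G)
      = g * ((Additive.toMul x : A) : G) * g⁻¹ := by
    intro g x
    exact MulAut.conjNormal_apply g _
  haveI : IsAddTorsionFree (Additive A) := by
    refine ⟨fun n hn x y h => ?_⟩
    have h1 : ((Additive.toMul x : A) : G) ^ n = ((Additive.toMul y : A) : G) ^ n :=
      congrArg (fun z : Additive A => ((Additive.toMul z : A) : G)) h
    have h2 : Commute ((Additive.toMul x : A) : G) ((Additive.toMul y : A) : G)⁻¹ :=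
      hA _ (SetLike.coe_mem _) _ (inv_mem (SetLike.coe_mem _))
    have h3 := hAtf (((Additive.toMul x : A) : G) * ((Additive.toMul y : A) : G)⁻¹)
      (mul_mem (SetLike.coe_mem _) (inv_mem (SetLike.coe_mem _))) n (Nat.pos_of_ne_zero hn)
      (by rw [h2.mul_pow, h1, inv_pow, mul_inv_cancel])
    exact Subtype.ext (mul_inv_eq_one.1 h3)
  obtain ⟨d, a, ha⟩ : ∃ (d : ℕ) (a : Fin d → Additive A), ∀ x, ∃ e : ℕ, 0 < e ∧
      e • x ∈ AddSubgroup.closure (Set.range a) := by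
    obtain ⟨r, hr⟩ := fpr_subgroup hpr A
    refine exists_tf_basis r fun H hH => ?_
    obtain ⟨S, hS, hSc⟩ := hr (AddSubgroup.toSubgroup' H) ((AddSubgroup.fg_iff_mul_fg H).1 hH)
    refine ⟨S, hS, ?_⟩
    apply AddSubgroup.toSubgroup'.injective
    rw [← hSc]
    exact AddSubgroup.toSubgroup'_closure _
  refine (tf_bad_finite α a ha M hMn hfi).subset ?_
  rintro i ⟨⟨M₀, hM₀, hM₀A⟩, hnfg⟩
  let aG : Fin d → G := fun j => ((Additive.toMul (a j) : A) : G)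
  let M₁ := M₀ ⊔ closure (Set.range aG)
  have hM₁ : M₁.FG := hM₀.sup (Subgroup.fg_iff _ |>.2 ⟨_, rfl, Set.finite_range _⟩)
  have hAM : A ≤ M i := by rw [← hM₀A]; exact le_sup_right
  have hM₁M : M₁ ≤ M i := sup_le (by rw [← hM₀A]; exact le_sup_left) ((closure_le _).2 (by
    rintro _ ⟨j, rfl⟩; exact hAM (SetLike.coe_mem _)))
  have hM1 : M₁ ⊔ A = M i := le_antisymm (sup_le hM₁M hAM)
    (by rw [← hM₀A]; exact sup_le_sup_right le_sup_left A)
  let UG : Subgroup G := M₁ ⊓ A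
  let U : AddSubgroup (Additive A) := (UG.comap A.subtype).toAddSubgroup
  have hUmem : ∀ x : Additive A, x ∈ U ↔ ((Additive.toMul x : A) : G) ∈ UG := fun x => Iff.rfl
  have hsmul : ∀ (e : ℕ) (x : Additive A), ((Additive.toMul (e • x) : A) : G)
      = ((Additive.toMul x : A) : G) ^ e := fun e x => rfl
  have hUt : ∀ x ∈ A, ∃ e : ℕ, 0 < e ∧ x ^ e ∈ UG := by
    intro x hx
    obtain ⟨e, he, h⟩ := ha (Additive.ofMul ⟨x, hx⟩)
    refine ⟨e, he, ?_⟩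
    have hle : AddSubgroup.closure (Set.range a) ≤ U := by
      rw [AddSubgroup.closure_le]
      rintro _ ⟨j, rfl⟩
      exact ⟨(le_sup_right : closure (Set.range aG) ≤ M₁) (subset_closure ⟨j, rfl⟩), SetLike.coe_mem _⟩
    exact hle h
  -- conjugation
  have hMU : ∀ m ∈ M i, ∀ u ∈ UG, m * u * m⁻¹ ∈ UG := by
    intro m hm u hu
    rw [← hM1] at hm
    obtain ⟨y, hy, b, hb, rfl⟩ := mem_sup_abel hAn hm
    have e1 : y * b * u * (y * b)⁻¹ = y * u * y⁻¹ := by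
      have := hA b hb u hu.2
      calc y * b * u * (y * b)⁻¹ = y * (b * u) * b⁻¹ * y⁻¹ := by group
        _ = y * u * y⁻¹ := by rw [this]; group
    rw [e1]
    exact ⟨M₁.mul_mem (M₁.mul_mem hy hu.1) (M₁.inv_mem hy), hAn.conj_mem u hu.2 y⟩
  obtain ⟨X, hXc, hX⟩ := Subgroup.fg_iff _ |>.1 hM₁
  have hXM : ∀ x ∈ X, x ∈ M i := fun x hx => hM₁M (by rw [← hXc]; exact subset_closure hx)
  have hdec : ∀ x ∈ M i, ∃ a, a ∈ A ∧ x * a⁻¹ ∈ M₁ := by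
    intro x hx
    rw [← hM1] at hx
    obtain ⟨y, hy, a, ha, rfl⟩ := mem_sup_abel hAn hx
    exact ⟨a, ha, by simpa using hy⟩
  choose! β hβA hβ using hdec
  have hGU : ∀ g : G, ∃ e : ℕ, 0 < e ∧ ∀ u ∈ UG, (g * u * g⁻¹) ^ e ∈ UG := by
    intro g
    have hgM : ∀ x ∈ X, g * x * g⁻¹ ∈ M i := fun x hx => (hMn i).conj_mem x (hXM x hx) g
    obtain ⟨e, he, hBe⟩ := exists_common_exp (A := A) (U := UG)
      (B := (fun x => β (g * x * g⁻¹)) '' X) (hX.image _) (by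
        rintro b ⟨x, hx, rfl⟩
        exact hUt _ (hβA _ (hgM x hx)))
    refine ⟨e, he, fun u hu => ?_⟩
    let E := rootSub A UG hA e
    -- M₁ * E is a subgroup
    have hEM : ∀ m ∈ M₁, ∀ x ∈ E, m⁻¹ * x * m ∈ E := by
      intro m hm x hx
      refine ⟨by simpa using hAn.conj_mem x hx.1 m⁻¹, ?_⟩
      have h1 := hMU m⁻¹ (inv_mem (hM₁M hm)) _ hx.2
      rw [← conj_pow', inv_inv] at h1
      exact h1
    have hEM' : ∀ m ∈ M₁, ∀ x ∈ E, m * x * m⁻¹ ∈ E := by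
      intro m hm x hx
      have := hEM m⁻¹ (inv_mem hm) x hx
      rwa [inv_inv] at this
    let P : Subgroup G :=
      { carrier := {z | ∃ m ∈ M₁, ∃ x ∈ E, z = m * x}
        mul_mem' := by
          rintro _ _ ⟨m, hm, x, hx, rfl⟩ ⟨m', hm', x', hx', rfl⟩
          exact ⟨m * m', mul_mem hm hm', (m'⁻¹ * x * m') * x', mul_mem (hEM m' hm' x hx) hx', by group⟩
        one_mem' := ⟨1, one_mem _, 1, one_mem _, by simp⟩
        inv_mem' := by
          rintro _ ⟨m, hm, x, hx, rfl⟩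
          exact ⟨m⁻¹, inv_mem hm, m * x⁻¹ * m⁻¹, hEM' m hm _ (inv_mem hx), by group⟩ }
    have hP : M₁ ≤ P.comap (MulAut.conj g).toMonoidHom := by
      rw [← hXc, closure_le]
      intro x hx
      refine ⟨_, hβ _ (hgM x hx), β (g * x * g⁻¹), ⟨hβA _ (hgM x hx), hBe _ ⟨x, hx, rfl⟩⟩, ?_⟩
      show g * x * g⁻¹ = _
      group
    obtain ⟨m, hm, x, hx, hmx⟩ : ∃ m ∈ M₁, ∃ x ∈ E, g * u * g⁻¹ = m * x := hP hu.1
    have hmA : m ∈ A := by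
      have : m = (g * u * g⁻¹) * x⁻¹ := by rw [hmx]; group
      rw [this]
      exact mul_mem (hAn.conj_mem u hu.2 g) (inv_mem hx.1)
    rw [hmx, (show Commute m x from hA m hmA x hx.1).mul_pow]
    exact mul_mem (pow_mem (show m ∈ UG from ⟨hm, hmA⟩) e) hx.2
  refine ⟨U, ?_, ?_, ?_, ?_⟩
  · intro x
    obtain ⟨e, he, h⟩ := hUt _ (Additive.toMul x : A).2
    exact ⟨e, he, h⟩
  · intro m hm u hu
    rw [hUmem, hα]
    exact hMU m hm _ hu
  · intro g
    obtain ⟨e, he, h⟩ := hGU g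
    refine ⟨e, he, fun u hu => ?_⟩
    rw [hUmem, hsmul, hα]
    exact h _ hu
  · rintro ⟨k, hk, hkU⟩
    apply hnfg
    have hkG : ∀ g : G, ∀ u ∈ UG, (g * u * g⁻¹) ^ k ∈ UG := by
      intro g u hu
      have := hkU g (Additive.ofMul ⟨u, hu.2⟩) hu
      rw [hUmem, hsmul, hα] at this
      exact this
    let U' : Subgroup G := normalClosure (UG : Set G)
    have hU'n : U'.Normal := normalClosure_normal
    have hU'E : U' ≤ rootSub A UG hA k := by
      show closure (Group.conjugatesOfSet (UG : Set G)) ≤ _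
      rw [closure_le]
      intro z hz
      obtain ⟨u, hu, hz⟩ := Group.mem_conjugatesOfSet_iff.1 hz
      obtain ⟨g, rfl⟩ := isConj_iff.1 hz
      exact ⟨hAn.conj_mem u hu.2 g, hkG g u hu⟩
    have hU'A : U' ≤ A := fun x hx => (hU'E hx).1
    have hUU' : UG ≤ U' := subset_normalClosure
    refine torsion_lemma hpr A (M i) hAn hA (hMn i) (s i) (hs i) (hs0 i) U' hU'n hU'A ?_ (M₁ ⊔ U')
      ?_ le_sup_right ?_
    · intro x hx
      obtain ⟨e, he, h⟩ := hUt x hx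
      exact ⟨e, he, hUU' h⟩
    · exact fg_sup_of_root hpr hA hUU' hU'A k hk (fun x hx => (hU'E hx).2) hM₁ inf_le_left
    · rw [sup_assoc, sup_eq_right.2 hU'A, hM1]

end TFL
end FibProd

namespace FibProd
open Group Subgroup
open scoped commutatorElement

section Layers
variable {G : Type*} [Group G]

theorem lift_fg (K M : Subgroup G) [K.Normal] (hKM : K ≤ M)
    (h : (M.map (QuotientGroup.mk' K)).FG) : ∃ M₀ : Subgroup G, M₀.FG ∧ M₀ ⊔ K = M := by
  obtain ⟨S, hS, hSf⟩ := Subgroup.fg_iff _ |>.1 h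
  have hsurj := QuotientGroup.mk'_surjective K
  refine ⟨closure (Function.surjInv hsurj '' S), Subgroup.fg_iff _ |>.2 ⟨_, rfl, hSf.image _⟩, ?_⟩
  have h1 : (closure (Function.surjInv hsurj '' S)).map (QuotientGroup.mk' K)
      = M.map (QuotientGroup.mk' K) := by
    rw [MonoidHom.map_closure, Set.image_image, ← hS]
    congr 1
    have : (fun x => (QuotientGroup.mk' K) (Function.surjInv hsurj x)) = id :=
      funext (Function.surjInv_eq hsurj)
    rw [this, Set.image_id]
  have h2 := congrArg (Subgroup.comap (QuotientGroup.mk' K)) h1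
  rw [Subgroup.comap_map_eq, Subgroup.comap_map_eq, QuotientGroup.ker_mk'] at h2
  rw [h2, sup_eq_left.2 hKM]

theorem fg_map {G' : Type*} [Group G'] {M : Subgroup G} (h : M.FG) (f : G →* G') : (M.map f).FG := by
  obtain ⟨S, hS, hSf⟩ := Subgroup.fg_iff _ |>.1 h
  exact Subgroup.fg_iff _ |>.2 ⟨f '' S, by rw [← MonoidHom.map_closure, hS], hSf.image _⟩

theorem map_fg_of (K M A M₀ : Subgroup G) [K.Normal] (hM₀ : M₀.FG) (h : M₀ ⊔ A = M) :
    ∃ M₁ : Subgroup (G ⧸ K), M₁.FG ∧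
      M₁ ⊔ A.map (QuotientGroup.mk' K) = M.map (QuotientGroup.mk' K) :=
  ⟨M₀.map (QuotientGroup.mk' K), fg_map hM₀ _, by rw [← Subgroup.map_sup, h]⟩

theorem quot_hs (K M : Subgroup G) [K.Normal] (s : G)
    (hs : ∀ g : G, ∃ m ∈ M, ∃ n : ℤ, g = m * s ^ n) :
    ∀ g : G ⧸ K, ∃ m ∈ M.map (QuotientGroup.mk' K), ∃ n : ℤ, g = m * (QuotientGroup.mk' K s) ^ n := by
  intro g
  obtain ⟨g, rfl⟩ := QuotientGroup.mk'_surjective K g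
  obtain ⟨m, hm, n, rfl⟩ := hs g
  exact ⟨_, ⟨m, hm, rfl⟩, n, by simp⟩

theorem mem_map_mk' (K M : Subgroup G) [K.Normal] (hKM : K ≤ M) (x : G) :
    QuotientGroup.mk' K x ∈ M.map (QuotientGroup.mk' K) ↔ x ∈ M := by
  rw [← Subgroup.mem_comap, Subgroup.comap_map_eq, QuotientGroup.ker_mk', sup_eq_left.2 hKM]

theorem quot_hs0 (K M : Subgroup G) [K.Normal] (hKM : K ≤ M) (s : G)
    (hs : ∀ n : ℤ, s ^ n ∈ M → n = 0) :
    ∀ n : ℤ, (QuotientGroup.mk' K s) ^ n ∈ M.map (QuotientGroup.mk' K) → n = 0 := by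
  intro n hn
  rw [← map_zpow, mem_map_mk' K M hKM] at hn
  exact hs n hn

theorem quot_comm (K A : Subgroup G) [K.Normal]
    (hA : ∀ a ∈ A, ∀ b ∈ A, a * b * a⁻¹ * b⁻¹ ∈ K) :
    ∀ a ∈ A.map (QuotientGroup.mk' K), ∀ b ∈ A.map (QuotientGroup.mk' K), a * b = b * a := by
  rintro _ ⟨a, ha, rfl⟩ _ ⟨b, hb, rfl⟩
  have h := (QuotientGroup.eq_one_iff _).2 (hA a ha b hb)
  have h' : QuotientGroup.mk' K (a * b * a⁻¹ * b⁻¹) = 1 := h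
  simp only [map_mul, map_inv] at h'
  rw [mul_inv_eq_one, mul_inv_eq_iff_eq_mul] at h'
  exact h'

theorem fg_quot [hG : Group.FG G] (K : Subgroup G) [K.Normal] : Group.FG (G ⧸ K) :=
  Group.fg_of_surjective (QuotientGroup.mk'_surjective K)

theorem layer_step [hG : Group.FG G] (hpr : FinitePruferRank G) (A B : Subgroup G)
    (hAn : A.Normal) (hBn : B.Normal) (hBA : B ≤ A)
    (hA : ∀ a ∈ A, ∀ b ∈ A, a * b * a⁻¹ * b⁻¹ ∈ B)
    {ι : Type*} (M : ι → Subgroup G) (hMn : ∀ i, (M i).Normal)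
    (s : ι → G) (hs : ∀ i, ∀ g : G, ∃ m ∈ M i, ∃ n : ℤ, g = m * s i ^ n)
    (hs0 : ∀ i, ∀ n : ℤ, s i ^ n ∈ M i → n = 0)
    (hfi : ∀ i j, i ≠ j → (M i ⊔ M j).FiniteIndex) (hAM : ∀ i, A ≤ M i) :
    {i | (∃ M₀ : Subgroup G, M₀.FG ∧ M₀ ⊔ A = M i) ∧
      ¬ (∃ M₀ : Subgroup G, M₀.FG ∧ M₀ ⊔ B = M i)}.Finite := by
  have hq1 : ∀ x : G, QuotientGroup.mk' B x = 1 ↔ x ∈ B := fun x => QuotientGroup.eq_one_iff x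
  have hqc := quot_comm B A hA
  let T : Subgroup G :=
    { carrier := {a | a ∈ A ∧ ∃ n : ℕ, 0 < n ∧ a ^ n ∈ B}
      mul_mem' := by
        rintro a b ⟨ha, n, hn, han⟩ ⟨hb, m, hm, hbm⟩
        refine ⟨mul_mem ha hb, n * m, Nat.mul_pos hn hm, ?_⟩
        have hc : Commute (QuotientGroup.mk' B a) (QuotientGroup.mk' B b) :=
          hqc _ ⟨a, ha, rfl⟩ _ ⟨b, hb, rfl⟩
        rw [← hq1, map_pow] at han hbm ⊢
        rw [map_mul, hc.mul_pow, pow_mul, han, one_pow, mul_comm n m, pow_mul, hbm, one_pow, one_mul]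
      one_mem' := ⟨one_mem _, 1, one_pos, by simp [one_mem]⟩
      inv_mem' := by
        rintro a ⟨ha, n, hn, han⟩
        exact ⟨inv_mem ha, n, hn, by rw [inv_pow]; exact inv_mem han⟩ }
  have hTA : T ≤ A := fun x hx => hx.1
  have hBT : B ≤ T := fun x hx => ⟨hBA hx, 1, one_pos, by simpa using hx⟩
  have hTn : T.Normal := ⟨fun x hx g => by
    obtain ⟨hx, n, hn, hxn⟩ := hx
    refine ⟨hAn.conj_mem x hx g, n, hn, ?_⟩
    rw [conj_pow]
    exact hBn.conj_mem _ hxn g⟩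
  haveI := fg_quot T
  haveI := fg_quot B
  have h1 := tf_layer (fpr_of_surj hpr (QuotientGroup.mk' T) (QuotientGroup.mk'_surjective T))
    (A.map (QuotientGroup.mk' T)) (hAn.map _ (QuotientGroup.mk'_surjective T))
    (quot_comm T A (fun a ha b hb => hBT (hA a ha b hb))) (by
      rintro _ ⟨a, ha, rfl⟩ n hn h
      rw [← map_pow] at h
      have h' : a ^ n ∈ T := (QuotientGroup.eq_one_iff _).1 h
      obtain ⟨_, m, hm, h2⟩ := h'
      exact (QuotientGroup.eq_one_iff _).2 ⟨ha, n * m, Nat.mul_pos hn hm, by rw [pow_mul]; exact h2⟩)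
    (fun i => (M i).map (QuotientGroup.mk' T))
    (fun i => (hMn i).map _ (QuotientGroup.mk'_surjective T)) (fun i => QuotientGroup.mk' T (s i))
    (fun i => quot_hs T (M i) (s i) (hs i))
    (fun i => quot_hs0 T (M i) (hTA.trans (hAM i)) (s i) (hs0 i))
    (fun i j hij => by
      rw [← Subgroup.map_sup]
      haveI := hfi i j hij
      exact ⟨fun h0 => this.index_ne_zero (by
        have := Subgroup.index_map_dvd (M i ⊔ M j) (QuotientGroup.mk'_surjective T)
        rw [Subgroup.index_map, QuotientGroup.ker_mk', MonoidHom.range_eq_top.2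
          (QuotientGroup.mk'_surjective T), index_top, mul_one,
          sup_eq_left.2 ((hTA.trans (hAM i)).trans le_sup_left)] at h0
        exact h0)⟩)
  refine h1.subset ?_
  rintro i ⟨⟨M₀, hM₀, hM₀A⟩, hno⟩
  refine ⟨map_fg_of T (M i) A M₀ hM₀ hM₀A, fun hfg => hno ?_⟩
  obtain ⟨M₁, hM₁, hM₁T⟩ := lift_fg T (M i) (hTA.trans (hAM i)) hfg
  apply lift_fg B (M i) (hBA.trans (hAM i))
  obtain ⟨M₂, hM₂, hM₂T⟩ := map_fg_of B (M i) T M₁ hM₁ hM₁T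
  refine torsion_lemma (fpr_of_surj hpr (QuotientGroup.mk' B) (QuotientGroup.mk'_surjective B))
    (T.map (QuotientGroup.mk' B)) _ (hTn.map _ (QuotientGroup.mk'_surjective B))
    (quot_comm B T (fun a ha b hb => hA a (hTA ha) b (hTA hb)))
    ((hMn i).map _ (QuotientGroup.mk'_surjective B)) (QuotientGroup.mk' B (s i))
    (quot_hs B (M i) (s i) (hs i)) (quot_hs0 B (M i) (hBA.trans (hAM i)) (s i) (hs0 i))
    ⊥ inferInstance bot_le ?_ M₂ hM₂ bot_le hM₂T
  rintro _ ⟨a, ⟨ha, n, hn, han⟩, rfl⟩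
  exact ⟨n, hn, by rw [Subgroup.mem_bot, ← map_pow]; exact (hq1 _).2 han⟩

theorem fin_part (C N : Subgroup G) [C.Normal] [hC : C.FiniteIndex] :
    ∃ S : Set G, S.Finite ∧ closure S ⊔ (C ⊓ N) = N := by
  classical
  let f : G ⧸ C → G := fun q => if h : ∃ x ∈ N, QuotientGroup.mk' C x = q then h.choose else 1
  have hfN : ∀ q, f q ∈ N := by
    intro q
    by_cases h : ∃ x ∈ N, QuotientGroup.mk' C x = q
    · simp only [f, dif_pos h]; exact h.choose_spec.1
    · simp only [f, dif_neg h]; exact one_mem _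
  haveI : Finite (G ⧸ C) := Subgroup.finite_quotient_of_finiteIndex
  refine ⟨Set.range f, Set.finite_range f, le_antisymm (sup_le ((closure_le _).2 ?_) inf_le_right) ?_⟩
  · rintro _ ⟨q, rfl⟩
    exact hfN q
  · intro x hx
    have h : ∃ y ∈ N, QuotientGroup.mk' C y = QuotientGroup.mk' C x := ⟨x, hx, rfl⟩
    have hf : QuotientGroup.mk' C (f (QuotientGroup.mk' C x)) = QuotientGroup.mk' C x := by
      simp only [f, dif_pos h]; exact h.choose_spec.2
    have h1 : (f (QuotientGroup.mk' C x))⁻¹ * x ∈ C := QuotientGroup.eq.1 hf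
    have h2 : f (QuotientGroup.mk' C x) * ((f (QuotientGroup.mk' C x))⁻¹ * x) = x := by group
    rw [← h2]
    exact mul_mem (Subgroup.mem_sup_left (subset_closure ⟨_, rfl⟩))
      (Subgroup.mem_sup_right ⟨h1, N.mul_mem (N.inv_mem (hfN _)) hx⟩)

/-- Generic finiteness: for a virtually solvable group of finite Prüfer rank, all but finitely
many `M i` are finitely generated. -/
theorem generic_fg [hG : Group.FG G] (hpr : FinitePruferRank G)
    (H : Subgroup G) (hfi' : H.FiniteIndex) (hsol : Group.IsSolvable H)
    (N : Subgroup G) (hNn : N.Normal)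
    {ι : Type*} (M : ι → Subgroup G) (hMn : ∀ i, (M i).Normal) (hNM : ∀ i, N ≤ M i)
    (hMN : ∀ i, ∃ m : G, closure {m} ⊔ N = M i)
    (s : ι → G) (hs : ∀ i, ∀ g : G, ∃ m ∈ M i, ∃ n : ℤ, g = m * s i ^ n)
    (hs0 : ∀ i, ∀ n : ℤ, s i ^ n ∈ M i → n = 0)
    (hfi : ∀ i j, i ≠ j → (M i ⊔ M j).FiniteIndex) :
    {i | ¬ (M i).FG}.Finite := by
  let D : ℕ → Subgroup G := fun n => (derivedSeries (H.normalCore) n).map H.normalCore.subtype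
  have hcore : H.normalCore.FiniteIndex := inferInstance
  have hDn : ∀ n, (D n).Normal := fun n => by
    haveI : (derivedSeries (H.normalCore) n).Characteristic := inferInstance
    infer_instance
  let L : ℕ → Subgroup G := fun n => D n ⊓ N
  have hLn : ∀ n, (L n).Normal := fun n => by
    haveI := hDn n
    infer_instance
  have hL0 : L 0 = H.normalCore ⊓ N := by
    simp only [L, D, derivedSeries_zero, ← MonoidHom.range_eq_map, Subgroup.range_subtype]
  have hstep : ∀ n, ∀ a ∈ L n, ∀ b ∈ L n, a * b * a⁻¹ * b⁻¹ ∈ L (n+1) := by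
    rintro n a ⟨⟨x, hx, rfl⟩, haN⟩ b ⟨⟨y, hy, rfl⟩, hbN⟩
    refine ⟨⟨⁅x, y⁆, ?_, by simp [commutatorElement_def]⟩, N.mul_mem (N.mul_mem (N.mul_mem haN hbN) (N.inv_mem haN)) (N.inv_mem hbN)⟩
    exact Subgroup.commutator_mem_commutator hx hy
  have hle : ∀ n, L (n+1) ≤ L n := fun n => inf_le_inf_right _ (Subgroup.map_mono
    (derivedSeries_antitone _ (Nat.le_succ n)))
  have hLN : ∀ n, L n ≤ N := fun n => inf_le_right
  have key : ∀ n, {i | ¬ (∃ M₀ : Subgroup G, M₀.FG ∧ M₀ ⊔ L n = M i)}.Finite := by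
    intro n
    induction n with
    | zero =>
      convert Set.finite_empty
      ext i
      simp only [Set.mem_setOf_eq, Set.mem_empty_iff_false, iff_false, not_not]
      obtain ⟨m, hm⟩ := hMN i
      obtain ⟨S, hSf, hS⟩ := fin_part H.normalCore N
      refine ⟨closure {m} ⊔ closure S, ?_, ?_⟩
      · exact Subgroup.FG.sup (Subgroup.fg_iff _ |>.2 ⟨_, rfl, Set.finite_singleton _⟩)
          (Subgroup.fg_iff _ |>.2 ⟨_, rfl, hSf⟩)
      · rw [sup_assoc, hL0, hS, hm]
    | succ n ih =>
      refine (ih.union (layer_step hpr (L n) (L (n+1)) (hLn n) (hLn (n+1)) (hle n) (hstep n) M hMn s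
        hs hs0 hfi (fun i => (hLN n).trans (hNM i)))).subset ?_
      intro i hi
      by_cases h : ∃ M₀ : Subgroup G, M₀.FG ∧ M₀ ⊔ L n = M i
      · exact Or.inr ⟨h, hi⟩
      · exact Or.inl h
  obtain ⟨n, hn⟩ : ∃ n, derivedSeries (H.normalCore) n = ⊥ := by
    haveI : Group.IsSolvable H.normalCore := solvable_of_solvable_injective
      (f := Subgroup.inclusion H.normalCore_le) (Subgroup.inclusion_injective _)
    exact (Group.isSolvable_def _).1 this
  refine (key n).subset ?_
  rintro i hi ⟨M₀, hM₀, h⟩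
  apply hi
  have : L n = ⊥ := by simp [L, D, hn]
  rw [this, sup_bot_eq] at h
  rwa [← h]
end Layers
end FibProd

namespace FibProd
open Group Subgroup

section Gen
variable {G : Type*} [Group G]

theorem generic_two [hG : Group.FG G] (hpr : FinitePruferRank G)
    (H : Subgroup G) (hfi' : H.FiniteIndex) (hsol : Group.IsSolvable H)
    (φ₁ φ₂ : G → ℤ) (h₁ : ∀ x y, φ₁ (x * y) = φ₁ x + φ₁ y) (h₂ : ∀ x y, φ₂ (x * y) = φ₂ x + φ₂ y)
    (hsurj : ∀ x y, ∃ g, φ₁ g = x ∧ φ₂ g = y) :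
    ∃ k : ℤ, ∃ M : Subgroup G, M.FG ∧ ∀ g, g ∈ M ↔ φ₁ g + k * φ₂ g = 0 := by
  have hχ : ∀ k : ℕ, ∀ x y, φ₁ (x * y) + k * φ₂ (x * y) = (φ₁ x + k * φ₂ x) + (φ₁ y + k * φ₂ y) := by
    intro k x y; rw [h₁, h₂]; ring
  let M : ℕ → Subgroup G := fun k => kerZ (fun g => φ₁ g + k * φ₂ g) (hχ k)
  have hM : ∀ k g, g ∈ M k ↔ φ₁ g + k * φ₂ g = 0 := fun k g => mem_kerZ
  obtain ⟨s, hs₁, hs₂⟩ := hsurj 1 0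
  have hm : ∀ k : ℕ, ∃ m, φ₁ m = -k ∧ φ₂ m = 1 := fun k => hsurj _ _
  choose m hm₁ hm₂ using hm
  let N : Subgroup G := kerZ φ₁ h₁ ⊓ kerZ φ₂ h₂
  have hN : ∀ g, g ∈ N ↔ φ₁ g = 0 ∧ φ₂ g = 0 := fun g =>
    (Subgroup.mem_inf).trans (and_congr (mem_kerZ) (mem_kerZ))
  have hfin := generic_fg hpr H hfi' hsol N (by
      refine ⟨fun n hn g => ?_⟩
      rw [hN] at hn ⊢
      rw [h₁, h₁, h₂, h₂, zchi_inv h₁, zchi_inv h₂, hn.1, hn.2]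
      constructor <;> ring) M (by
      intro k
      refine ⟨fun n hn g => ?_⟩
      rw [hM] at hn ⊢
      rw [h₁, h₁, h₂, h₂, zchi_inv h₁, zchi_inv h₂]
      linear_combination hn) (by
      intro k g hg
      rw [hN] at hg
      rw [hM, hg.1, hg.2]; ring) (by
      intro k
      refine ⟨m k, le_antisymm (sup_le ((closure_le _).2 ?_) ?_) ?_⟩
      · rintro _ rfl
        rw [SetLike.mem_coe, hM, hm₁, hm₂]; ring
      · intro g hg
        rw [hN] at hg
        rw [hM, hg.1, hg.2]; ring
      · intro g hg
        rw [hM] at hg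
        have : g = m k ^ (φ₂ g) * (m k ^ (-φ₂ g) * g) := by rw [← mul_assoc, ← zpow_add]; simp
        rw [this]
        refine mul_mem (Subgroup.mem_sup_left (zpow_mem (subset_closure (Set.mem_singleton (m k))) _))
          (Subgroup.mem_sup_right ?_)
        rw [hN, h₁, h₂, zchi_zpow h₁, zchi_zpow h₂, hm₁, hm₂]
        constructor
        · linear_combination hg
        · ring) (fun _ => s) (by
      intro k g
      refine ⟨g * s ^ (-(φ₁ g + k * φ₂ g)), ?_, φ₁ g + k * φ₂ g, by rw [mul_assoc, ← zpow_add]; simp⟩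
      rw [hM, h₁, h₂, zchi_zpow h₁, zchi_zpow h₂, hs₁, hs₂]
      ring) (by
      intro k n hn
      rw [hM, zchi_zpow h₁, zchi_zpow h₂, hs₁, hs₂] at hn
      linear_combination hn) (by
      intro i j hij
      let f : G →* Multiplicative (ZMod ((j:ℤ) - i).natAbs) :=
        { toFun := fun g => Multiplicative.ofAdd ((φ₁ g + i * φ₂ g : ℤ) : ZMod _)
          map_one' := by rw [zchi_one h₁, zchi_one h₂]; simp
          map_mul' := by
            intro x y
            rw [← ofAdd_add, ← Int.cast_add, hχ i x y] }
      haveI : NeZero ((j:ℤ) - i).natAbs := ⟨by omega⟩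
      haveI : Finite (Multiplicative (ZMod ((j:ℤ) - i).natAbs)) :=
        inferInstanceAs (Finite (ZMod ((j:ℤ) - i).natAbs))
      have hker : f.ker ≤ M i ⊔ M j := by
        intro g hg
        have hg' : ((φ₁ g + i * φ₂ g : ℤ) : ZMod ((j:ℤ) - i).natAbs) = 0 := hg
        rw [ZMod.intCast_zmod_eq_zero_iff_dvd, Int.natAbs_dvd] at hg'
        obtain ⟨q, hq⟩ := hg'
        have : g = (g * m j ^ q) * m j ^ (-q) := by rw [mul_assoc, ← zpow_add]; simp
        rw [this]
        refine mul_mem (Subgroup.mem_sup_left ?_) (Subgroup.mem_sup_right (zpow_mem ?_ _))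
        · rw [hM, h₁, h₂, zchi_zpow h₁, zchi_zpow h₂, hm₁, hm₂]
          linear_combination hq
        · rw [hM, hm₁, hm₂]; ring
      exact Subgroup.finiteIndex_of_le hker)
  obtain ⟨k, hk⟩ := hfin.exists_notMem
  exact ⟨k, M k, not_not.1 hk, hM k⟩

theorem exists_fg_corank (n : ℕ) : ∀ {G : Type*} [Group G] [hG : Group.FG G] (hpr : FinitePruferRank G)
    (H : Subgroup G) (hfi' : H.FiniteIndex) (hsol : Group.IsSolvable H)
    (φ : G → (Fin (n+1) → ℤ)) (hφ : ∀ x y, φ (x * y) = φ x + φ y) (hsurj : Function.Surjective φ),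
    ∃ e : (Fin (n+1) → ℤ) ≃+ (Fin (n+1) → ℤ), ∃ M : Subgroup G, M.FG ∧
      ∀ g, g ∈ M ↔ ∀ i : Fin n, e (φ g) i.succ = 0 := by
  induction n with
  | zero =>
    intro G _ hG _ _ _ _ φ hφ hsurj
    exact ⟨AddEquiv.refl _, ⊤, hG.out, fun g => by simp⟩
  | succ n ih =>
    intro G _ hG hpr H hfi hsol φ hφ hsurj
    obtain ⟨k, M, hMfg, hM⟩ := generic_two hpr H hfi hsol (fun g => φ g 0) (fun g => φ g 1)
      (fun x y => by rw [hφ]; rfl) (fun x y => by rw [hφ]; rfl) (fun x y => by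
        obtain ⟨g, hg⟩ := hsurj (Fin.cons x (Fin.cons y 0))
        exact ⟨g, by rw [hg]; rfl, by rw [hg]; rfl⟩)
    haveI : Group.FG M := (Group.fg_iff_subgroup_fg M).2 hMfg
    obtain ⟨e, K, hK, hKmem⟩ := ih (G := M) (fpr_subgroup hpr M) (H.subgroupOf M)
      inferInstance (by
        haveI := hsol
        refine solvable_of_solvable_injective
          (f := ((H.subgroupOf M).subtype.comp (MonoidHom.id _) |> M.subtype.comp).codRestrict H
            (fun x => x.2)) ?_
        intro x y hxy
        apply Subtype.ext
        apply Subtype.ext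
        exact congrArg (fun z : H => (z : G)) hxy)
      (fun g i => φ g i.succ) (fun x y => by
        funext i
        show φ ((x:G) * y) i.succ = _
        rw [hφ]; rfl) (by
        intro v
        obtain ⟨g, hg⟩ := hsurj (Fin.cons (-k * v 0) v)
        have hgM : g ∈ M := by
          rw [hM, hg]
          show -k * v 0 + k * v 0 = 0
          ring
        exact ⟨⟨g, hgM⟩, by funext i; simp only [hg]; rfl⟩)
    let E : (Fin (n+1+1) → ℤ) ≃+ (Fin (n+1+1) → ℤ) :=
      { toFun := fun v => Fin.cons (e (fun i => v i.succ) 0)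
          (Fin.cons (v 0 + k * v 1) (fun i => e (fun i => v i.succ) i.succ))
        invFun := fun w =>
          let u := e.symm (Fin.cons (w 0) (fun i => w i.succ.succ))
          Fin.cons (w 1 - k * u 0) u
        left_inv := by
          intro v
          have h0 : (Fin.cons (e (fun i => v i.succ) 0) (fun i => e (fun i => v i.succ) i.succ) : Fin (n+1) → ℤ)
            = e (fun i => v i.succ) := by
            funext i
            refine Fin.cases ?_ (fun j => ?_) i <;> simp
          have h1 : e.symm (Fin.cons (e (fun i => v i.succ) 0) (fun i => e (fun i => v i.succ) i.succ) : Fin (n+1) → ℤ)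
            = (fun i => v i.succ) := by rw [h0, e.symm_apply_apply]
          funext i
          show (Fin.cons (v 0 + k * v 1 - k * e.symm (Fin.cons (e (fun i => v i.succ) 0) (fun i => e (fun i => v i.succ) i.succ) : Fin (n+1) → ℤ) 0) (e.symm (Fin.cons (e (fun i => v i.succ) 0) (fun i => e (fun i => v i.succ) i.succ) : Fin (n+1) → ℤ)) : Fin (n+1+1) → ℤ) i = v i
          rw [h1]
          refine Fin.cases ?_ (fun j => ?_) i
          · show v 0 + k * v 1 - k * v 1 = v 0
            ring
          · rfl
        right_inv := by
          intro w
          set u := e.symm (Fin.cons (w 0) (fun i => w i.succ.succ)) with hu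
          have hu' : e u = Fin.cons (w 0) (fun i => w i.succ.succ) := by rw [hu, e.apply_symm_apply]
          show (Fin.cons (e u 0) (Fin.cons ((w 1 - k * u 0) + k * u 0) (fun i => e u i.succ)) : Fin (n+1+1) → ℤ) = w
          rw [hu']
          funext i
          refine Fin.cases rfl (fun j => Fin.cases ?_ (fun l => rfl) j) i
          show w 1 - k * u 0 + k * u 0 = w 1
          ring
        map_add' := by
          intro v w
          have h1 : e (fun i => (v + w) i.succ) = e (fun i => v i.succ) + e (fun i => w i.succ) := by
            rw [← map_add]; rfl
          show (Fin.cons (e (fun i => (v + w) i.succ) 0) (Fin.cons ((v 0 + w 0) + k * (v 1 + w 1)) (fun i => e (fun i => (v + w) i.succ) i.succ)) : Fin (n+1+1) → ℤ) = _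
          rw [h1]
          funext i
          refine Fin.cases rfl (fun j => Fin.cases ?_ (fun l => rfl) j) i
          show (v 0 + w 0) + k * (v 1 + w 1) = (v 0 + k * v 1) + (w 0 + k * w 1)
          ring }
    refine ⟨E, K.map M.subtype, fg_map hK _, fun g => ?_⟩
    constructor
    · rintro ⟨x, hx, rfl⟩ i
      refine Fin.cases ?_ (fun l => ?_) i
      · exact (hM x).1 x.2
      · exact (hKmem x).1 hx l
    · intro h
      have hgM : g ∈ M := (hM g).2 (h 0)
      exact ⟨⟨g, hgM⟩, (hKmem ⟨g, hgM⟩).2 (fun l => h l.succ), rfl⟩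
end Gen
end FibProd

namespace FibProd
open Group Subgroup

section Tr
variable {F Γ : Type*} [Group F] [Group Γ]

def Bset (t : F) (Y : Set F) (lo hi : ℤ) : Set F :=
  {z | ∃ b : ℤ, lo ≤ b ∧ b ≤ hi ∧ ∃ y ∈ Y, z = t ^ b * y * t ^ (-b)}

theorem image_Bset (f : F →* Γ) (t : F) (Y : Set F) (lo hi : ℤ) :
    closure (f '' Bset t Y lo hi) = Bint (f t) (f '' Y) lo hi := by
  unfold Bint
  congr 1
  ext z
  constructor
  · rintro ⟨_, ⟨b, h1, h2, y, hy, rfl⟩, rfl⟩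
    exact ⟨b, h1, h2, f y, ⟨y, hy, rfl⟩, by simp⟩
  · rintro ⟨b, h1, h2, _, ⟨y, hy, rfl⟩, rfl⟩
    exact ⟨_, ⟨b, h1, h2, y, hy, rfl⟩, by simp⟩

def Wset (S X : Set F) (ℓ : ℕ) : Set F :=
  {z | ∃ g ∈ WL S ℓ, ∃ x ∈ X, z = g * x * g⁻¹}

theorem image_WL (f : F →* Γ) (S : Set F) (ℓ : ℕ) : f '' WL S ℓ = WL (f '' S) ℓ := by
  induction ℓ with
  | zero => simp [WL]
  | succ n ih =>
    simp only [WL]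
    rw [Set.image_union, ih]
    congr 1
    ext z
    constructor
    · rintro ⟨_, ⟨g, hg, s, hs, rfl⟩, rfl⟩
      exact ⟨f g, by rw [← ih]; exact ⟨g, hg, rfl⟩, f s, ⟨s, hs, rfl⟩, by simp⟩
    · rintro ⟨g, hg, _, ⟨s, hs, rfl⟩, rfl⟩
      rw [← ih] at hg
      obtain ⟨g, hg, rfl⟩ := hg
      exact ⟨_, ⟨g, hg, s, hs, rfl⟩, by simp⟩

theorem image_Wset (f : F →* Γ) (S X : Set F) (ℓ : ℕ) :
    f '' Wset S X ℓ = {z | ∃ g ∈ WL (f '' S) ℓ, ∃ x ∈ f '' X, z = g * x * g⁻¹} := by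
  rw [← image_WL]
  ext z
  constructor
  · rintro ⟨_, ⟨g, hg, x, hx, rfl⟩, rfl⟩
    exact ⟨f g, ⟨g, hg, rfl⟩, f x, ⟨x, hx, rfl⟩, by simp⟩
  · rintro ⟨_, ⟨g, hg, rfl⟩, _, ⟨x, hx, rfl⟩, rfl⟩
    exact ⟨_, ⟨g, hg, x, hx, rfl⟩, by simp⟩

theorem WL_mono {S S' : Set F} (h : S ⊆ S') (n : ℕ) : WL S n ⊆ WL S' n := by
  induction n with
  | zero => exact subset_rfl
  | succ n ih =>
    rintro g (⟨g', hg', s, hs, rfl⟩ | hg)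
    · exact Or.inl ⟨g', ih hg', s, h hs, rfl⟩
    · exact Or.inr (ih hg)

theorem WL_le {S : Set F} {n m : ℕ} (h : n ≤ m) : WL S n ⊆ WL S m := by
  induction h with
  | refl => exact subset_rfl
  | step _ ih => exact ih.trans Set.subset_union_right

end Tr

set_option maxHeartbeats 1000000 in
theorem comm_transfer {H : Type*} [Group H] (X Y S : Set H) (hXf : X.Finite) (hYf : Y.Finite)
    (hSf : S.Finite) (t r : H) (N c ℓ : ℕ) (hc : 1 ≤ c) (hN : c + ℓ * c + 1 ≤ N)
    (hSinv : ∀ s ∈ S, s⁻¹ ∈ S)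
    (hSt : ∀ s ∈ S, ∃ w ∈ Y, ∃ u ∈ X, s * t * s⁻¹ = w * u * t)
    (hSY : ∀ s ∈ S, ∀ y ∈ Y, s * y * s⁻¹ ∈ Bint t Y (-c) c)
    (hτY : ∀ y ∈ Y, (r * t ^ (-N : ℤ)) * y * (r * t ^ (-N : ℤ))⁻¹ ∈ Bint t Y (-c) c)
    (hτY' : ∀ y ∈ Y, (r * t ^ (-N : ℤ))⁻¹ * y * (r * t ^ (-N : ℤ)) ∈ Bint t Y (-c) c)
    (hτt : ∃ w ∈ Y, ∃ u ∈ X, (r * t ^ (-N : ℤ)) * t * (r * t ^ (-N : ℤ))⁻¹ = w * u * t)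
    (hτt' : ∃ w ∈ Y, ∃ u ∈ X, (r * t ^ (-N : ℤ))⁻¹ * t * (r * t ^ (-N : ℤ)) =
      w * (t ^ (N : ℤ) * u * t ^ (-N : ℤ)) * t)
    (hrX : ∀ x ∈ X, r * x * r⁻¹ ∈ closure {z | ∃ g ∈ WL (S ∪ {t, t⁻¹}) ℓ, ∃ x ∈ X, z = g * x * g⁻¹})
    (hrX' : ∀ x ∈ X, r⁻¹ * x * r ∈ closure {z | ∃ g ∈ WL (S ∪ {t, t⁻¹}) ℓ, ∃ x ∈ X, z = g * x * g⁻¹})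
    (hbase : CommUpTo t X Y (N + c + ℓ * c)) :
    ∀ (n : ℕ) (p : FreeGroup (Fin n) →* H) (σ : H → FreeGroup (Fin n)),
      (∀ h, p (σ h) = h) → ∃ M : Set (FreeGroup (Fin n) × Set (FreeGroup (Fin n))), M.Finite ∧
        (∀ m ∈ M, p m.1 ∈ closure (p '' m.2)) ∧
        ∀ (Γ : Type) [Group Γ] (π : FreeGroup (Fin n) →* Γ), Function.Surjective π →
          (∀ m ∈ M, π m.1 ∈ closure (π '' m.2)) →
          closure ((fun h => π (σ h)) '' (X ∪ Y ∪ (S ∪ {t, r}))) = ⊤ →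
          ∀ x ∈ X, ∀ y ∈ Y, ∀ g, Commute (π (σ x)) (g * π (σ y) * g⁻¹) := by
  intro n p σ hσ
  set X' := σ '' X with hX'
  set Y' := σ '' Y with hY'
  set S' := σ '' S ∪ (fun s => (σ s)⁻¹) '' S with hS'
  set t' := σ t with ht'
  set r' := σ r with hr'
  set τ' := r' * t' ^ (-N : ℤ) with hτ'
  have hX'f : X'.Finite := hXf.image _
  have hY'f : Y'.Finite := hYf.image _
  have hS'f : S'.Finite := (hSf.image _).union (hSf.image _)
  have pX : p '' X' = X := by rw [hX', Set.image_image]; simp [hσ]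
  have pY : p '' Y' = Y := by rw [hY', Set.image_image]; simp [hσ]
  have pS : ∀ s ∈ S', p s ∈ S := by
    rintro _ (⟨s, hs, rfl⟩ | ⟨s, hs, rfl⟩)
    · rwa [hσ]
    · simp only [map_inv, hσ]; exact hSinv s hs
  have pSi : p '' (S' ∪ {t', t'⁻¹}) = S ∪ {t, t⁻¹} := by
    rw [Set.image_union, Set.image_pair, map_inv, hσ]
    congr 1
    refine Set.Subset.antisymm ?_ ?_
    · rintro _ ⟨s, hs, rfl⟩; exact pS s hs
    · intro s hs
      exact ⟨σ s, Or.inl ⟨s, hs, rfl⟩, hσ s⟩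
  have pt : p t' = t := hσ t
  have pr : p r' = r := hσ r
  have pτ : p τ' = r * t ^ (-N : ℤ) := by rw [hτ', map_mul, map_zpow, pt, pr]
  have pXm : ∀ x ∈ X', p x ∈ X := fun x hx => by rw [← pX]; exact ⟨x, hx, rfl⟩
  have pYm : ∀ x ∈ Y', p x ∈ Y := fun x hx => by rw [← pY]; exact ⟨x, hx, rfl⟩
  have c1 : ∀ s ∈ S', ∃ w ∈ Y', ∃ u ∈ X', p (s * t' * s⁻¹ * (w * u * t')⁻¹) = 1 := by
    intro s hs
    obtain ⟨w, hw, u, hu, h⟩ := hSt _ (pS s hs)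
    refine ⟨σ w, ⟨w, hw, rfl⟩, σ u, ⟨u, hu, rfl⟩, ?_⟩
    simp only [map_mul, map_inv, hσ, pt]
    rw [h, mul_inv_cancel]
  choose! w1 hw1 u1 hu1 h1 using c1
  obtain ⟨w2, hw2, u2, hu2, h2⟩ : ∃ w ∈ Y', ∃ u ∈ X', p (τ' * t' * τ'⁻¹ * (w * u * t')⁻¹) = 1 := by
    obtain ⟨w, hw, u, hu, h⟩ := hτt
    refine ⟨σ w, ⟨w, hw, rfl⟩, σ u, ⟨u, hu, rfl⟩, ?_⟩
    simp only [map_mul, map_inv, hσ, pt, pτ]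
    rw [h]; group
  obtain ⟨w3, hw3, u3, hu3, h3⟩ : ∃ w ∈ Y', ∃ u ∈ X', p (τ'⁻¹ * t' * τ' *
      (w * (t' ^ (N:ℤ) * u * t' ^ (-N:ℤ)) * t')⁻¹) = 1 := by
    obtain ⟨w, hw, u, hu, h⟩ := hτt'
    refine ⟨σ w, ⟨w, hw, rfl⟩, σ u, ⟨u, hu, rfl⟩, ?_⟩
    simp only [map_mul, map_inv, map_zpow, hσ, pt, pτ]
    rw [h]; group
  let BB := Bset t' Y' (-c) c
  let WW := Wset (S' ∪ {t', t'⁻¹}) X' ℓ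
  let E : FreeGroup (Fin n) → FreeGroup (Fin n) × Set (FreeGroup (Fin n)) := fun z => (z, ∅)
  let k : ℤ := N + c + ℓ * c
  let M1 := (fun s => E (s * t' * s⁻¹ * (w1 s * u1 s * t')⁻¹)) '' S'
  let M2 := (fun sy : _ × _ => (sy.1 * sy.2 * sy.1⁻¹, BB)) '' (S' ×ˢ Y')
  let M3 := (fun y => (τ' * y * τ'⁻¹, BB)) '' Y'
  let M3' := (fun y => (τ'⁻¹ * y * τ', BB)) '' Y'
  let M4 : Set (FreeGroup (Fin n) × Set (FreeGroup (Fin n))) := {E (τ' * t' * τ'⁻¹ * (w2 * u2 * t')⁻¹),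
    E (τ'⁻¹ * t' * τ' * (w3 * (t' ^ (N:ℤ) * u3 * t' ^ (-N:ℤ)) * t')⁻¹)}
  let M5 := (fun x => (r' * x * r'⁻¹, WW)) '' X'
  let M5' := (fun x => (r'⁻¹ * x * r', WW)) '' X'
  let M6 := (fun q : (FreeGroup (Fin n) × FreeGroup (Fin n)) × ℤ =>
      E (q.1.1 * (t' ^ q.2 * q.1.2 * t' ^ (-q.2)) * ((t' ^ q.2 * q.1.2 * t' ^ (-q.2)) * q.1.1)⁻¹))
      '' ((X' ×ˢ Y') ×ˢ Set.Icc (-k) k)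
  refine ⟨M1 ∪ M2 ∪ M3 ∪ M3' ∪ M4 ∪ M5 ∪ M5' ∪ M6, ?_, ?_, ?_⟩
  · refine Set.Finite.union (Set.Finite.union (Set.Finite.union (Set.Finite.union (Set.Finite.union
      (Set.Finite.union (Set.Finite.union ?_ ?_) ?_) ?_) ?_) ?_) ?_) ?_
    · exact hS'f.image _
    · exact (hS'f.prod hY'f).image _
    · exact hY'f.image _
    · exact hY'f.image _
    · exact (Set.finite_singleton _).insert _
    · exact hX'f.image _
    · exact hX'f.image _
    · exact ((hX'f.prod hY'f).prod (Set.finite_Icc _ _)).image _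
  · rintro m (((((((⟨s, hs, rfl⟩ | ⟨⟨s, y⟩, ⟨hs, hy⟩, rfl⟩) | ⟨y, hy, rfl⟩) | ⟨y, hy, rfl⟩) |
      (rfl | rfl)) | ⟨x, hx, rfl⟩) | ⟨x, hx, rfl⟩) | ⟨⟨⟨x, y⟩, i⟩, ⟨⟨hx, hy⟩, hi⟩, rfl⟩)
    · show p _ ∈ _
      rw [h1 s hs]; exact one_mem _
    · show p (s * y * s⁻¹) ∈ closure (p '' BB)
      rw [image_Bset, pt, pY, map_mul, map_mul, map_inv]
      exact hSY _ (pS s hs) _ (pYm y hy)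
    · show p (τ' * y * τ'⁻¹) ∈ closure (p '' BB)
      rw [image_Bset, pt, pY, map_mul, map_mul, map_inv, pτ]
      exact hτY _ (pYm y hy)
    · show p (τ'⁻¹ * y * τ') ∈ closure (p '' BB)
      rw [image_Bset, pt, pY, map_mul, map_mul, map_inv, pτ]
      exact hτY' _ (pYm y hy)
    · show p _ ∈ _
      rw [h2]; exact one_mem _
    · show p _ ∈ _
      rw [h3]; exact one_mem _
    · show p (r' * x * r'⁻¹) ∈ closure (p '' WW)
      rw [image_Wset, pSi, pX, map_mul, map_mul, map_inv, pr]
      exact hrX _ (pXm x hx)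
    · show p (r'⁻¹ * x * r') ∈ closure (p '' WW)
      rw [image_Wset, pSi, pX, map_mul, map_mul, map_inv, pr]
      exact hrX' _ (pXm x hx)
    · show p (x * (t' ^ i * y * t' ^ (-i)) * ((t' ^ i * y * t' ^ (-i)) * x)⁻¹) ∈ _
      have := hbase _ (pXm x hx) _ (pYm y hy) i (abs_le.2 hi)
      have e1 : p (x * (t' ^ i * y * t' ^ (-i)) * ((t' ^ i * y * t' ^ (-i)) * x)⁻¹) = 1 := by
        simp only [map_mul, map_inv, map_zpow, pt]
        rw [this.eq, mul_inv_cancel]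
      rw [e1]; exact one_mem _
  · intro Γ _ π hπ hM hgen
    have hM1 : ∀ m ∈ M1, π m.1 ∈ closure (π '' m.2) := fun m hm =>
      hM m (Or.inl (Or.inl (Or.inl (Or.inl (Or.inl (Or.inl (Or.inl hm)))))))
    have hM2 : ∀ m ∈ M2, π m.1 ∈ closure (π '' m.2) := fun m hm =>
      hM m (Or.inl (Or.inl (Or.inl (Or.inl (Or.inl (Or.inl (Or.inr hm)))))))
    have hM3 : ∀ m ∈ M3, π m.1 ∈ closure (π '' m.2) := fun m hm =>
      hM m (Or.inl (Or.inl (Or.inl (Or.inl (Or.inl (Or.inr hm))))))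
    have hM3' : ∀ m ∈ M3', π m.1 ∈ closure (π '' m.2) := fun m hm =>
      hM m (Or.inl (Or.inl (Or.inl (Or.inl (Or.inr hm)))))
    have hM4 : ∀ m ∈ M4, π m.1 ∈ closure (π '' m.2) := fun m hm =>
      hM m (Or.inl (Or.inl (Or.inl (Or.inr hm))))
    have hM5 : ∀ m ∈ M5, π m.1 ∈ closure (π '' m.2) := fun m hm =>
      hM m (Or.inl (Or.inl (Or.inr hm)))
    have hM5' : ∀ m ∈ M5', π m.1 ∈ closure (π '' m.2) := fun m hm =>
      hM m (Or.inl (Or.inr hm))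
    have hM6 : ∀ m ∈ M6, π m.1 ∈ closure (π '' m.2) := fun m hm =>
      hM m (Or.inr hm)
    clear hM
    have hE : ∀ a b : FreeGroup (Fin n), π (a * b⁻¹) ∈ closure (π '' (∅ : Set (FreeGroup (Fin n)))) → π a = π b := by
      intro a b h
      rw [Set.image_empty, Subgroup.closure_empty, Subgroup.mem_bot, map_mul, map_inv, mul_inv_eq_one] at h
      exact h
    have πτ : π τ' = π r' * (π t') ^ (-N : ℤ) := by rw [hτ', map_mul, map_zpow]
    have main := comm_lemma (X := π '' X') (Y := π '' Y') (t := π t') (π '' S') (π r') (π τ') N c ℓ hc hN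
      ?_ πτ ?_ ?_ ?_ ?_ ?_ ?_ ?_ ?_ ?_ ?_
    · intro x hx y hy g
      exact main _ ⟨σ x, ⟨x, hx, rfl⟩, rfl⟩ _ ⟨σ y, ⟨y, hy, rfl⟩, rfl⟩ g
    · rw [eq_top_iff, ← hgen]
      apply Subgroup.closure_mono
      rintro _ ⟨h, ((hx | hy) | (hs | (rfl | rfl))), rfl⟩
      · exact Or.inl (Or.inl ⟨σ h, ⟨h, hx, rfl⟩, rfl⟩)
      · exact Or.inl (Or.inr ⟨σ h, ⟨h, hy, rfl⟩, rfl⟩)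
      · exact Or.inr (Or.inl ⟨σ h, Or.inl ⟨h, hs, rfl⟩, rfl⟩)
      · exact Or.inr (Or.inr (Or.inl rfl))
      · exact Or.inr (Or.inr (Or.inr rfl))
    · rintro _ ⟨_, (⟨s, hs, rfl⟩ | ⟨s, hs, rfl⟩), rfl⟩
      · exact ⟨(σ s)⁻¹, Or.inr ⟨s, hs, rfl⟩, by simp⟩
      · exact ⟨σ s, Or.inl ⟨s, hs, rfl⟩, by simp⟩
    · rintro _ ⟨s, hs, rfl⟩
      refine ⟨_, ⟨w1 s, hw1 s hs, rfl⟩, _, ⟨u1 s, hu1 s hs, rfl⟩, ?_⟩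
      have := hE (s * t' * s⁻¹) (w1 s * u1 s * t')
        (hM1 (E (s * t' * s⁻¹ * (w1 s * u1 s * t')⁻¹)) ⟨s, hs, rfl⟩)
      simpa only [map_mul, map_inv] using this
    · rintro _ ⟨s, hs, rfl⟩ _ ⟨y, hy, rfl⟩
      have := hM2 (s * y * s⁻¹, BB) ⟨(s, y), ⟨hs, hy⟩, rfl⟩
      rw [image_Bset] at this
      simpa only [map_mul, map_inv] using this
    · rintro _ ⟨y, hy, rfl⟩
      have := hM3 (τ' * y * τ'⁻¹, BB) ⟨y, hy, rfl⟩
      rw [image_Bset] at this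
      rw [← map_inv, ← map_mul, ← map_mul]
      exact this
    · rintro _ ⟨y, hy, rfl⟩
      have := hM3' (τ'⁻¹ * y * τ', BB) ⟨y, hy, rfl⟩
      rw [image_Bset] at this
      rw [← map_inv, ← map_mul, ← map_mul]
      exact this
    · refine ⟨_, ⟨w2, hw2, rfl⟩, _, ⟨u2, hu2, rfl⟩, ?_⟩
      have := hE (τ' * t' * τ'⁻¹) (w2 * u2 * t') (hM4 (E (τ' * t' * τ'⁻¹ * (w2 * u2 * t')⁻¹)) (Or.inl rfl))
      rw [← map_inv, ← map_mul, ← map_mul, this, map_mul, map_mul]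
    · refine ⟨_, ⟨w3, hw3, rfl⟩, _, ⟨u3, hu3, rfl⟩, ?_⟩
      have := hE (τ'⁻¹ * t' * τ') (w3 * (t' ^ (N:ℤ) * u3 * t' ^ (-N:ℤ)) * t')
        (hM4 (E (τ'⁻¹ * t' * τ' * (w3 * (t' ^ (N:ℤ) * u3 * t' ^ (-N:ℤ)) * t')⁻¹)) (Or.inr rfl))
      rw [← map_inv, ← map_mul, ← map_mul, this]
      simp only [map_mul, map_zpow]
    · rintro _ ⟨x, hx, rfl⟩
      have := hM5 (r' * x * r'⁻¹, WW) ⟨x, hx, rfl⟩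
      rw [image_Wset, Set.image_union, Set.image_pair, map_inv π t'] at this
      simpa only [map_mul, map_inv] using this
    · rintro _ ⟨x, hx, rfl⟩
      have := hM5' (r'⁻¹ * x * r', WW) ⟨x, hx, rfl⟩
      rw [image_Wset, Set.image_union, Set.image_pair, map_inv π t'] at this
      simpa only [map_mul, map_inv] using this
    · rintro _ ⟨x, hx, rfl⟩ _ ⟨y, hy, rfl⟩ i hi
      have := hE (x * (t' ^ i * y * t' ^ (-i))) ((t' ^ i * y * t' ^ (-i)) * x) (hM6 (E (x * (t' ^ i * y * t' ^ (-i)) * ((t' ^ i * y * t' ^ (-i)) * x)⁻¹)) ⟨((x, y), i), ⟨⟨hx, hy⟩, abs_le.1 hi⟩, rfl⟩)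
      simp only [map_mul, map_zpow] at this
      exact this

end FibProd

namespace FibProd
open Group Subgroup

section Core
variable {H G₁ G₂ Q : Type*} [Group H] [Group G₁] [Group G₂] [CommGroup Q]

theorem lift_closure (q₁ : H →* G₁) (q₂ : H →* G₂) (hinj : ∀ h, q₁ h = 1 → q₂ h = 1 → h = 1)
    {A : Set H} (hA : ∀ a ∈ A, q₂ a = 1) {z : H} (hz2 : q₂ z = 1) (hz1 : q₁ z ∈ closure (q₁ '' A)) :
    z ∈ closure A := by
  rw [← MonoidHom.map_closure] at hz1
  obtain ⟨a, ha, haz⟩ := hz1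
  have hle : closure A ≤ q₂.ker := (closure_le _).2 hA
  have h2 : q₂ a = 1 := hle ha
  have : z * a⁻¹ = 1 := hinj _ (by rw [map_mul, map_inv, haz, mul_inv_cancel])
    (by rw [map_mul, map_inv, h2, hz2]; simp)
  rw [mul_inv_eq_one.1 this]
  exact ha

theorem conj_set_le {T X A : Set H} (hT : T ⊆ closure A) (hX : X ⊆ closure A) :
    closure {z | ∃ g ∈ closure T, ∃ x ∈ X, z = g * x * g⁻¹} ≤ closure A := by
  rw [closure_le]
  rintro _ ⟨g, hg, x, hx, rfl⟩
  have hg' : g ∈ closure A := (closure_le _).2 hT hg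
  exact mul_mem (mul_mem hg' (hX hx)) (inv_mem hg')

theorem conj_set_normal {T X : Set H} :
    closure {z | ∃ g ∈ closure T, ∃ x ∈ X, z = g * x * g⁻¹} ≤ normalClosure X := by
  rw [closure_le]
  rintro _ ⟨g, hg, x, hx, rfl⟩
  exact normalClosure_normal.conj_mem x (subset_normalClosure hx) g

theorem image_conj (f : H →* G₁) (T X : Set H) :
    f '' {z | ∃ g ∈ closure T, ∃ x ∈ X, z = g * x * g⁻¹}
      = {z | ∃ g ∈ closure (f '' T), ∃ x ∈ f '' X, z = g * x * g⁻¹} := by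
  ext z
  constructor
  · rintro ⟨_, ⟨g, hg, x, hx, rfl⟩, rfl⟩
    exact ⟨f g, by rw [← MonoidHom.map_closure]; exact ⟨g, hg, rfl⟩, f x, ⟨x, hx, rfl⟩, by simp⟩
  · rintro ⟨g, hg, _, ⟨x, hx, rfl⟩, rfl⟩
    rw [← MonoidHom.map_closure] at hg
    obtain ⟨g, hg, rfl⟩ := hg
    exact ⟨_, ⟨g, hg, x, hx, rfl⟩, by simp⟩

theorem core_gen (q₁ : H →* G₁) (q₂ : H →* G₂)
    (hinj : ∀ h, q₁ h = 1 → q₂ h = 1 → h = 1)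
    (θ : H →* Q) (hθ : ∀ h, θ h = 1 → ∃ a b, q₂ a = 1 ∧ q₁ b = 1 ∧ h = a * b)
    (X Y T : Set H) (hX2 : ∀ x ∈ X, q₂ x = 1) (hY1 : ∀ y ∈ Y, q₁ y = 1)
    (hgenθ : ∀ h, ∃ d ∈ closure T, θ d = θ h)
    (hN1 : ∀ h, q₂ h = 1 → q₁ h ∈
      closure {z | ∃ g ∈ closure (q₁ '' T), ∃ x ∈ q₁ '' X, z = g * x * g⁻¹})
    (hN2 : ∀ h, q₁ h = 1 → q₂ h ∈
      closure {z | ∃ g ∈ closure (q₂ '' T), ∃ y ∈ q₂ '' Y, z = g * y * g⁻¹}) :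
    closure (X ∪ Y ∪ T) = ⊤ ∧ normalClosure X = q₂.ker ∧ normalClosure Y = q₁.ker := by
  have k1 : ∀ h, q₂ h = 1 → h ∈ closure {z | ∃ g ∈ closure T, ∃ x ∈ X, z = g * x * g⁻¹} := by
    intro h hh
    refine lift_closure q₁ q₂ hinj ?_ hh ?_
    · rintro _ ⟨g, _, x, hx, rfl⟩
      rw [map_mul, map_mul, hX2 x hx, map_inv]; simp
    · rw [image_conj]; exact hN1 h hh
  have k2 : ∀ h, q₁ h = 1 → h ∈ closure {z | ∃ g ∈ closure T, ∃ x ∈ Y, z = g * x * g⁻¹} := by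
    intro h hh
    refine lift_closure q₂ q₁ (fun h h1 h2 => hinj h h2 h1) ?_ hh ?_
    · rintro _ ⟨g, _, x, hx, rfl⟩
      rw [map_mul, map_mul, hY1 x hx, map_inv]; simp
    · rw [image_conj]; exact hN2 h hh
  refine ⟨?_, ?_, ?_⟩
  · rw [eq_top_iff]
    intro h _
    obtain ⟨d, hd, hdh⟩ := hgenθ h
    obtain ⟨a, b, ha, hb, hab⟩ := hθ (d⁻¹ * h) (by rw [map_mul, map_inv, hdh, inv_mul_cancel])
    have : h = d * (a * b) := by rw [← hab]; group
    rw [this]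
    have hT : T ⊆ closure (X ∪ Y ∪ T) := fun z hz => subset_closure (Or.inr hz)
    refine mul_mem ((closure_le _).2 hT hd) (mul_mem ?_ ?_)
    · exact conj_set_le hT (fun z hz => subset_closure (Or.inl (Or.inl hz))) (k1 a ha)
    · exact conj_set_le hT (fun z hz => subset_closure (Or.inl (Or.inr hz))) (k2 b hb)
  · exact le_antisymm (normalClosure_le_normal hX2) (fun h hh => conj_set_normal (k1 h hh))
  · exact le_antisymm (normalClosure_le_normal hY1) (fun h hh => conj_set_normal (k2 h hh))

theorem core [IsFinitelyPresented G₁] [IsFinitelyPresented G₂] (q₁ : H →* G₁) (q₂ : H →* G₂)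
    (hq₁ : Function.Surjective q₁) (hq₂ : Function.Surjective q₂)
    (hinj : ∀ h, q₁ h = 1 → q₂ h = 1 → h = 1)
    (θ : H →* Q) (hθ : ∀ h, θ h = 1 → ∃ a b, q₂ a = 1 ∧ q₁ b = 1 ∧ h = a * b)
    (X Y S : Set H) (hXf : X.Finite) (hYf : Y.Finite) (hSf : S.Finite)
    (hX2 : ∀ x ∈ X, q₂ x = 1) (hY1 : ∀ y ∈ Y, q₁ y = 1) (t r : H)
    (hSinv : ∀ s ∈ S, s⁻¹ ∈ S)
    (hgenθ : ∀ h, ∃ d ∈ closure (S ∪ {t, r}), θ d = θ h)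
    (X₁ : Set G₁) (Y₂ : Set G₂) (hX₁ : q₁ '' X = X₁) (hY₂ : q₂ '' Y = Y₂)
    (hN1 : ∀ h, q₂ h = 1 → q₁ h ∈
      closure {z | ∃ g ∈ closure (q₁ '' (S ∪ {t, r})), ∃ x ∈ X₁, z = g * x * g⁻¹})
    (hN2 : ∀ h, q₁ h = 1 → q₂ h ∈
      closure {z | ∃ g ∈ closure (q₂ '' (S ∪ {t, r})), ∃ y ∈ Y₂, z = g * y * g⁻¹})
    (N c ℓ : ℕ) (hc : 1 ≤ c) (hN : c + ℓ * c + 1 ≤ N)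
    (hSt1 : ∀ s ∈ S, q₁ s * q₁ t * (q₁ s)⁻¹ * (q₁ t)⁻¹ ∈ X₁)
    (hSt2 : ∀ s ∈ S, q₂ s * q₂ t * (q₂ s)⁻¹ * (q₂ t)⁻¹ ∈ Y₂)
    (hSY : ∀ s ∈ S, ∀ y ∈ Y₂, q₂ s * y * (q₂ s)⁻¹ ∈ Bint (q₂ t) Y₂ (-c) c)
    (τ₂ : G₂) (hτ2 : q₂ r = τ₂ * q₂ t ^ (N : ℤ))
    (hτY : ∀ y ∈ Y₂, τ₂ * y * τ₂⁻¹ ∈ Bint (q₂ t) Y₂ (-c) c)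
    (hτY' : ∀ y ∈ Y₂, τ₂⁻¹ * y * τ₂ ∈ Bint (q₂ t) Y₂ (-c) c)
    (hτt1 : q₁ r * q₁ t * (q₁ r)⁻¹ * (q₁ t)⁻¹ ∈ X₁)
    (hτt2 : τ₂ * q₂ t * τ₂⁻¹ * (q₂ t)⁻¹ ∈ Y₂)
    (hτt1' : (q₁ r)⁻¹ * q₁ t * q₁ r * (q₁ t)⁻¹ ∈ X₁)
    (hτt2' : τ₂⁻¹ * q₂ t * τ₂ * (q₂ t)⁻¹ ∈ Y₂)
    (hrX : ∀ x ∈ X₁, q₁ r * x * (q₁ r)⁻¹ ∈ closure (Wset (q₁ '' (S ∪ {t, t⁻¹})) X₁ ℓ))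
    (hrX' : ∀ x ∈ X₁, (q₁ r)⁻¹ * x * q₁ r ∈ closure (Wset (q₁ '' (S ∪ {t, t⁻¹})) X₁ ℓ)) :
    IsFinitelyPresented H := by
  subst hX₁ hY₂
  obtain ⟨hgen, hnX, hnY⟩ := core_gen q₁ q₂ hinj θ hθ X Y (S ∪ {t, r}) hX2 hY1 hgenθ hN1 hN2
  have hτ2' : q₂ (r * t ^ (-N : ℤ)) = τ₂ := by rw [map_mul, map_zpow, hτ2]; group
  -- equality in H
  have heq : ∀ a b : H, q₁ a = q₁ b → q₂ a = q₂ b → a = b := by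
    intro a b h1 h2
    rw [← mul_inv_eq_one]
    exact hinj _ (by rw [map_mul, map_inv, h1, mul_inv_cancel]) (by rw [map_mul, map_inv, h2, mul_inv_cancel])
  have hB : ∀ z : H, q₁ z = 1 → q₂ z ∈ Bint (q₂ t) (q₂ '' Y) (-c) c → z ∈ Bint t Y (-c) c := by
    intro z hz1 hz2
    rw [← image_Bset] at hz2
    refine lift_closure q₂ q₁ (fun h h1 h2 => hinj h h2 h1) ?_ hz1 hz2
    rintro _ ⟨b, _, _, y, hy, rfl⟩
    rw [map_mul, map_mul, hY1 y hy, map_zpow, map_zpow]; simp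
  have hW : ∀ z : H, q₂ z = 1 → q₁ z ∈ closure (Wset (q₁ '' (S ∪ {t, t⁻¹})) (q₁ '' X) ℓ) →
      z ∈ closure (Wset (S ∪ {t, t⁻¹}) X ℓ) := by
    intro z hz2 hz1
    refine lift_closure q₁ q₂ hinj ?_ hz2 ?_
    · rintro _ ⟨g, _, x, hx, rfl⟩
      rw [map_mul, map_mul, hX2 x hx, map_inv]; simp
    · rw [image_Wset]; exact hz1
  refine fp_of_comm q₁ q₂ hq₁ hq₂ hinj θ hθ X Y (S ∪ {t, r}) hXf hYf
    (hSf.union ((Set.finite_singleton _).insert _)) hgen hnX hnY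
    (comm_transfer X Y S hXf hYf hSf t r N c ℓ hc hN hSinv ?_ ?_ ?_ ?_ ?_ ?_ ?_ ?_ ?_)
  · intro s hs
    obtain ⟨u, hu, hu'⟩ := hSt1 s hs
    obtain ⟨w, hw, hw'⟩ := hSt2 s hs
    refine ⟨w, hw, u, hu, heq _ _ ?_ ?_⟩
    · simp only [map_mul, map_inv, hY1 w hw, hu']; group
    · simp only [map_mul, map_inv, hX2 u hu, hw']; group
  · intro s hs y hy
    apply hB
    · simp [hY1 y hy]
    · simpa using hSY s hs _ ⟨y, hy, rfl⟩
  · intro y hy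
    apply hB
    · rw [map_mul, map_mul, hY1 y hy, map_inv]; group
    · rw [map_mul, map_mul, map_inv, hτ2']; exact hτY _ ⟨y, hy, rfl⟩
  · intro y hy
    apply hB
    · rw [map_mul, map_mul, hY1 y hy, map_inv]; group
    · rw [map_mul, map_mul, map_inv, hτ2']; exact hτY' _ ⟨y, hy, rfl⟩
  · obtain ⟨u, hu, hu'⟩ := hτt1
    obtain ⟨w, hw, hw'⟩ := hτt2
    refine ⟨w, hw, u, hu, heq _ _ ?_ ?_⟩
    · simp only [map_mul, map_inv, map_zpow, hY1 w hw, hu']; group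
    · rw [map_mul, map_mul, map_inv, hτ2']
      simp only [map_mul, hX2 u hu, hw']; group
  · obtain ⟨u, hu, hu'⟩ := hτt1'
    obtain ⟨w, hw, hw'⟩ := hτt2'
    refine ⟨w, hw, u, hu, heq _ _ ?_ ?_⟩
    · simp only [map_mul, map_inv, map_zpow, hY1 w hw, hu']; group
    · rw [map_mul, map_mul, map_inv, hτ2']
      simp only [map_mul, map_zpow, hX2 u hu, hw']; group
  · intro x hx
    apply hW
    · simp [hX2 x hx]
    · simpa using hrX _ ⟨x, hx, rfl⟩
  · intro x hx
    apply hW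
    · simp [hX2 x hx]
    · simpa using hrX' _ ⟨x, hx, rfl⟩
  · intro x hx y hy i _
    apply heq
    · simp [hY1 y hy]
    · simp [hX2 x hx]
end Core
end FibProd

namespace FibProd
open Group Subgroup

section Side
variable {G : Type*} [Group G]

def mkHom {V : Type*} [AddCommGroup V] (φ : G → V) (hφ : ∀ x y, φ (x * y) = φ x + φ y) :
    G →* Multiplicative V :=
  MonoidHom.mk' (fun g => Multiplicative.ofAdd (φ g)) (fun x y => by rw [hφ, ofAdd_add])

theorem mkHom_eq {V : Type*} [AddCommGroup V] (φ : G → V) (hφ : ∀ x y, φ (x * y) = φ x + φ y) (x y : G) :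
    mkHom φ hφ x = mkHom φ hφ y ↔ φ x = φ y := Iff.rfl

theorem add_one {V : Type*} [AddCommGroup V] {φ : G → V} (hφ : ∀ x y, φ (x * y) = φ x + φ y) : φ 1 = 0 := by
  have := hφ 1 1; simpa using this

theorem add_inv {V : Type*} [AddCommGroup V] {φ : G → V} (hφ : ∀ x y, φ (x * y) = φ x + φ y) (x : G) :
    φ x⁻¹ = - φ x := by
  have := hφ x x⁻¹; rw [mul_inv_cancel, add_one hφ] at this
  exact (neg_eq_of_add_eq_zero_right this.symm).symm

theorem add_zpow' {V : Type*} [AddCommGroup V] {φ : G → V} (hφ : ∀ x y, φ (x * y) = φ x + φ y) (x : G) (n : ℤ) :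
    φ (x ^ n) = n • φ x :=
  congrArg Multiplicative.toAdd (map_zpow (mkHom φ hφ) x n)

theorem hlp {K Q : Type*} [Group K] [Group Q] [hK : Group.FG K] [IsFinitelyPresented Q] (p : K →* Q)
    (hp : Function.Surjective p) (D : Subgroup K) (hD : ∀ k, ∃ d ∈ D, p d = p k) :
    ∃ X : Set K, X.Finite ∧ (∀ x ∈ X, p x = 1) ∧
      ∀ k, p k = 1 → k ∈ closure {z | ∃ d ∈ D, ∃ x ∈ X, z = d * x * d⁻¹} := by
  classical
  obtain ⟨A, hA⟩ := hK.out
  obtain ⟨X₂, hX₂f, hX₂⟩ : ∃ X₂ : Set K, X₂.Finite ∧ normalClosure X₂ = p.ker := by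
    obtain ⟨X₂, h1, h2⟩ := ker_nfg p hp
    exact ⟨X₂, h1, h2⟩
  choose d hdD hd using hD
  refine ⟨(fun k => (d k)⁻¹ * k) '' A ∪ X₂, (A.finite_toSet.image _).union hX₂f, ?_, ?_⟩
  · rintro _ (⟨k, _, rfl⟩ | hx)
    · rw [map_mul, map_inv, hd, inv_mul_cancel]
    · have : _ ∈ p.ker := hX₂ ▸ subset_normalClosure hx
      exact this
  · set X := (fun k => (d k)⁻¹ * k) '' A ∪ X₂ with hX
    set P := closure {z | ∃ d ∈ D, ∃ x ∈ X, z = d * x * d⁻¹} with hP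
    have hXP : ∀ x ∈ X, x ∈ P := fun x hx => subset_closure ⟨1, one_mem _, x, hx, by simp⟩
    have hDP : ∀ e ∈ D, ∀ z ∈ P, e * z * e⁻¹ ∈ P := by
      intro e he
      apply conj_closure_le
      rintro _ ⟨d, hd, x, hx, rfl⟩
      exact subset_closure ⟨e * d, mul_mem he hd, x, hx, by group⟩
    let R : Subgroup K :=
      { carrier := {g | (∀ z ∈ P, g * z * g⁻¹ ∈ P) ∧ ∀ z ∈ P, g⁻¹ * z * g ∈ P}
        one_mem' := by simp
        mul_mem' := by
          rintro a b ⟨ha, ha'⟩ ⟨hb, hb'⟩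
          refine ⟨fun z hz => ?_, fun z hz => ?_⟩
          · have := ha _ (hb z hz)
            convert this using 1; group
          · have := hb' _ (ha' z hz)
            convert this using 1; group
        inv_mem' := by
          rintro a ⟨ha, ha'⟩
          exact ⟨by simpa using ha', by simpa using ha⟩ }
    have hRD : D ≤ R := fun e he => ⟨hDP e he, by simpa using hDP e⁻¹ (inv_mem he)⟩
    have hRP : P ≤ R := fun e he => ⟨fun z hz => mul_mem (mul_mem he hz) (inv_mem he),
      fun z hz => mul_mem (mul_mem (inv_mem he) hz) he⟩
    have hR : R = ⊤ := by
      rw [eq_top_iff, ← hA, closure_le]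
      intro a ha
      have : a = d a * ((d a)⁻¹ * a) := by group
      rw [this]
      exact R.mul_mem (hRD (hdD a)) (hRP (hXP _ (Or.inl ⟨a, ha, rfl⟩)))
    have hPn : P.Normal := ⟨fun z hz g => by
      have : g ∈ R := hR ▸ Subgroup.mem_top g
      exact this.1 z hz⟩
    intro k hk
    have h1 : normalClosure X₂ ≤ P := normalClosure_le_normal (fun x hx => hXP x (Or.inr hx))
    rw [hX₂] at h1
    exact h1 hk

/-- relative version -/
theorem hlp' {V : Type*} [AddCommGroup V] [AddGroup.FG V] (φ : G → V)
    (hφ : ∀ x y, φ (x * y) = φ x + φ y) (K D : Subgroup G) (hK : K.FG) (hDK : D ≤ K)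
    (hD : ∀ k ∈ K, ∃ d ∈ D, φ d = φ k) :
    ∃ X : Set G, X.Finite ∧ (∀ x ∈ X, x ∈ K ∧ φ x = 0) ∧
      ∀ k ∈ K, φ k = 0 → k ∈ closure {z | ∃ d ∈ D, ∃ x ∈ X, z = d * x * d⁻¹} := by
  haveI : Group.FG K := (Group.fg_iff_subgroup_fg K).2 hK
  let f : K →* Multiplicative V := (mkHom φ hφ).comp K.subtype
  haveI : Group.FG f.range := (Group.fg_iff_subgroup_fg _).2 (fg_subgroup_comm _)
  haveI : IsFinitelyPresented f.range := fp_of_comm_fg _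
  have hf1 : ∀ k, f.rangeRestrict k = 1 ↔ φ k = 0 := fun k => by
    rw [Subtype.ext_iff]; rfl
  obtain ⟨X, hXf, hX, hk⟩ := hlp f.rangeRestrict f.rangeRestrict_surjective (D.subgroupOf K) (by
    intro k
    obtain ⟨d, hd, h⟩ := hD k k.2
    exact ⟨⟨d, hDK hd⟩, hd, Subtype.ext h⟩)
  refine ⟨(fun x : K => (x : G)) '' X, hXf.image _, ?_, ?_⟩
  · rintro _ ⟨x, hx, rfl⟩
    exact ⟨x.2, (hf1 x).1 (hX x hx)⟩
  · intro k hkK hk0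
    have h1 := hk ⟨k, hkK⟩ ((hf1 _).2 hk0)
    have h2 : (k : G) ∈ (closure {z | ∃ d ∈ D.subgroupOf K, ∃ x ∈ X, z = d * x * d⁻¹}).map K.subtype :=
      ⟨_, h1, rfl⟩
    rw [MonoidHom.map_closure] at h2
    refine Subgroup.closure_mono ?_ h2
    rintro _ ⟨_, ⟨d, hd, x, hx, rfl⟩, rfl⟩
    exact ⟨d, hd, x, ⟨x, hx, rfl⟩, by simp⟩

/-- lifts of basis vectors -/
theorem gen_lift {n : ℕ} (φ : G → (Fin n → ℤ)) (hφ : ∀ x y, φ (x * y) = φ x + φ y)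
    (g : Fin n → G) (hg : ∀ i, φ (g i) = Pi.single i 1) (J : Set (Fin n)) (u : Fin n → ℤ)
    (hu : ∀ i, i ∉ J → u i = 0) : ∃ d ∈ closure (g '' J), φ d = u := by
  classical
  have key : ∀ F : Finset (Fin n), ∃ d ∈ closure (g '' J), φ d = ∑ i ∈ F, Pi.single i (u i) := by
    intro F
    induction F using Finset.induction_on with
    | empty => exact ⟨1, one_mem _, by rw [add_one hφ]; simp⟩
    | insert i F hi ih =>
      obtain ⟨d, hd, h⟩ := ih
      by_cases hiJ : i ∈ J
      · refine ⟨g i ^ u i * d, mul_mem (zpow_mem (Subgroup.subset_closure (Set.mem_image_of_mem g hiJ)) _) hd, ?_⟩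
        rw [hφ, add_zpow' hφ, hg, h, Finset.sum_insert hi]
        congr 1
        rw [← Pi.single_smul]; simp
      · refine ⟨d, hd, ?_⟩
        rw [h, Finset.sum_insert hi, hu i hiJ]; simp
  obtain ⟨d, hd, h⟩ := key Finset.univ
  exact ⟨d, hd, by rw [h, Finset.univ_sum_single]⟩

/-- directed unions of closures -/
theorem closure_directed (A : ℕ → Set G) (hA : Monotone A) {z : G} (hz : z ∈ closure (⋃ n, A n)) :
    ∃ n, z ∈ closure (A n) := by
  induction hz using Subgroup.closure_induction with
  | mem x hx =>
    obtain ⟨n, hn⟩ := Set.mem_iUnion.1 hx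
    exact ⟨n, subset_closure hn⟩
  | one => exact ⟨0, one_mem _⟩
  | mul x y _ _ hx hy =>
    obtain ⟨n, hn⟩ := hx
    obtain ⟨m, hm⟩ := hy
    exact ⟨max n m, mul_mem (Subgroup.closure_mono (hA (le_max_left _ _)) hn)
      (Subgroup.closure_mono (hA (le_max_right _ _)) hm)⟩
  | inv x _ hx =>
    obtain ⟨n, hn⟩ := hx
    exact ⟨n, inv_mem hn⟩

theorem finite_directed (A : ℕ → Set G) (hA : Monotone A) (Z : Set G) (hZ : Z.Finite)
    (h : ∀ z ∈ Z, z ∈ closure (⋃ n, A n)) : ∃ n, ∀ z ∈ Z, z ∈ closure (A n) := by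
  have h' : ∀ z ∈ Z, ∃ n, z ∈ closure (A n) := fun z hz => closure_directed A hA (h z hz)
  choose! n hn using h'
  obtain ⟨b, hb⟩ := (hZ.image n).bddAbove
  exact ⟨b, fun z hz => Subgroup.closure_mono (hA (hb ⟨z, hz, rfl⟩)) (hn z hz)⟩

theorem mem_WL_of_closure (S : Set G) (hS : ∀ s ∈ S, s⁻¹ ∈ S) {g : G} (hg : g ∈ closure S) :
    ∃ n, g ∈ WL S n := by
  induction hg using Subgroup.closure_induction_right with
  | one => exact ⟨0, rfl⟩
  | mul_right x hx y hy ih =>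
    obtain ⟨n, hn⟩ := ih
    exact ⟨n+1, Or.inl ⟨x, hn, y, hy, rfl⟩⟩
  | mul_inv_cancel x hx y hy ih =>
    obtain ⟨n, hn⟩ := ih
    exact ⟨n+1, Or.inl ⟨x, hn, y⁻¹, hS y hy, rfl⟩⟩

end Side
end FibProd

namespace FibProd
open Group Subgroup

section Side
variable {G : Type*} [Group G]

theorem bound_W (S X : Set G) (hS : ∀ s ∈ S, s⁻¹ ∈ S) (Z : Set G) (hZ : Z.Finite)
    (h : ∀ z ∈ Z, z ∈ closure {z | ∃ d ∈ closure S, ∃ x ∈ X, z = d * x * d⁻¹}) :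
    ∃ ℓ : ℕ, ∀ z ∈ Z, z ∈ closure (Wset S X ℓ) := by
  refine finite_directed (fun n => Wset S X n) ?_ Z hZ ?_
  · rintro a b hab z ⟨g, hg, x, hx, rfl⟩
    exact ⟨g, WL_le hab hg, x, hx, rfl⟩
  · intro z hz
    refine Subgroup.closure_mono ?_ (h z hz)
    rintro _ ⟨d, hd, x, hx, rfl⟩
    obtain ⟨n, hn⟩ := mem_WL_of_closure S hS hd
    exact Set.mem_iUnion.2 ⟨n, d, hn, x, hx, rfl⟩

theorem bound_B (t : G) (Y : Set G) (Z : Set G) (hZ : Z.Finite)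
    (h : ∀ z ∈ Z, z ∈ closure {z | ∃ d ∈ closure {t}, ∃ x ∈ Y, z = d * x * d⁻¹}) :
    ∃ c : ℕ, ∀ z ∈ Z, z ∈ Bint t Y (-c) c := by
  refine finite_directed (fun n : ℕ => Bset t Y (-n) n) ?_ Z hZ ?_
  · rintro a b hab z ⟨k, hk1, hk2, x, hx, rfl⟩
    have : (a : ℤ) ≤ b := by exact_mod_cast hab
    exact ⟨k, by omega, by omega, x, hx, rfl⟩
  · intro z hz
    refine Subgroup.closure_mono ?_ (h z hz)
    rintro _ ⟨d, hd, x, hx, rfl⟩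
    obtain ⟨k, rfl⟩ := Subgroup.mem_closure_singleton.1 hd
    refine Set.mem_iUnion.2 ⟨k.natAbs, k, by omega, by omega, x, hx, by simp⟩

/-- the symmetric set of lifts of the last coordinates -/
def Sset {m : ℕ} (g : Fin (m+2) → G) : Set G :=
  {z | ∃ i : Fin m, z = g i.succ.succ ∨ z = (g i.succ.succ)⁻¹}

theorem Sset_finite {m : ℕ} (g : Fin (m+2) → G) : (Sset g).Finite := by
  refine ((Set.finite_range (fun i : Fin m => g i.succ.succ)).union
    (Set.finite_range (fun i : Fin m => (g i.succ.succ)⁻¹))).subset ?_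
  rintro z ⟨i, rfl | rfl⟩
  · exact Or.inl ⟨i, rfl⟩
  · exact Or.inr ⟨i, rfl⟩

theorem Sset_inv {m : ℕ} (g : Fin (m+2) → G) : ∀ s ∈ Sset g, s⁻¹ ∈ Sset g := by
  rintro z ⟨i, rfl | rfl⟩
  · exact ⟨i, Or.inr rfl⟩
  · exact ⟨i, Or.inl (by simp)⟩

theorem side1 {m : ℕ} (φ : G → (Fin (m+2) → ℤ)) (hφ : ∀ x y, φ (x * y) = φ x + φ y)
    (g : Fin (m+2) → G) (hg : ∀ i, φ (g i) = Pi.single i 1) (K : Subgroup G) (hK : K.FG)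
    (hKm : ∀ x, x ∈ K ↔ φ x 0 = 0) :
    ∃ X : Set G, X.Finite ∧ (∀ x ∈ X, φ x = 0) ∧
      (∀ n, φ n = 0 → n ∈ closure {z | ∃ d ∈ closure (Sset g ∪ {g 1, (g 1)⁻¹}), ∃ x ∈ X, z = d * x * d⁻¹}) ∧
      (∀ s ∈ Sset g, s * g 1 * s⁻¹ * (g 1)⁻¹ ∈ X) ∧
      g 0 * g 1 * (g 0)⁻¹ * (g 1)⁻¹ ∈ X ∧ (g 0)⁻¹ * g 1 * g 0 * (g 1)⁻¹ ∈ X ∧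
      ∃ ℓ : ℕ, (∀ x ∈ X, g 0 * x * (g 0)⁻¹ ∈ closure (Wset (Sset g ∪ {g 1, (g 1)⁻¹}) X ℓ)) ∧
        (∀ x ∈ X, (g 0)⁻¹ * x * g 0 ∈ closure (Wset (Sset g ∪ {g 1, (g 1)⁻¹}) X ℓ)) := by
  set T : Set G := Sset g ∪ {g 1, (g 1)⁻¹} with hT
  have hTinv : ∀ s ∈ T, s⁻¹ ∈ T := by
    rintro s (hs | hs | hs)
    · exact Or.inl (Sset_inv g s hs)
    · subst hs; exact Or.inr (Or.inr rfl)
    · rw [Set.mem_singleton_iff] at hs; subst hs; exact Or.inr (Or.inl (by simp))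
  have hDK : closure T ≤ K := by
    rw [closure_le]
    have hgK : ∀ i : Fin (m+1), g i.succ ∈ K := fun i => by rw [hKm, hg]; simp
    rintro s (⟨i, rfl | rfl⟩ | hs | hs)
    · exact hgK _
    · exact inv_mem (hgK _)
    · subst hs; exact hgK 0
    · rw [Set.mem_singleton_iff] at hs; subst hs; exact inv_mem (hgK 0)
  have hgT : g '' {i | i ≠ 0} ⊆ T := by
    rintro _ ⟨i, hi, rfl⟩
    obtain ⟨j, rfl⟩ := Fin.exists_succ_eq.2 hi
    induction j using Fin.cases with
    | zero => exact Or.inr (Or.inl rfl)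
    | succ j => exact Or.inl ⟨j, Or.inl rfl⟩
  obtain ⟨X₀, hX₀f, hX₀, hgen⟩ := hlp' φ hφ K (closure T) hK hDK (by
    intro k hk
    obtain ⟨d, hd, h⟩ := gen_lift φ hφ g hg {i | i ≠ 0} (φ k) (by
      intro i hi
      have : i = 0 := by simpa using hi
      rw [this]; exact (hKm k).1 hk)
    exact ⟨d, Subgroup.closure_mono hgT hd, h⟩)
  let C : Set G := (fun s => s * g 1 * s⁻¹ * (g 1)⁻¹) '' Sset g
  let P : Set G := {g 0 * g 1 * (g 0)⁻¹ * (g 1)⁻¹, (g 0)⁻¹ * g 1 * g 0 * (g 1)⁻¹}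
  have hXf : (X₀ ∪ C ∪ P).Finite := (hX₀f.union ((Sset_finite g).image _)).union (by simp [P])
  have hX0 : ∀ x ∈ X₀ ∪ C ∪ P, φ x = 0 := by
    rintro x ((hx | ⟨s, hs, rfl⟩) | hx)
    · exact (hX₀ x hx).2
    · simp only [hφ, add_inv hφ]; abel
    · rcases hx with rfl | rfl <;> simp only [hφ, add_inv hφ] <;> abel
  have hgen' : ∀ n, φ n = 0 → n ∈ closure {z | ∃ d ∈ closure T, ∃ x ∈ X₀ ∪ C ∪ P, z = d * x * d⁻¹} := by
    intro n hn
    refine Subgroup.closure_mono ?_ (hgen n ((hKm n).2 (by rw [hn]; rfl)) hn)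
    rintro _ ⟨d, hd, x, hx, rfl⟩
    exact ⟨d, hd, x, Or.inl (Or.inl hx), rfl⟩
  refine ⟨X₀ ∪ C ∪ P, hXf, hX0, hgen', fun s hs => Or.inl (Or.inr ⟨s, hs, rfl⟩), Or.inr (Or.inl rfl),
    Or.inr (Or.inr rfl), ?_⟩
  obtain ⟨ℓ, hℓ⟩ := bound_W T (X₀ ∪ C ∪ P) hTinv
    ((fun x => g 0 * x * (g 0)⁻¹) '' (X₀ ∪ C ∪ P) ∪ (fun x => (g 0)⁻¹ * x * g 0) '' (X₀ ∪ C ∪ P))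
    ((hXf.image _).union (hXf.image _)) (by
      rintro z (⟨x, hx, rfl⟩ | ⟨x, hx, rfl⟩)
      · apply hgen'; simp only [hφ, add_inv hφ, hX0 x hx]; abel
      · apply hgen'; simp only [hφ, add_inv hφ, hX0 x hx]; abel)
  exact ⟨ℓ, fun x hx => hℓ _ (Or.inl ⟨x, hx, rfl⟩), fun x hx => hℓ _ (Or.inr ⟨x, hx, rfl⟩)⟩

theorem side2 {m : ℕ} (φ : G → (Fin (m+2) → ℤ)) (hφ : ∀ x y, φ (x * y) = φ x + φ y)
    (g : Fin (m+2) → G) (hg : ∀ i, φ (g i) = Pi.single i 1) (K : Subgroup G) (hK : K.FG)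
    (hKm : ∀ x, x ∈ K ↔ ∀ i : Fin (m+1), φ x i.succ = 0) :
    ∃ Y : Set G, Y.Finite ∧ (∀ x ∈ Y, φ x = 0) ∧
      (∀ n, φ n = 0 → n ∈ closure {z | ∃ d ∈ closure {g 0}, ∃ x ∈ Y, z = d * x * d⁻¹}) ∧
      (∀ s ∈ Sset g, s * g 0 * s⁻¹ * (g 0)⁻¹ ∈ Y) ∧
      g 1 * g 0 * (g 1)⁻¹ * (g 0)⁻¹ ∈ Y ∧ (g 1)⁻¹ * g 0 * g 1 * (g 0)⁻¹ ∈ Y ∧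
      ∃ c : ℕ, 1 ≤ c ∧ (∀ s ∈ Sset g, ∀ y ∈ Y, s * y * s⁻¹ ∈ Bint (g 0) Y (-c) c) ∧
        (∀ x ∈ Y, g 1 * x * (g 1)⁻¹ ∈ Bint (g 0) Y (-c) c) ∧
        (∀ x ∈ Y, (g 1)⁻¹ * x * g 1 ∈ Bint (g 0) Y (-c) c) := by
  have hDK : closure {g 0} ≤ K := by
    rw [closure_le]
    rintro s hs
    rw [Set.mem_singleton_iff] at hs; subst hs
    rw [SetLike.mem_coe, hKm]; intro i; rw [hg]; simp
  obtain ⟨X₀, hX₀f, hX₀, hgen⟩ := hlp' φ hφ K (closure {g 0}) hK hDK (by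
    intro k hk
    obtain ⟨d, hd, h⟩ := gen_lift φ hφ g hg {0} (φ k) (by
      intro i hi
      obtain ⟨j, rfl⟩ := Fin.exists_succ_eq.2 (show i ≠ 0 by simpa using hi)
      exact (hKm k).1 hk j)
    exact ⟨d, by simpa using hd, h⟩)
  let C : Set G := (fun s => s * g 0 * s⁻¹ * (g 0)⁻¹) '' Sset g
  let P : Set G := {g 1 * g 0 * (g 1)⁻¹ * (g 0)⁻¹, (g 1)⁻¹ * g 0 * g 1 * (g 0)⁻¹}
  have hXf : (X₀ ∪ C ∪ P).Finite := (hX₀f.union ((Sset_finite g).image _)).union (by simp [P])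
  have hX0 : ∀ x ∈ X₀ ∪ C ∪ P, φ x = 0 := by
    rintro x ((hx | ⟨s, hs, rfl⟩) | hx)
    · exact (hX₀ x hx).2
    · simp only [hφ, add_inv hφ]; abel
    · rcases hx with rfl | rfl <;> simp only [hφ, add_inv hφ] <;> abel
  have hgen' : ∀ n, φ n = 0 → n ∈ closure {z | ∃ d ∈ closure {g 0}, ∃ x ∈ X₀ ∪ C ∪ P, z = d * x * d⁻¹} := by
    intro n hn
    refine Subgroup.closure_mono ?_ (hgen n ((hKm n).2 (by rw [hn]; intro i; rfl)) hn)
    rintro _ ⟨d, hd, x, hx, rfl⟩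
    exact ⟨d, hd, x, Or.inl (Or.inl hx), rfl⟩
  refine ⟨X₀ ∪ C ∪ P, hXf, hX0, hgen', fun s hs => Or.inl (Or.inr ⟨s, hs, rfl⟩), Or.inr (Or.inl rfl),
    Or.inr (Or.inr rfl), ?_⟩
  set Y := X₀ ∪ C ∪ P
  obtain ⟨c, hc⟩ := bound_B (g 0) Y
    (Set.image2 (fun s x => s * x * s⁻¹) (Sset g) Y ∪
      ((fun x => g 1 * x * (g 1)⁻¹) '' Y ∪ (fun x => (g 1)⁻¹ * x * g 1) '' Y))
    ((Set.Finite.image2 _ (Sset_finite g) hXf).union ((hXf.image _).union (hXf.image _))) (by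
      rintro z (⟨s, hs, x, hx, rfl⟩ | ⟨x, hx, rfl⟩ | ⟨x, hx, rfl⟩)
      · apply hgen'; simp only [hφ, add_inv hφ, hX0 x hx]; abel
      · apply hgen'; simp only [hφ, add_inv hφ, hX0 x hx]; abel
      · apply hgen'; simp only [hφ, add_inv hφ, hX0 x hx]; abel)
  have hmono : Bint (g 0) Y (-c) c ≤ Bint (g 0) Y (-(c+1 : ℕ)) (c+1 : ℕ) :=
    Bint_mono (by push_cast; omega) (by push_cast; omega)
  exact ⟨c+1, by omega, fun s hs y hy => hmono (hc _ (Or.inl ⟨s, hs, y, hy, rfl⟩)),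
    fun x hx => hmono (hc _ (Or.inr (Or.inl ⟨x, hx, rfl⟩))),
    fun x hx => hmono (hc _ (Or.inr (Or.inr ⟨x, hx, rfl⟩)))⟩

end Side
end FibProd

namespace FibProd
open Group Subgroup

section Fib
variable {G₁ G₂ : Type*} [Group G₁] [Group G₂]

/-- fibre product of additive functions -/
def fib {V : Type*} [AddCommGroup V] (φ₁ : G₁ → V) (φ₂ : G₂ → V)
    (h₁ : ∀ x y, φ₁ (x * y) = φ₁ x + φ₁ y) (h₂ : ∀ x y, φ₂ (x * y) = φ₂ x + φ₂ y) :
    Subgroup (G₁ × G₂) where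
  carrier := {x | φ₁ x.1 = φ₂ x.2}
  one_mem' := by
    change φ₁ 1 = φ₂ 1
    rw [add_one h₁, add_one h₂]
  mul_mem' := by
    intro a b ha hb
    change φ₁ a.1 = φ₂ a.2 at ha
    change φ₁ b.1 = φ₂ b.2 at hb
    change φ₁ (a.1 * b.1) = φ₂ (a.2 * b.2)
    rw [h₁, h₂, ha, hb]
  inv_mem' := by
    intro a ha
    change φ₁ a.1 = φ₂ a.2 at ha
    change φ₁ a.1⁻¹ = φ₂ a.2⁻¹
    rw [add_inv h₁, add_inv h₂, ha]

theorem mem_fib {V : Type*} [AddCommGroup V] {φ₁ : G₁ → V} {φ₂ : G₂ → V}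
    {h₁ : ∀ x y, φ₁ (x * y) = φ₁ x + φ₁ y} {h₂ : ∀ x y, φ₂ (x * y) = φ₂ x + φ₂ y} {x : G₁ × G₂} :
    x ∈ fib φ₁ φ₂ h₁ h₂ ↔ φ₁ x.1 = φ₂ x.2 := Iff.rfl

section
variable {V : Type*} [AddCommGroup V] (φ₁ : G₁ → V) (φ₂ : G₂ → V)
  (h₁ : ∀ x y, φ₁ (x * y) = φ₁ x + φ₁ y) (h₂ : ∀ x y, φ₂ (x * y) = φ₂ x + φ₂ y)

def fq₁ : fib φ₁ φ₂ h₁ h₂ →* G₁ := (MonoidHom.fst G₁ G₂).comp (fib φ₁ φ₂ h₁ h₂).subtype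
def fq₂ : fib φ₁ φ₂ h₁ h₂ →* G₂ := (MonoidHom.snd G₁ G₂).comp (fib φ₁ φ₂ h₁ h₂).subtype

theorem fq_mem (h : fib φ₁ φ₂ h₁ h₂) : φ₁ (fq₁ φ₁ φ₂ h₁ h₂ h) = φ₂ (fq₂ φ₁ φ₂ h₁ h₂ h) := h.2

theorem fq₁_surj (hs : Function.Surjective φ₂) : Function.Surjective (fq₁ φ₁ φ₂ h₁ h₂) := by
  intro x
  obtain ⟨y, hy⟩ := hs (φ₁ x)
  exact ⟨⟨(x, y), hy.symm⟩, rfl⟩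

theorem fq₂_surj (hs : Function.Surjective φ₁) : Function.Surjective (fq₂ φ₁ φ₂ h₁ h₂) := by
  intro y
  obtain ⟨x, hx⟩ := hs (φ₂ y)
  exact ⟨⟨(x, y), hx⟩, rfl⟩

theorem fq_inj (h : fib φ₁ φ₂ h₁ h₂) (a : fq₁ φ₁ φ₂ h₁ h₂ h = 1) (b : fq₂ φ₁ φ₂ h₁ h₂ h = 1) : h = 1 :=
  Subtype.ext (Prod.ext a b)

theorem fq_split (h : fib φ₁ φ₂ h₁ h₂) (h0 : φ₁ (fq₁ φ₁ φ₂ h₁ h₂ h) = 0) :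
    ∃ a b, fq₂ φ₁ φ₂ h₁ h₂ a = 1 ∧ fq₁ φ₁ φ₂ h₁ h₂ b = 1 ∧ h = a * b := by
  have h0' : φ₂ (fq₂ φ₁ φ₂ h₁ h₂ h) = 0 := by rw [← fq_mem φ₁ φ₂ h₁ h₂, h0]
  refine ⟨⟨(fq₁ φ₁ φ₂ h₁ h₂ h, 1), ?_⟩, ⟨(1, fq₂ φ₁ φ₂ h₁ h₂ h), ?_⟩, rfl, rfl, ?_⟩
  · rw [mem_fib]; simp only; rw [h0, add_one h₂]
  · rw [mem_fib]; simp only; rw [h0', add_one h₁]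
  · apply Subtype.ext
    apply Prod.ext
    · change fq₁ φ₁ φ₂ h₁ h₂ h = _ * 1; simp
    · change fq₂ φ₁ φ₂ h₁ h₂ h = 1 * _; simp

theorem lift_X (X₁ : Set G₁) (hf : X₁.Finite) (h0 : ∀ x ∈ X₁, φ₁ x = 0) :
    ∃ X : Set (fib φ₁ φ₂ h₁ h₂), X.Finite ∧ (∀ x ∈ X, fq₂ φ₁ φ₂ h₁ h₂ x = 1) ∧ fq₁ φ₁ φ₂ h₁ h₂ '' X = X₁ := by
  have hi : (fq₁ φ₁ φ₂ h₁ h₂) '' {h | fq₁ φ₁ φ₂ h₁ h₂ h ∈ X₁ ∧ fq₂ φ₁ φ₂ h₁ h₂ h = 1} = X₁ := by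
    ext x
    constructor
    · rintro ⟨h, hh, rfl⟩; exact hh.1
    · intro hx
      exact ⟨⟨(x, 1), by rw [mem_fib]; simp only; rw [h0 x hx, add_one h₂]⟩, ⟨hx, rfl⟩, rfl⟩
  refine ⟨_, Set.Finite.of_finite_image (by rw [hi]; exact hf) ?_, fun x hx => hx.2, hi⟩
  intro a ha b hb hab
  exact Subtype.ext (Prod.ext hab (ha.2.trans hb.2.symm))

theorem lift_Y (Y₂ : Set G₂) (hf : Y₂.Finite) (h0 : ∀ x ∈ Y₂, φ₂ x = 0) :
    ∃ Y : Set (fib φ₁ φ₂ h₁ h₂), Y.Finite ∧ (∀ x ∈ Y, fq₁ φ₁ φ₂ h₁ h₂ x = 1) ∧ fq₂ φ₁ φ₂ h₁ h₂ '' Y = Y₂ := by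
  have hi : (fq₂ φ₁ φ₂ h₁ h₂) '' {h | fq₂ φ₁ φ₂ h₁ h₂ h ∈ Y₂ ∧ fq₁ φ₁ φ₂ h₁ h₂ h = 1} = Y₂ := by
    ext x
    constructor
    · rintro ⟨h, hh, rfl⟩; exact hh.1
    · intro hx
      exact ⟨⟨(1, x), by rw [mem_fib]; simp only; rw [h0 x hx, add_one h₁]⟩, ⟨hx, rfl⟩, rfl⟩
  refine ⟨_, Set.Finite.of_finite_image (by rw [hi]; exact hf) ?_, fun x hx => hx.2, hi⟩
  intro a ha b hb hab
  exact Subtype.ext (Prod.ext (ha.2.trans hb.2.symm) hab)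
end

/-- the shear -/
def shear {m : ℕ} (N : ℕ) (u : Fin (m+2) → ℤ) : Fin (m+2) → ℤ :=
  Fin.cons (u 1 + N * u 0) (Fin.cons (u 0) (fun j : Fin m => u j.succ.succ) : Fin (m+1) → ℤ)

theorem shear_add {m : ℕ} (N : ℕ) (u v : Fin (m+2) → ℤ) : shear N (u + v) = shear N u + shear N v := by
  funext i
  refine Fin.cases ?_ (fun i => ?_) i
  · simp [shear]; ring
  · refine Fin.cases ?_ (fun i => ?_) i <;> simp [shear]

theorem shear_surj {m : ℕ} (N : ℕ) : Function.Surjective (shear (m := m) N) := by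
  intro v
  refine ⟨Fin.cons (v 1) (Fin.cons (v 0 - N * v 1) (fun j : Fin m => v j.succ.succ) : Fin (m+1) → ℤ), ?_⟩
  funext i
  refine Fin.cases ?_ (fun i => ?_) i
  · have : (1 : Fin (m+2)) = Fin.succ 0 := rfl
    simp only [shear, this, Fin.cons_zero, Fin.cons_succ]; ring
  · refine Fin.cases ?_ (fun i => ?_) i <;> simp [shear]

theorem shear_zero {m : ℕ} (N : ℕ) (u : Fin (m+2) → ℤ) (h : shear N u = 0) : u = 0 := by
  have h0 : u 1 + N * u 0 = 0 := by simpa [shear] using congrFun h 0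
  have h1 : u 0 = 0 := by
    have := congrFun h (Fin.succ 0); simpa [shear] using this
  rw [h1] at h0
  funext i
  refine Fin.cases h1 (fun i => ?_) i
  refine Fin.cases (by simpa using h0) (fun j => ?_) i
  have := congrFun h j.succ.succ; simpa [shear] using this

theorem case_ge_two [IsFinitelyPresented G₁] [IsFinitelyPresented G₂] {m : ℕ}
    (φ₁ : G₁ → (Fin (m+2) → ℤ)) (φ₂ : G₂ → (Fin (m+2) → ℤ))
    (h₁ : ∀ x y, φ₁ (x * y) = φ₁ x + φ₁ y) (h₂ : ∀ x y, φ₂ (x * y) = φ₂ x + φ₂ y)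
    (hs₁ : Function.Surjective φ₁) (hs₂ : Function.Surjective φ₂)
    (K : Subgroup G₁) (hK : K.FG) (hKm : ∀ x, x ∈ K ↔ φ₁ x 0 = 0)
    (M : Subgroup G₂) (hM : M.FG) (hMm : ∀ x, x ∈ M ↔ ∀ i : Fin (m+1), φ₂ x i.succ = 0) :
    ∃ (ψ₁ : G₁ → (Fin (m+2) → ℤ)) (k₁ : ∀ x y, ψ₁ (x * y) = ψ₁ x + ψ₁ y),
      Function.Surjective ψ₁ ∧ IsFinitelyPresented (fib ψ₁ φ₂ k₁ h₂) := by
  choose g hg using fun i : Fin (m+2) => hs₁ (Pi.single i 1)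
  choose k hk using fun i : Fin (m+2) => hs₂ (Pi.single i 1)
  obtain ⟨X₁, hX₁f, hX₁0, hX₁g, hXS, hX01, hX01', ℓ, hℓ, hℓ'⟩ := side1 φ₁ h₁ g hg K hK hKm
  obtain ⟨Y₂, hY₂f, hY₂0, hY₂g, hYS, hY10, hY10', c, hc, hcS, hcτ, hcτ'⟩ := side2 φ₂ h₂ k hk M hM hMm
  set N := c + ℓ * c + 1 with hN
  let ψ₁ : G₁ → (Fin (m+2) → ℤ) := fun x => shear N (φ₁ x)
  have k₁ : ∀ x y, ψ₁ (x * y) = ψ₁ x + ψ₁ y := fun x y => by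
    simp only [ψ₁]; rw [h₁, shear_add]
  have hsψ : Function.Surjective ψ₁ := (shear_surj N).comp hs₁
  refine ⟨ψ₁, k₁, hsψ, ?_⟩
  have hψ0 : ∀ x, ψ₁ x = 0 ↔ φ₁ x = 0 := fun x => by
    constructor
    · exact shear_zero N _
    · intro h
      have : shear N (0 : Fin (m+2) → ℤ) = 0 := by
        have := shear_add N (0 : Fin (m+2) → ℤ) 0
        simpa using this
      simp only [ψ₁]; rw [h, this]
  obtain ⟨X, hXf, hX2, hXX⟩ := lift_X ψ₁ φ₂ k₁ h₂ X₁ hX₁f (fun x hx => (hψ0 x).2 (hX₁0 x hx))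
  obtain ⟨Y, hYf, hY1, hYY⟩ := lift_Y ψ₁ φ₂ k₁ h₂ Y₂ hY₂f hY₂0
  let k' : Fin (m+2) → G₂ := Fin.cons (k 1 * k 0 ^ (N : ℤ)) (Fin.cons (k 0) (fun j : Fin m => k j.succ.succ) : Fin (m+1) → G₂)
  have hmem : ∀ i, (g i, k' i) ∈ fib ψ₁ φ₂ k₁ h₂ := by
    intro i
    rw [mem_fib]
    change shear N (φ₁ (g i)) = φ₂ (k' i)
    rw [hg]
    refine Fin.cases ?_ (fun i => ?_) i
    · simp only [k', Fin.cons_zero]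
      rw [h₂, add_zpow' h₂, hk, hk]
      funext j
      refine Fin.cases ?_ (fun j => ?_) j
      · simp [shear]
      · refine Fin.cases ?_ (fun j => ?_) j <;> simp [shear]
        · simp [Pi.single_apply, Fin.ext_iff]
    · refine Fin.cases ?_ (fun i => ?_) i
      · simp only [k', Fin.cons_zero, Fin.cons_succ]
        rw [hk]
        funext j
        refine Fin.cases ?_ (fun j => ?_) j
        · simp [shear]
        · refine Fin.cases ?_ (fun j => ?_) j <;> simp [shear]
          · simp [Pi.single_apply, Fin.ext_iff]
      · simp only [k', Fin.cons_succ]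
        rw [hk]
        funext j
        refine Fin.cases ?_ (fun j => ?_) j
        · simp [shear, Pi.single_apply, Fin.ext_iff]
        · refine Fin.cases ?_ (fun j => ?_) j <;> simp [shear, Pi.single_apply, Fin.ext_iff]
  let s : Fin (m+2) → fib ψ₁ φ₂ k₁ h₂ := fun i => ⟨(g i, k' i), hmem i⟩
  set q₁ := fq₁ ψ₁ φ₂ k₁ h₂ with hq₁
  set q₂ := fq₂ ψ₁ φ₂ k₁ h₂ with hq₂
  have hS1 : ∀ z ∈ Sset s, q₁ z ∈ Sset g := by
    rintro z ⟨i, rfl | rfl⟩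
    · exact ⟨i, Or.inl rfl⟩
    · exact ⟨i, Or.inr rfl⟩
  have hS2 : ∀ z ∈ Sset s, q₂ z ∈ Sset k := by
    rintro z ⟨i, rfl | rfl⟩
    · exact ⟨i, Or.inl rfl⟩
    · exact ⟨i, Or.inr rfl⟩
  have hS1' : Sset g ⊆ q₁ '' Sset s := by
    rintro z ⟨i, rfl | rfl⟩
    · exact ⟨s i.succ.succ, ⟨i, Or.inl rfl⟩, rfl⟩
    · exact ⟨(s i.succ.succ)⁻¹, ⟨i, Or.inr rfl⟩, rfl⟩
  have hT1 : q₁ '' (Sset s ∪ {s 1, (s 1)⁻¹}) = Sset g ∪ {g 1, (g 1)⁻¹} := by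
    rw [Set.image_union, Set.image_pair]
    congr 1
    refine Set.Subset.antisymm ?_ hS1'
    rintro _ ⟨z, hz, rfl⟩; exact hS1 z hz
  have hq1t : q₁ (s 1) = g 1 := rfl
  have hq1r : q₁ (s 0) = g 0 := rfl
  have hq2t : q₂ (s 1) = k 0 := rfl
  have hq2r : q₂ (s 0) = k 1 * k 0 ^ (N : ℤ) := rfl
  have hmemq : ∀ h, ψ₁ (q₁ h) = φ₂ (q₂ h) := fun h => fq_mem ψ₁ φ₂ k₁ h₂ h
  let φH : fib ψ₁ φ₂ k₁ h₂ → (Fin (m+2) → ℤ) := fun h => φ₁ (q₁ h)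
  have hφH : ∀ x y, φH (x * y) = φH x + φH y := fun x y => by
    simp only [φH]; rw [map_mul, h₁]
  refine core q₁ q₂ (fq₁_surj ψ₁ φ₂ k₁ h₂ hs₂) (fq₂_surj ψ₁ φ₂ k₁ h₂ hsψ) (fq_inj ψ₁ φ₂ k₁ h₂)
    (mkHom φH hφH) ?_ X Y (Sset s) hXf hYf (Sset_finite s) hX2 hY1 (s 1) (s 0) (Sset_inv s) ?_ X₁ Y₂ hXX hYY
    ?_ ?_ N c ℓ hc le_rfl ?_ ?_ ?_ (k 1) hq2r ?_ ?_ ?_ ?_ ?_ ?_ ?_ ?_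
  · intro h hh
    exact fq_split ψ₁ φ₂ k₁ h₂ h ((hψ0 _).2 hh)
  · intro h
    obtain ⟨d, hd, h'⟩ := gen_lift φH hφH s hg Set.univ (φH h) (by simp)
    refine ⟨d, Subgroup.closure_mono ?_ hd, h'⟩
    rintro _ ⟨i, -, rfl⟩
    refine Fin.cases ?_ (fun i => ?_) i
    · exact Or.inr (Or.inr rfl)
    · refine Fin.cases ?_ (fun i => ?_) i
      · exact Or.inr (Or.inl rfl)
      · exact Or.inl ⟨i, Or.inl rfl⟩
  · intro h hh
    have h0 : φ₁ (q₁ h) = 0 := (hψ0 _).1 (by rw [hmemq, hh, add_one h₂])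
    refine Subgroup.closure_mono ?_ (hX₁g _ h0)
    rintro _ ⟨d, hd, x, hx, rfl⟩
    refine ⟨d, ?_, x, hx, rfl⟩
    refine (closure_le _).2 ?_ hd
    have ht : g 1 ∈ closure (q₁ '' (Sset s ∪ {s 1, s 0})) :=
      Subgroup.subset_closure ⟨s 1, Or.inr (Or.inl rfl), rfl⟩
    rintro z (hz | hz | hz)
    · obtain ⟨y, hy, rfl⟩ := hS1' hz
      exact Subgroup.subset_closure ⟨y, Or.inl hy, rfl⟩
    · subst hz; exact ht
    · rw [Set.mem_singleton_iff] at hz; subst hz; exact inv_mem ht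
  · intro h hh
    have h0 : φ₂ (q₂ h) = 0 := by rw [← hmemq, hh, add_one k₁]
    refine Subgroup.closure_mono ?_ (hY₂g _ h0)
    rintro _ ⟨d, hd, x, hx, rfl⟩
    refine ⟨d, ?_, x, hx, rfl⟩
    refine Subgroup.closure_mono ?_ hd
    rintro z hz
    rw [Set.mem_singleton_iff] at hz; subst hz
    exact ⟨s 1, Or.inr (Or.inl rfl), rfl⟩
  · intro z hz; exact hXS _ (hS1 z hz)
  · intro z hz; exact hYS _ (hS2 z hz)
  · intro z hz y hy; exact hcS _ (hS2 z hz) y hy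
  · exact hcτ
  · exact hcτ'
  · exact hX01
  · exact hY10
  · exact hX01'
  · exact hY10'
  · rw [hT1]; exact hℓ
  · rw [hT1]; exact hℓ'

end Fib
end FibProd

namespace FibProd
open Group Subgroup

theorem asc_commute {Γ : Type*} [Group Γ] (X Y : Set Γ) (t : Γ)
    (hgen : closure (X ∪ Y ∪ {t}) = ⊤)
    (hX : ∀ x ∈ X, t⁻¹ * x * t ∈ closure X) (hY : ∀ y ∈ Y, t⁻¹ * y * t ∈ closure Y)
    (hXY : ∀ x ∈ X, ∀ y ∈ Y, Commute x y) :
    ∀ x ∈ X, ∀ y ∈ Y, ∀ g, Commute x (g * y * g⁻¹) := by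
  have pw : ∀ Z : Set Γ, (∀ z ∈ Z, t⁻¹ * z * t ∈ closure Z) → ∀ n : ℕ, ∀ z ∈ closure Z,
      (t ^ n)⁻¹ * z * t ^ n ∈ closure Z := by
    intro Z hZ n
    induction n with
    | zero => intro z hz; simpa using hz
    | succ n ih =>
      intro z hz
      have h1 := conj_mem_of_closure Z (closure Z) t hZ _ (ih z hz)
      convert h1 using 1
      rw [pow_succ]; group
  have cc : ∀ a ∈ closure X, ∀ b ∈ closure Y, Commute a b := by
    intro a ha b hb
    refine commute_closure (fun y hy => ?_) b hb
    exact (commute_closure (fun x hx => (hXY x hx y hy).symm) a ha).symm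
  let B : Set Γ := {z | ∃ i : ℤ, ∃ y ∈ Y, z = t ^ i * y * (t ^ i)⁻¹}
  have hsh : ∀ j : ℤ, ∀ b ∈ closure B, t ^ j * b * (t ^ j)⁻¹ ∈ closure B := by
    intro j
    apply conj_closure_le
    rintro _ ⟨i, y, hy, rfl⟩
    refine Subgroup.subset_closure ⟨j + i, y, hy, ?_⟩
    rw [zpow_add]; group
  refine commute_of_normalizing X Y {t} hgen (closure B) ?_ ?_ ?_
  · intro y hy
    exact Subgroup.subset_closure ⟨0, y, hy, by simp⟩
  · intro x hx
    apply commute_closure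
    rintro _ ⟨i, y, hy, rfl⟩
    obtain ⟨n, rfl | rfl⟩ := i.eq_nat_or_neg
    · have h1 := cc _ (pw X hX n x (Subgroup.subset_closure hx)) y (Subgroup.subset_closure hy)
      have h2 := (Commute.conj_iff (t ^ n)).2 h1
      convert h2 using 1
      · group
      · rw [zpow_natCast]
    · have h1 := cc x (Subgroup.subset_closure hx) _ (pw Y hY n y (Subgroup.subset_closure hy))
      convert h1 using 1
      rw [zpow_neg, zpow_natCast, inv_inv]
  · intro s hs b hb
    rw [Set.mem_singleton_iff] at hs; subst hs
    exact ⟨by simpa using hsh 1 b hb, by simpa using hsh (-1) b hb⟩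

theorem asc_conj {G : Type*} [Group G] {Z : Set G} {t n : G} {k : ℕ} {A : Set G} (ht : t ∈ A)
    (h : (t ^ k)⁻¹ * n * t ^ k ∈ closure Z) :
    n ∈ closure {z | ∃ g ∈ closure A, ∃ x ∈ Z, z = g * x * g⁻¹} := by
  have h1 := conj_closure_le (g := t ^ k) (S := Z)
    (K := closure {z | ∃ g ∈ closure A, ∃ x ∈ Z, z = g * x * g⁻¹}) (fun z hz =>
      Subgroup.subset_closure ⟨t ^ k, pow_mem (Subgroup.subset_closure ht) k, z, hz, rfl⟩) _ h
  convert h1 using 1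
  group

section Fib
variable {G₁ G₂ : Type*} [Group G₁] [Group G₂]

theorem case_asc [IsFinitelyPresented G₁] [IsFinitelyPresented G₂] {V : Type*} [AddCommGroup V]
    (φ₁ : G₁ → V) (φ₂ : G₂ → V)
    (h₁ : ∀ x y, φ₁ (x * y) = φ₁ x + φ₁ y) (h₂ : ∀ x y, φ₂ (x * y) = φ₂ x + φ₂ y)
    (hs₁ : Function.Surjective φ₁) (hs₂ : Function.Surjective φ₂)
    (t₁ : G₁) (t₂ : G₂) (ht : φ₁ t₁ = φ₂ t₂) (hV : ∀ v, ∃ n : ℤ, n • φ₁ t₁ = v)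
    (N₁ : Subgroup G₁) (hN₁ : ∀ x, x ∈ N₁ ↔ φ₁ x = 0)
    (N₂ : Subgroup G₂) (hN₂ : ∀ x, x ∈ N₂ ↔ φ₂ x = 0)
    (ha₁ : Asc N₁ t₁) (ha₂ : Asc N₂ t₂) :
    IsFinitelyPresented (fib φ₁ φ₂ h₁ h₂) := by
  obtain ⟨X₁, hX₁f, hX₁, hX₁t, hX₁g⟩ := ha₁
  obtain ⟨Y₂, hY₂f, hY₂, hY₂t, hY₂g⟩ := ha₂
  obtain ⟨X, hXf, hX2, hXX⟩ := lift_X φ₁ φ₂ h₁ h₂ X₁ hX₁f (fun x hx => (hN₁ x).1 (hX₁ hx))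
  obtain ⟨Y, hYf, hY1, hYY⟩ := lift_Y φ₁ φ₂ h₁ h₂ Y₂ hY₂f (fun x hx => (hN₂ x).1 (hY₂ hx))
  let t : fib φ₁ φ₂ h₁ h₂ := ⟨(t₁, t₂), ht⟩
  have hmemq := fq_mem φ₁ φ₂ h₁ h₂
  have hinj := fq_inj φ₁ φ₂ h₁ h₂
  have hspl := fq_split φ₁ φ₂ h₁ h₂
  have hq₁s := fq₁_surj φ₁ φ₂ h₁ h₂ hs₂
  have hq₂s := fq₂_surj φ₁ φ₂ h₁ h₂ hs₁
  have hq1t : fq₁ φ₁ φ₂ h₁ h₂ t = t₁ := rfl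
  have hq2t : fq₂ φ₁ φ₂ h₁ h₂ t = t₂ := rfl
  generalize fq₁ φ₁ φ₂ h₁ h₂ = q₁ at *
  generalize fq₂ φ₁ φ₂ h₁ h₂ = q₂ at *
  subst hXX hYY
  let φH : fib φ₁ φ₂ h₁ h₂ → V := fun h => φ₁ (q₁ h)
  have hφH : ∀ x y, φH (x * y) = φH x + φH y := fun x y => by
    simp only [φH]; rw [map_mul, h₁]
  have hθ : ∀ h, mkHom φH hφH h = 1 → ∃ a b, q₂ a = 1 ∧ q₁ b = 1 ∧ h = a * b := fun h hh => hspl h hh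
  obtain ⟨hgen, hnX, hnY⟩ := core_gen q₁ q₂ hinj (mkHom φH hφH) hθ X Y {t} hX2 hY1
    (by
      intro h
      obtain ⟨n, hn⟩ := hV (φH h)
      refine ⟨t ^ n, zpow_mem (Subgroup.subset_closure (Set.mem_singleton t)) n, ?_⟩
      rw [mkHom_eq, add_zpow' hφH, ← hn]
      simp only [φH]; rw [hq1t])
    (by
      intro h hh
      obtain ⟨k, hk⟩ := hX₁g (q₁ h) ((hN₁ _).2 (by rw [hmemq, hh, add_one h₂]))
      exact asc_conj ⟨t, Set.mem_singleton t, hq1t⟩ hk)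
    (by
      intro h hh
      obtain ⟨k, hk⟩ := hY₂g (q₂ h) ((hN₂ _).2 (by rw [← hmemq, hh, add_one h₁]))
      exact asc_conj ⟨t, Set.mem_singleton t, hq2t⟩ hk)
  refine fp_of_comm q₁ q₂ hq₁s hq₂s hinj (mkHom φH hφH) hθ X Y {t} hXf hYf (Set.finite_singleton t)
    hgen hnX hnY ?_
  intro n p σ hσ
  refine ⟨(fun x => ((σ t)⁻¹ * σ x * σ t, σ '' X)) '' X ∪ (fun y => ((σ t)⁻¹ * σ y * σ t, σ '' Y)) '' Y ∪
    Set.image2 (fun x y => (σ x * σ y * (σ x)⁻¹ * (σ y)⁻¹, ∅)) X Y,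
    ((hXf.image _).union (hYf.image _)).union (hXf.image2 _ hYf), ?_, ?_⟩
  · have him : ∀ Z : Set (fib φ₁ φ₂ h₁ h₂), p '' (σ '' Z) = Z := by
      intro Z; rw [Set.image_image]; simp [hσ]
    rintro _ ((⟨x, hx, rfl⟩ | ⟨y, hy, rfl⟩) | ⟨x, hx, y, hy, rfl⟩)
    · simp only [him, map_mul, map_inv, hσ]
      refine lift_closure q₁ q₂ hinj hX2 (by simp [hX2 x hx]) ?_
      simpa [hq1t] using hX₁t _ ⟨x, hx, rfl⟩
    · simp only [him, map_mul, map_inv, hσ]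
      refine lift_closure q₂ q₁ (fun h a b => hinj h b a) hY1 (by simp [hY1 y hy]) ?_
      simpa [hq2t] using hY₂t _ ⟨y, hy, rfl⟩
    · simp only [map_mul, map_inv, hσ]
      have : x * y * x⁻¹ * y⁻¹ = 1 := hinj _ (by simp [hY1 y hy]) (by simp [hX2 x hx])
      rw [this]; exact one_mem _
  · intro Γ _ π hπ hM hg x hx y hy g
    rw [Set.image_union, Set.image_union, Set.image_singleton] at hg
    refine asc_commute _ _ _ hg ?_ ?_ ?_ (π (σ x)) ⟨x, hx, rfl⟩ (π (σ y)) ⟨y, hy, rfl⟩ g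
    · rintro _ ⟨x, hx, rfl⟩
      have := hM _ (Or.inl (Or.inl ⟨x, hx, rfl⟩))
      simpa [Set.image_image] using this
    · rintro _ ⟨y, hy, rfl⟩
      have := hM _ (Or.inl (Or.inr ⟨y, hy, rfl⟩))
      simpa [Set.image_image] using this
    · rintro _ ⟨x, hx, rfl⟩ _ ⟨y, hy, rfl⟩
      have := hM _ (Or.inr ⟨x, hx, y, hy, rfl⟩)
      simp only [Set.image_empty, Subgroup.closure_empty, mem_bot, map_mul, map_inv] at this
      exact mul_inv_eq_iff_eq_mul.1 (mul_inv_eq_one.1 this)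

end Fib
end FibProd

namespace FibProd
open Group Subgroup

theorem one_dir {G : Type*} [Group G] [IsFinitelyPresented G]
    (hfree : ∀ f : FreeGroup (Fin 2) →* G, ¬ Function.Injective f)
    (φ : G → (Fin 1 → ℤ)) (h : ∀ x y, φ (x * y) = φ x + φ y) (hs : Function.Surjective φ) :
    ∃ (ψ : G → (Fin 1 → ℤ)) (_ : ∀ x y, ψ (x * y) = ψ x + ψ y) (t : G) (N : Subgroup G),
      Function.Surjective ψ ∧ ψ t = 1 ∧ (∀ x, x ∈ N ↔ ψ x = 0) ∧ Asc N t := by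
  obtain ⟨t, ht⟩ := hs 1
  have hχ : ∀ a b, (fun g => φ g 0) (a * b) = (fun g => φ g 0) a + (fun g => φ g 0) b := by
    intro a b; (try simp only); rw [h]; rfl
  have hN : ∀ x, x ∈ kerZ (fun g => φ g 0) hχ ↔ φ x = 0 := fun x => by
    rw [mem_kerZ]
    constructor
    · intro hx; funext i; rw [Subsingleton.elim i 0]; exact hx
    · intro hx; (try simp only); rw [hx]; rfl
  rcases exists_asc hfree (fun g => φ g 0) hχ t (by (try simp only); rw [ht]; rfl) with ha | ha
  · exact ⟨φ, h, t, _, hs, ht, hN, ha⟩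
  · refine ⟨fun g => - φ g, fun x y => by (try simp only); rw [h]; abel, t⁻¹, _, ?_, ?_, ?_, ha⟩
    · intro v
      obtain ⟨g, hg⟩ := hs (-v)
      exact ⟨g, by (try simp only); rw [hg, neg_neg]⟩
    · (try simp only); rw [add_inv h, ht, neg_neg]
    · intro x; rw [hN]; simp

theorem asc_top (G : Type*) [Group G] [hG : Group.FG G] : Asc (⊤ : Subgroup G) 1 := by
  obtain ⟨S, hS, hSf⟩ := Group.fg_iff.1 hG
  exact ⟨S, hSf, fun _ _ => mem_top _, fun z _ => by rw [hS]; exact mem_top _, fun n _ => ⟨0, by rw [hS]; exact mem_top _⟩⟩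

theorem theoremD {G₁ G₂ : Type*} [Group G₁] [Group G₂] [IsFinitelyPresented G₁] [IsFinitelyPresented G₂]
    (hfree : ∀ f : FreeGroup (Fin 2) →* G₁, ¬ Function.Injective f)
    (H : Subgroup G₂) (hfi : H.FiniteIndex) (hsol : Group.IsSolvable H)
    (hpr : FinitePruferRank G₂) (n : ℕ)
    (φ₁ : G₁ → (Fin n → ℤ)) (φ₂ : G₂ → (Fin n → ℤ))
    (h₁ : ∀ x y, φ₁ (x * y) = φ₁ x + φ₁ y) (h₂ : ∀ x y, φ₂ (x * y) = φ₂ x + φ₂ y)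
    (hs₁ : Function.Surjective φ₁) (hs₂ : Function.Surjective φ₂) :
    ∃ (ψ₁ : G₁ → (Fin n → ℤ)) (ψ₂ : G₂ → (Fin n → ℤ))
      (k₁ : ∀ x y, ψ₁ (x * y) = ψ₁ x + ψ₁ y) (k₂ : ∀ x y, ψ₂ (x * y) = ψ₂ x + ψ₂ y),
      Function.Surjective ψ₁ ∧ Function.Surjective ψ₂ ∧ IsFinitelyPresented (fib ψ₁ ψ₂ k₁ k₂) := by
  haveI := fg_of_fp G₁
  haveI := fg_of_fp G₂
  match n, φ₁, φ₂, h₁, h₂, hs₁, hs₂ with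
  | 0, φ₁, φ₂, h₁, h₂, hs₁, hs₂ =>
    exact ⟨φ₁, φ₂, h₁, h₂, hs₁, hs₂, case_asc φ₁ φ₂ h₁ h₂ hs₁ hs₂ 1 1 (Subsingleton.elim _ _)
      (fun v => ⟨0, Subsingleton.elim _ _⟩) ⊤ (fun x => ⟨fun _ => Subsingleton.elim _ _, fun _ => mem_top _⟩)
      ⊤ (fun x => ⟨fun _ => Subsingleton.elim _ _, fun _ => mem_top _⟩) (asc_top _) (asc_top _)⟩
  | 1, φ₁, φ₂, h₁, h₂, hs₁, hs₂ =>
    obtain ⟨ψ₁, k₁, t₁, N₁, hsψ₁, ht₁, hN₁, ha₁⟩ := one_dir hfree φ₁ h₁ hs₁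
    obtain ⟨ψ₂, k₂, t₂, N₂, hsψ₂, ht₂, hN₂, ha₂⟩ := one_dir (no_free_of_virt_solvable H hfi hsol) φ₂ h₂ hs₂
    refine ⟨ψ₁, ψ₂, k₁, k₂, hsψ₁, hsψ₂, case_asc ψ₁ ψ₂ k₁ k₂ hsψ₁ hsψ₂ t₁ t₂ (by rw [ht₁, ht₂]) ?_
      N₁ hN₁ N₂ hN₂ ha₁ ha₂⟩
    intro v
    refine ⟨v 0, ?_⟩
    rw [ht₁]
    funext i
    rw [Subsingleton.elim i 0]; simp
  | m+2, φ₁, φ₂, h₁, h₂, hs₁, hs₂ =>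
    obtain ⟨a, b, ⟨x, y, hxy⟩, K, hK, hKm⟩ := exists_fg_ker hfree (fun g => φ₁ g 0) (fun g => φ₁ g 1)
      (fun x y => by (try simp only); rw [h₁]; rfl) (fun x y => by (try simp only); rw [h₁]; rfl) (by
        intro x y
        obtain ⟨g, hg⟩ := hs₁ (Fin.cons x (fun _ => y))
        exact ⟨g, by (try simp only); rw [hg]; rfl, by (try simp only); rw [hg]; rfl⟩)
    obtain ⟨e, M, hM, hMm⟩ := exists_fg_corank (m+1) hpr H hfi hsol φ₂ h₂ hs₂
    let ψ₂ : G₂ → (Fin (m+2) → ℤ) := fun g => e (φ₂ g)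
    have k₂ : ∀ x y, ψ₂ (x * y) = ψ₂ x + ψ₂ y := fun x y => by simp only [ψ₂]; rw [h₂, map_add]
    let A : (Fin (m+2) → ℤ) → (Fin (m+2) → ℤ) := fun u =>
      Fin.cons (a * u 0 + b * u 1) (Fin.cons (-y * u 0 + x * u 1) (fun j : Fin m => u j.succ.succ) : Fin (m+1) → ℤ)
    have hA : ∀ u v, A (u + v) = A u + A v := by
      intro u v
      funext i
      refine Fin.cases ?_ (fun i => ?_) i
      · simp only [A, Fin.cons_zero, Pi.add_apply]; ring
      · refine Fin.cases ?_ (fun i => ?_) i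
        · simp only [A, Fin.cons_zero, Fin.cons_succ, Pi.add_apply]; ring
        · simp only [A, Fin.cons_succ, Pi.add_apply]
    have hAs : Function.Surjective A := by
      intro v
      refine ⟨Fin.cons (x * v 0 - b * v 1) (Fin.cons (y * v 0 + a * v 1) (fun j : Fin m => v j.succ.succ) : Fin (m+1) → ℤ), ?_⟩
      funext i
      have e1 : (1 : Fin (m+2)) = Fin.succ 0 := rfl
      refine Fin.cases ?_ (fun i => ?_) i
      · simp only [A, e1, Fin.cons_zero, Fin.cons_succ]
        linear_combination (v 0) * hxy
      · refine Fin.cases ?_ (fun i => ?_) i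
        · simp only [A, e1, Fin.cons_zero, Fin.cons_succ]
          linear_combination (v (Fin.succ 0)) * hxy
        · simp only [A, Fin.cons_succ]
    obtain ⟨ψ₁, k₁, hsψ, hfp⟩ := case_ge_two (fun g => A (φ₁ g)) ψ₂ (fun x y => by (try simp only); rw [h₁, hA]) k₂
      (hAs.comp hs₁) (e.surjective.comp hs₂) K hK hKm M hM hMm
    exact ⟨ψ₁, ψ₂, k₁, k₂, hsψ, e.surjective.comp hs₂, hfp⟩

/-- surjections onto free abelian groups -/
theorem exists_surj {G : Type*} [Group G] [hG : Group.FG G] (n : ℕ) (hn : n ≤ rkAb G) :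
    ∃ φ : G → (Fin n → ℤ), (∀ x y, φ (x * y) = φ x + φ y) ∧ Function.Surjective φ := by
  let A := Additive (Abelianization G)
  haveI : Group.FG (Abelianization G) := Group.fg_of_surjective (f := Abelianization.of) ((QuotientGroup.mk_surjective (s := _root_.commutator G)))
  haveI : Module.Finite ℤ A := Module.Finite.iff_addGroup_fg.2 inferInstance
  let F := A ⧸ Submodule.torsion ℤ A
  haveI : Module.IsTorsionFree ℤ F := inferInstance
  haveI : Module.Finite ℤ F := inferInstance
  haveI : Module.Free ℤ F := inferInstance
  have hr : Module.finrank ℤ F = rkAb G := by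
    exact congrArg Cardinal.toNat (rank_quotient_eq_of_le_torsion (M := A) (M' := Submodule.torsion ℤ A) le_rfl)
  let bF := Module.finBasis ℤ F
  refine ⟨fun g i => bF.equivFun (Submodule.Quotient.mk (Additive.ofMul (Abelianization.of g))) (Fin.castLE (hn.trans hr.ge) i), ?_, ?_⟩
  · intro x y
    funext i
    simp only [map_mul, ofMul_mul, Submodule.Quotient.mk_add, map_add, Pi.add_apply]
  · intro v
    obtain ⟨z, hz⟩ := bF.equivFun.surjective (fun j => if h : (j : ℕ) < n then v ⟨j, h⟩ else 0)
    obtain ⟨w, rfl⟩ := Submodule.Quotient.mk_surjective _ z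
    obtain ⟨g, hg⟩ := (QuotientGroup.mk_surjective (s := _root_.commutator G)) w.toMul
    refine ⟨g, ?_⟩
    funext i
    have : Additive.ofMul (Abelianization.of g) = w := hg
    simp only [this, hz]
    simp

end FibProd

namespace FibProd
open Group Subgroup

theorem rkAb_congr {G G' : Type*} [Group G] [Group G'] (e : G ≃* G') : rkAb G = rkAb G' :=
  LinearEquiv.finrank_eq (MulEquiv.toAdditive e.abelianizationCongr).toIntLinearEquiv

theorem rkAb_mul (n : ℕ) : rkAb (Multiplicative (Fin n → ℤ)) = n := by
  have e : Additive (Abelianization (Multiplicative (Fin n → ℤ))) ≃+ (Fin n → ℤ) :=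
    (MulEquiv.toAdditive (Abelianization.equivOfComm (H := Multiplicative (Fin n → ℤ))).symm).trans
      (AddEquiv.additiveMultiplicative (Fin n → ℤ))
  unfold rkAb
  rw [e.toIntLinearEquiv.finrank_eq]
  simp

end FibProd

theorem exists_fp_normal_fibre_product_maximal_corank {G₁ G₂ : Type*} [Group G₁] [Group G₂]
    (hfp₁ : FinitelyPresentedGroup G₁) (hfp₂ : FinitelyPresentedGroup G₂)
    (hfree : ∀ f : FreeGroup (Fin 2) →* G₁, ¬ Function.Injective f)
    (hvs : ∃ H : Subgroup G₂, H.FiniteIndex ∧ IsSolvable ↥H)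
    (hpr : FinitePruferRank G₂) :
    ∃ (H : Subgroup (G₁ × G₂)) (hHn : H.Normal),
      Subgroup.map (MonoidHom.fst G₁ G₂) H = ⊤ ∧
      Subgroup.map (MonoidHom.snd G₁ G₂) H = ⊤ ∧
      (commutator G₁).prod (commutator G₂) ≤ H ∧
      FinitelyPresentedGroup ↥H ∧
      rkQuot H hHn = min (rkAb G₁) (rkAb G₂) := by
  haveI := FibProd.fp_iff.1 hfp₁
  haveI := FibProd.fp_iff.1 hfp₂
  haveI := FibProd.fg_of_fp G₁
  haveI := FibProd.fg_of_fp G₂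
  obtain ⟨L, hLfi, hLs⟩ := hvs
  obtain ⟨φ₁, h₁, hs₁⟩ := FibProd.exists_surj (G := G₁) (min (rkAb G₁) (rkAb G₂)) (min_le_left _ _)
  obtain ⟨φ₂, h₂, hs₂⟩ := FibProd.exists_surj (G := G₂) (min (rkAb G₁) (rkAb G₂)) (min_le_right _ _)
  obtain ⟨ψ₁, ψ₂, k₁, k₂, hsψ₁, hsψ₂, hfp⟩ :=
    FibProd.theoremD hfree L hLfi hLs hpr _ φ₁ φ₂ h₁ h₂ hs₁ hs₂
  generalize min (rkAb G₁) (rkAb G₂) = n at *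
  let f : G₁ × G₂ →* Multiplicative (Fin n → ℤ) := FibProd.mkHom (fun x => ψ₁ x.1 - ψ₂ x.2) (by
    intro x y
    simp only [Prod.fst_mul, Prod.snd_mul, k₁, k₂]; abel)
  have hf : Function.Surjective f := by
    intro v
    obtain ⟨x, hx⟩ := hsψ₁ v.toAdd
    refine ⟨(x, 1), ?_⟩
    change Multiplicative.ofAdd (ψ₁ x - ψ₂ 1) = v
    rw [hx, FibProd.add_one k₂, sub_zero]; rfl
  have hH : FibProd.fib ψ₁ ψ₂ k₁ k₂ = f.ker := by
    ext x
    rw [FibProd.mem_fib, MonoidHom.mem_ker]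
    exact sub_eq_zero.symm
  have hcomm : ∀ {G : Type _} [Group G] (ψ : G → (Fin n → ℤ)) (k : ∀ x y, ψ (x * y) = ψ x + ψ y) (x : G),
      x ∈ commutator G → ψ x = 0 := by
    intro G _ ψ k x hx
    exact Abelianization.commutator_subset_ker (FibProd.mkHom ψ k) hx
  have hcomm' : ∀ (ψ : G₂ → (Fin n → ℤ)) (k : ∀ x y, ψ (x * y) = ψ x + ψ y) (x : G₂),
      x ∈ commutator G₂ → ψ x = 0 := by
    intro ψ k x hx
    exact Abelianization.commutator_subset_ker (FibProd.mkHom ψ k) hx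
  have hn : (FibProd.fib ψ₁ ψ₂ k₁ k₂).Normal := by rw [hH]; infer_instance
  refine ⟨FibProd.fib ψ₁ ψ₂ k₁ k₂, hn, ?_, ?_, ?_, FibProd.fp_iff.2 hfp, ?_⟩
  · rw [eq_top_iff]
    intro x _
    obtain ⟨y, hy⟩ := hsψ₂ (ψ₁ x)
    exact ⟨(x, y), hy.symm, rfl⟩
  · rw [eq_top_iff]
    intro y _
    obtain ⟨x, hx⟩ := hsψ₁ (ψ₂ y)
    exact ⟨(x, y), hx, rfl⟩
  · intro x hx
    obtain ⟨ha, hb⟩ := Subgroup.mem_prod.1 hx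
    rw [FibProd.mem_fib, hcomm ψ₁ k₁ _ ha, hcomm' ψ₂ k₂ _ hb]
  · unfold rkQuot
    exact (FibProd.rkAb_congr ((QuotientGroup.quotientMulEquivOfEq hH).trans
      (QuotientGroup.quotientKerEquivOfSurjective f hf))).trans (FibProd.rkAb_mul n)
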